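/- Let 0 < c < √2 and let U_c be a traveling wave solution of ΔU + ic ∂U/∂y₂ + U(1−|U|²) = 0 in ℝ². Then as |y| → ∞, U_c(y) − 1 = O(⟨y⟩^{−1}). -/

import Mathlib

noncomputable section
open scoped Topology ENNReal NNReal RealInnerProductSpace
open Filter MeasureTheory Metric

/-- Euclidean space `ℝ^d`. -/
abbrev Euc (d : ℕ) : Type := EuclideanSpace ℝ (Fin d)

/-- The `i`-th standard basis vector of `ℝ^d`. -/
noncomputable def basisVec {d : ℕ} (i : Fin d) : Euc d := EuclideanSpace.single i (1 : ℝ)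

/-- The Laplacian of a function on `ℝ^d`, as a sum of second directional derivatives. -/
noncomputable def lap {d : ℕ} {F : Type*} [NormedAddCommGroup F] [NormedSpace ℝ F]
    (f : Euc d → F) (x : Euc d) : F :=
  ∑ i : Fin d, fderiv ℝ (fun y => fderiv ℝ f y (basisVec i)) x (basisVec i)

/-- The divergence of a vector field on `ℝ^d`. -/
noncomputable def dvg {d : ℕ} (V : Euc d → Euc d) (x : Euc d) : ℝ :=
  ∑ i : Fin d, fderiv ℝ (fun y => V y i) x (basisVec i)

/-- The `d`-th standard unit vector `e_d` (the last coordinate direction). -/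
noncomputable def eDir (d : ℕ) : Euc d :=
  if h : 0 < d then EuclideanSpace.single ⟨d - 1, by omega⟩ (1 : ℝ) else 0

/-- The Japanese bracket `⟨x⟩ = √(1+|x|²)`. -/
noncomputable def jap {d : ℕ} (x : Euc d) : ℝ := Real.sqrt (1 + ‖x‖ ^ 2)

/-- A smooth bounded obstacle `Ω ⊆ ℝ^d`, together with its unit outer normal field `ν`
on `∂Ω`. -/
structure Obstacle (d : ℕ) where
  region : Set (Euc d)
  normal : Euc d → Euc d
  isOpen : IsOpen region
  bounded : Bornology.IsBounded region
  nonempty : region.Nonempty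
  normal_unit : ∀ x ∈ frontier region, ‖normal x‖ = 1

/-- The closed exterior region `ℝ^d ∖ Ω`. -/
def Obstacle.ext {d : ℕ} (O : Obstacle d) : Set (Euc d) := (O.region)ᶜ

/-- The open exterior region `ℝ^d ∖ closure Ω`. -/
def Obstacle.extOpen {d : ℕ} (O : Obstacle d) : Set (Euc d) := (closure O.region)ᶜ

/-- `Φ` is a classical solution of the irrotational subsonic flow equation past the
obstacle `Ω`, with far-field speed `δ` in the direction `e_d`:
`∇·((1−|∇Φ|²)∇Φ) = 0` in `ℝ^d ∖ Ω`, `∂Φ/∂ν = 0` on `∂Ω`, `∇Φ(x) → δ e_d` as `|x| → ∞`. -/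
def IsFlowSolution {d : ℕ} (O : Obstacle d) (δ : ℝ) (Φ : Euc d → ℝ) : Prop :=
  ContDiffOn ℝ 2 Φ O.ext ∧
  (∀ x ∈ O.extOpen, dvg (fun y => (1 - ‖gradient Φ y‖ ^ 2) • gradient Φ y) x = 0) ∧
  (∀ x ∈ frontier O.region, ⟪gradient Φ x, O.normal x⟫ = (0 : ℝ)) ∧
  Tendsto (fun x => gradient Φ x) (Filter.cocompact (Euc d)) (nhds (δ • eDir d))

/-- `u` is a smooth solution of the Gross–Pitaevskii obstacle problem
`ε²Δu + u(1−|u|²) = 0` in `ℝ^d ∖ Ω`, `∂u/∂ν = 0` on `∂Ω`. -/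
def IsGPSolution {d : ℕ} (O : Obstacle d) (ε : ℝ) (u : Euc d → ℂ) : Prop :=
  (∀ n : ℕ, ContDiffOn ℝ n u O.ext) ∧
  (∀ x ∈ O.extOpen, (ε ^ 2 : ℂ) * lap u x + u x * (1 - (‖u x‖ : ℂ) ^ 2) = 0) ∧
  (∀ x ∈ frontier O.region, fderiv ℝ u x (O.normal x) = 0)

/-- The family `(ρ_ε, Φ_ε)`, `0 < ε < ε₀`, is a vortex-free family of solutions of the
Gross–Pitaevskii obstacle problem: `u_ε = ρ_ε e^{iΦ_ε/ε}` solves the problem and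
`ρ_ε → 1 − |∇Φ^δ|²`, `∇Φ_ε → ∇Φ^δ` uniformly on `ℝ² ∖ Ω` as `ε → 0⁺`. -/
def IsVortexFreeFamily (O : Obstacle 2) (δ : ℝ) (Φδ : Euc 2 → ℝ) (ε₀ : ℝ)
    (ρ Φ : ℝ → Euc 2 → ℝ) : Prop :=
  (∀ ε : ℝ, 0 < ε → ε < ε₀ →
    IsGPSolution O ε (fun x => (ρ ε x : ℂ) * Complex.exp (Complex.I * ((Φ ε x / ε : ℝ) : ℂ)))) ∧
  TendstoUniformlyOn (fun ε x => gradient (Φ ε) x) (fun x => gradient Φδ x)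
    (𝓝[>] (0 : ℝ)) O.ext ∧
  TendstoUniformlyOn (fun ε x => ρ ε x) (fun x => 1 - ‖gradient Φδ x‖ ^ 2)
    (𝓝[>] (0 : ℝ)) O.ext

/-- First coordinate direction in `ℝ²`. -/
noncomputable def e1 : Euc 2 := basisVec (0 : Fin 2)

/-- Second coordinate direction in `ℝ²`. -/
noncomputable def e2 : Euc 2 := basisVec (1 : Fin 2)

/-- Reflection across the line `{y₁ = 0}` in `ℝ²`. -/
noncomputable def refl1 (y : Euc 2) : Euc 2 := y - (2 * y 0) • e1

/-- `U` is a (classical) traveling wave solution of the Gross–Pitaevskii equation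
`ΔU + ic ∂U/∂y₂ + U(1−|U|²) = 0` in `ℝ²`. -/
def IsTravelingWave (c : ℝ) (U : Euc 2 → ℂ) : Prop :=
  ContDiff ℝ 2 U ∧
  ∀ y : Euc 2, lap U y + Complex.I * (c : ℂ) * fderiv ℝ U y e2
    + U y * (1 - (‖U y‖ : ℂ) ^ 2) = 0

/-- The linearized operator `𝕃₀[φ] = Δφ + ic ∂φ/∂y₂ + (1−|U|²)φ − 2(U·φ)U`
around a traveling wave `U`, where `a · b = Re(a b̄)`. -/
noncomputable def linGP (c : ℝ) (U φ : Euc 2 → ℂ) (y : Euc 2) : ℂ :=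
  lap φ y + Complex.I * (c : ℂ) * fderiv ℝ φ y e2 + (1 - (‖U y‖ : ℂ) ^ 2) * φ y
    - 2 * (((U y * (starRingEnd ℂ) (φ y)).re : ℝ) : ℂ) * U y

/-- Nondegeneracy of a traveling wave `U`: the only bounded solutions of the linearized
equation in the half-plane `{y₁ > 0}` with Neumann condition on `{y₁ = 0}` are the
real linear combinations of `iU` and `∂U/∂y₂`. -/
def NondegenerateTW (c : ℝ) (U : Euc 2 → ℂ) : Prop :=
  ∀ φ : Euc 2 → ℂ, ContDiff ℝ 2 φ →
    (∀ y : Euc 2, 0 < y 0 → linGP c U φ y = 0) →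
    (∀ y : Euc 2, y 0 = 0 → fderiv ℝ φ y e1 = 0) →
    (∃ M : ℝ, ∀ y : Euc 2, 0 ≤ y 0 → ‖φ y‖ ≤ M) →
    ∃ β₁ β₂ : ℝ, ∀ y : Euc 2, 0 ≤ y 0 →
      φ y = (β₁ : ℂ) * (Complex.I * U y) + (β₂ : ℂ) * fderiv ℝ U y e2

/-- `w` is the degree-one Ginzburg–Landau vortex `w⁺(y) = S₀(|y|) e^{iθ}` in `ℝ²`. -/
def IsGLVortexPlus (w : Euc 2 → ℂ) : Prop :=
  ContDiff ℝ 2 w ∧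
  (∀ y : Euc 2, lap w y + w y * (1 - (‖w y‖ : ℂ) ^ 2) = 0) ∧
  ∃ S₀ : ℝ → ℝ, ∀ y : Euc 2, y ≠ 0 →
    w y = ((S₀ ‖y‖ / ‖y‖ : ℝ) : ℂ) * ((y 0 : ℂ) + Complex.I * (y 1 : ℂ))

/-- The Ginzburg–Landau energy `∫ (|∇U|²/2 + (1−|U|²)²/4)` on `ℝ²`. -/
noncomputable def glEnergy (U : Euc 2 → ℂ) : ℝ≥0∞ :=
  ∫⁻ y : Euc 2, ((‖fderiv ℝ U y‖₊ : ℝ≥0∞) ^ 2 / 2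
    + (‖1 - ‖U y‖ ^ 2‖₊ : ℝ≥0∞) ^ 2 / 4)

/-- The momentum (in the `y₂` direction) of a map `U : ℝ² → ℂ`. -/
noncomputable def momentum (U : Euc 2 → ℂ) : ℝ :=
  ∫ y : Euc 2, (Complex.I * fderiv ℝ U y e2 * (starRingEnd ℂ) (U y - 1)).re
/-- `W^{1,2}` Sobolev norm of a function over a set `S`. -/
noncomputable def sobW12 {d : ℕ} (S : Set (Euc d)) (ρ : Euc d → ℝ) : ℝ≥0∞ :=
  eLpNorm ρ 2 (volume.restrict S) + eLpNorm (fun y => gradient ρ y) 2 (volume.restrict S)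

/-- `W^{2,4}` Sobolev norm of a function over a set `S`. -/
noncomputable def sobW24 {d : ℕ} (S : Set (Euc d)) (ρ : Euc d → ℝ) : ℝ≥0∞ :=
  eLpNorm ρ 4 (volume.restrict S) + eLpNorm (fun y => gradient ρ y) 4 (volume.restrict S)
    + eLpNorm (fun y => fderiv ℝ (fun z => gradient ρ z) y) 4 (volume.restrict S)

/-- The norm `‖ρ‖_{*,1} = sup_y ‖ρ‖_{W^{2,4}(B₁(y)∩S)} + ‖ρ‖_{W^{1,2}(S)}`. -/
noncomputable def normStar1 {d : ℕ} (S : Set (Euc d)) (ρ : Euc d → ℝ) : ℝ≥0∞ :=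
  (⨆ y : Euc d, sobW24 (Metric.ball y 1 ∩ S) ρ) + sobW12 S ρ

/-- The norm `‖Φ‖_{*,2} = ‖∇Φ‖_{L²(S)} + ‖∇Φ‖_{L⁴(S)}`. -/
noncomputable def normStar2 {d : ℕ} (S : Set (Euc d)) (Φ : Euc d → ℝ) : ℝ≥0∞ :=
  eLpNorm (fun y => gradient Φ y) 2 (volume.restrict S)
    + eLpNorm (fun y => gradient Φ y) 4 (volume.restrict S)

/-- The norm `‖f‖_{**,1} = ‖f‖_{L²(S)}`. -/
noncomputable def normSS1 {d : ℕ} (S : Set (Euc d)) (f : Euc d → ℝ) : ℝ≥0∞ :=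
  eLpNorm f 2 (volume.restrict S)

/-- The norm `‖g‖_{**,2} = ‖g‖_{L²(S)} + ‖g‖_{L⁴(S)}`. -/
noncomputable def normSS2 {d : ℕ} (S : Set (Euc d)) (g : Euc d → Euc d) : ℝ≥0∞ :=
  eLpNorm g 2 (volume.restrict S) + eLpNorm g 4 (volume.restrict S)

/-- The linear operator
`L₁(ρ,Φ) = Δρ − 2a²ρ + 2a b·∇Φ` (with `a = ρ^δ+ρ₁` and `b = ∇_xΦ^δ` in stretched
variables). -/
noncomputable def L1op {d : ℕ} (a : Euc d → ℝ) (b : Euc d → Euc d)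
    (ρ Φ : Euc d → ℝ) (y : Euc d) : ℝ :=
  lap ρ y - 2 * (a y) ^ 2 * ρ y + 2 * a y * ⟪b y, gradient Φ y⟫

/-- The linear operator `L₂(ρ,Φ) = ∇·(a²∇Φ) + ∇·(2 a ρ b)`. -/
noncomputable def L2op {d : ℕ} (a : Euc d → ℝ) (b : Euc d → Euc d)
    (ρ Φ : Euc d → ℝ) (y : Euc d) : ℝ :=
  dvg (fun z => (a z) ^ 2 • gradient Φ z) y + dvg (fun z => (2 * a z * ρ z) • b z) y

/-- Supremum (in `ℝ≥0∞`) of a real-valued function over a set. -/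
noncomputable def supENN (S : Set (Euc 2)) (f : Euc 2 → ℝ) : ℝ≥0∞ :=
  ⨆ y ∈ S, ENNReal.ofReal (f y)

/-- Hölder seminorm of exponent `γ` over a set `S`. -/
noncomputable def holderSemiOn {F : Type*} [NormedAddCommGroup F] (γ : ℝ) (S : Set (Euc 2))
    (f : Euc 2 → F) : ℝ≥0∞ :=
  ⨆ x ∈ S, ⨆ y ∈ S, ENNReal.ofReal (‖f x - f y‖ / ‖x - y‖ ^ γ)

/-- `C^{2,γ}` Hölder norm over a set `S`. -/
noncomputable def holderC2 (γ : ℝ) (S : Set (Euc 2)) (f : Euc 2 → ℂ) : ℝ≥0∞ :=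
  supENN S (fun y => ‖f y‖) + supENN S (fun y => ‖fderiv ℝ f y‖)
    + supENN S (fun y => ‖fderiv ℝ (fun z => fderiv ℝ f z) y‖)
    + holderSemiOn γ S (fun y => fderiv ℝ (fun z => fderiv ℝ f z) y)

/-- `C^{0,γ}` Hölder norm over a set `S`. -/
noncomputable def holderC0 (γ : ℝ) (S : Set (Euc 2)) (f : Euc 2 → ℂ) : ℝ≥0∞ :=
  supENN S (fun y => ‖f y‖) + holderSemiOn γ S f

/-- The weighted norm `‖φ‖_*`: the `C^{2,γ}` norm of `φ` on `{|y| < R} ∩ D`, plus the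
weighted decay norms of `ψ₁, ∇ψ₁, ψ₂, ∇ψ₂` on `{|y| > R} ∩ D`, where `φ = iWψ`,
`ψ = ψ₁ + iψ₂`. -/
noncomputable def normStarTW (γ σ R : ℝ) (D : Set (Euc 2)) (W φ : Euc 2 → ℂ) : ℝ≥0∞ :=
  holderC2 γ (D ∩ {y | ‖y‖ < R}) φ
    + supENN (D ∩ {y | R < ‖y‖}) (fun y => |((φ y / (Complex.I * W y)).re)|)
    + supENN (D ∩ {y | R < ‖y‖})
        (fun y => jap y ^ (1 + σ) * ‖gradient (fun z => (φ z / (Complex.I * W z)).re) y‖)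
    + supENN (D ∩ {y | R < ‖y‖}) (fun y => jap y ^ (1 + σ) * |((φ y / (Complex.I * W y)).im)|)
    + supENN (D ∩ {y | R < ‖y‖})
        (fun y => jap y ^ (2 + σ) * ‖gradient (fun z => (φ z / (Complex.I * W z)).im) y‖)

/-- The interior norm `‖h‖_{**,i} = ‖iWh‖_{C^{0,γ}} + ‖⟨y⟩^{2+σ}h₁‖_∞ + ‖⟨y⟩^{1+σ}h₂‖_∞`
on `{|y| > R} ∩ D`. -/
noncomputable def normSSi (γ σ R : ℝ) (D : Set (Euc 2)) (W h : Euc 2 → ℂ) : ℝ≥0∞ :=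
  holderC0 γ (D ∩ {y | R < ‖y‖}) (fun y => Complex.I * W y * h y)
    + supENN (D ∩ {y | R < ‖y‖}) (fun y => jap y ^ (2 + σ) * |(h y).re|)
    + supENN (D ∩ {y | R < ‖y‖}) (fun y => jap y ^ (1 + σ) * |(h y).im|)

/-- The boundary norm `‖g‖_{**,b} = ‖⟨y⟩^{2+σ}g₁‖_{L^∞(∂)} + ‖⟨y⟩^{1+σ}g₂‖_{L^∞(∂)}`. -/
noncomputable def normSSb (σ : ℝ) (B : Set (Euc 2)) (g : Euc 2 → ℂ) : ℝ≥0∞ :=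
  supENN B (fun y => jap y ^ (2 + σ) * |(g y).re|)
    + supENN B (fun y => jap y ^ (1 + σ) * |(g y).im|)

/-- Dot product of the (complex) gradients of `f` and `g`: `∇f · ∇g`. -/
noncomputable def cgradDot (f g : Euc 2 → ℂ) (y : Euc 2) : ℂ :=
  ∑ j : Fin 2, fderiv ℝ f y (basisVec j) * fderiv ℝ g y (basisVec j)

/-- Dot product of a real vector `v` with the gradient of a complex function: `v · ∇g`. -/
noncomputable def vecDotC (v : Euc 2) (g : Euc 2 → ℂ) (y : Euc 2) : ℂ :=
  ∑ j : Fin 2, ((v j : ℝ) : ℂ) * fderiv ℝ g y (basisVec j)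

/-- The linear operator
`L̃_{ε,1}[ψ] = Δψ − 2iρ_ε²|W|²ψ₂ + (∇W/W)·∇ψ + 2i∇_xΦ_ε(x₀)·∇ψ`, at `x = x₀ + εy`. -/
noncomputable def Ltilde1 (ρe Φe : Euc 2 → ℝ) (x₀ : Euc 2) (ε : ℝ) (W : Euc 2 → ℂ)
    (ψ : Euc 2 → ℂ) (y : Euc 2) : ℂ :=
  lap ψ y - 2 * Complex.I * (((ρe (x₀ + ε • y)) ^ 2 * ‖W y‖ ^ 2 * (ψ y).im : ℝ) : ℂ)
    + (1 / W y) * cgradDot W ψ y + 2 * Complex.I * vecDotC (gradient Φe x₀) ψ y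

/-- The linear operator
`L̃_{ε,2}[ψ] = 2i(∇_xΦ_ε(x) − ∇_xΦ_ε(x₀))·∇ψ + 2ε ∇_x log ρ_ε(x)·∇ψ`, at `x = x₀ + εy`. -/
noncomputable def Ltilde2 (ρe Φe : Euc 2 → ℝ) (x₀ : Euc 2) (ε : ℝ)
    (ψ : Euc 2 → ℂ) (y : Euc 2) : ℂ :=
  2 * Complex.I * vecDotC (gradient Φe (x₀ + ε • y) - gradient Φe x₀) ψ y
    + 2 * ((ε : ℝ) : ℂ) * vecDotC (gradient (fun x => Real.log (ρe x)) (x₀ + ε • y)) ψ y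

/-- The rescaled Gross–Pitaevskii solution operator
`S[v] = Δv + vρ_ε²(1−|v|²) + 2ε∇_x log ρ_ε·∇v + 2i∇_xΦ_ε·∇v`, at `x = x₀ + εy`. -/
noncomputable def SOp (ρe Φe : Euc 2 → ℝ) (x₀ : Euc 2) (ε : ℝ)
    (v : Euc 2 → ℂ) (y : Euc 2) : ℂ :=
  lap v y + v y * (((ρe (x₀ + ε • y)) ^ 2 : ℝ) : ℂ) * ((1 - ‖v y‖ ^ 2 : ℝ) : ℂ)
    + 2 * ((ε : ℝ) : ℂ) * vecDotC (gradient (fun x => Real.log (ρe x)) (x₀ + ε • y)) v y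
    + 2 * Complex.I * vecDotC (gradient Φe (x₀ + ε • y)) v y

/-- The exterior of the shifted rescaled obstacle `Ω_{ε,x₀} = (Ω − x₀)/ε`. -/
def extD (O : Obstacle 2) (x₀ : Euc 2) (ε : ℝ) : Set (Euc 2) :=
  {y | x₀ + ε • y ∈ O.region}ᶜ

/-- The open exterior of the shifted rescaled obstacle. -/
def extDOpen (O : Obstacle 2) (x₀ : Euc 2) (ε : ℝ) : Set (Euc 2) :=
  {y | x₀ + ε • y ∈ closure O.region}ᶜ

/-- The boundary of the shifted rescaled obstacle. -/
def bdryD (O : Obstacle 2) (x₀ : Euc 2) (ε : ℝ) : Set (Euc 2) :=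
  {y | x₀ + ε • y ∈ frontier O.region}

/-- `Z₀ = iW/(1+|y|⁴)`. -/
noncomputable def Zfun0 (W : Euc 2 → ℂ) (y : Euc 2) : ℂ :=
  Complex.I * W y / (((1 + ‖y‖ ^ 4 : ℝ)) : ℂ)

/-- `Z₁ = (∂W/∂y₂)/(1+|y|⁴)`. -/
noncomputable def Zfun1 (W : Euc 2 → ℂ) (y : Euc 2) : ℂ :=
  fderiv ℝ W y e2 / (((1 + ‖y‖ ^ 4 : ℝ)) : ℂ)

/-- Divergence form complex operator `∇·(a∇v)` for a real weight `a`. -/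
noncomputable def divAC (a : Euc 2 → ℝ) (v : Euc 2 → ℂ) (y : Euc 2) : ℂ :=
  ∑ j : Fin 2, fderiv ℝ (fun z => ((a z : ℝ) : ℂ) * fderiv ℝ v z (basisVec j)) y (basisVec j)

/-- partial derivative in the first variable -/
def px (f : Euc 2 → ℝ) : Euc 2 → ℝ := fun y => fderiv ℝ f y (basisVec 0)
/-- partial derivative in the second variable -/
def py (f : Euc 2 → ℝ) : Euc 2 → ℝ := fun y => fderiv ℝ f y (basisVec 1)

lemma lap_eq (f : Euc 2 → ℝ) (y : Euc 2) : lap f y = px (px f) y + py (py f) y := by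
  unfold lap; rw [Fin.sum_univ_two]; rfl

lemma px_contDiff {f : Euc 2 → ℝ} (hf : ContDiff ℝ 2 f) : ContDiff ℝ 1 (px f) :=
  (hf.fderiv_right (m := 1) (by norm_num)).clm_apply contDiff_const
lemma py_contDiff {f : Euc 2 → ℝ} (hf : ContDiff ℝ 2 f) : ContDiff ℝ 1 (py f) :=
  (hf.fderiv_right (m := 1) (by norm_num)).clm_apply contDiff_const
lemma px_contDiff_top {f : Euc 2 → ℝ} (hf : ContDiff ℝ (⊤ : ℕ∞) f) : ContDiff ℝ (⊤ : ℕ∞) (px f) :=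
  (hf.fderiv_right (m := (⊤ : ℕ∞)) (by simp)).clm_apply contDiff_const
lemma py_contDiff_top {f : Euc 2 → ℝ} (hf : ContDiff ℝ (⊤ : ℕ∞) f) : ContDiff ℝ (⊤ : ℕ∞) (py f) :=
  (hf.fderiv_right (m := (⊤ : ℕ∞)) (by simp)).clm_apply contDiff_const
lemma px_cont {f : Euc 2 → ℝ} (hf : ContDiff ℝ 1 f) : Continuous (px f) :=
  (hf.continuous_fderiv (by norm_num)).clm_apply continuous_const
lemma py_cont {f : Euc 2 → ℝ} (hf : ContDiff ℝ 1 f) : Continuous (py f) :=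
  (hf.continuous_fderiv (by norm_num)).clm_apply continuous_const
lemma px_diff {f : Euc 2 → ℝ} (hf : ContDiff ℝ 2 f) : Differentiable ℝ (px f) :=
  (px_contDiff hf).differentiable (by norm_num)
lemma py_diff {f : Euc 2 → ℝ} (hf : ContDiff ℝ 2 f) : Differentiable ℝ (py f) :=
  (py_contDiff hf).differentiable (by norm_num)

lemma px_add {f g : Euc 2 → ℝ} (hf : Differentiable ℝ f) (hg : Differentiable ℝ g) :
    px (fun y => f y + g y) = fun y => px f y + px g y := by
  funext y; unfold px; rw [fderiv_fun_add (hf y) (hg y)]; rfl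
lemma py_add {f g : Euc 2 → ℝ} (hf : Differentiable ℝ f) (hg : Differentiable ℝ g) :
    py (fun y => f y + g y) = fun y => py f y + py g y := by
  funext y; unfold py; rw [fderiv_fun_add (hf y) (hg y)]; rfl
lemma px_sub {f g : Euc 2 → ℝ} (hf : Differentiable ℝ f) (hg : Differentiable ℝ g) :
    px (fun y => f y - g y) = fun y => px f y - px g y := by
  funext y; unfold px; rw [fderiv_fun_sub (hf y) (hg y)]; rfl
lemma py_sub {f g : Euc 2 → ℝ} (hf : Differentiable ℝ f) (hg : Differentiable ℝ g) :
    py (fun y => f y - g y) = fun y => py f y - py g y := by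
  funext y; unfold py; rw [fderiv_fun_sub (hf y) (hg y)]; rfl
lemma px_mul {f g : Euc 2 → ℝ} (hf : Differentiable ℝ f) (hg : Differentiable ℝ g) :
    px (fun y => f y * g y) = fun y => px f y * g y + f y * px g y := by
  funext y; unfold px; rw [fderiv_fun_mul (hf y) (hg y)]
  simp [smul_eq_mul]; ring
lemma py_mul {f g : Euc 2 → ℝ} (hf : Differentiable ℝ f) (hg : Differentiable ℝ g) :
    py (fun y => f y * g y) = fun y => py f y * g y + f y * py g y := by
  funext y; unfold py; rw [fderiv_fun_mul (hf y) (hg y)]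
  simp [smul_eq_mul]; ring
lemma px_const (a : ℝ) : px (fun _ => a) = fun _ => 0 := by
  funext y; simp [px]
lemma py_const (a : ℝ) : py (fun _ => a) = fun _ => 0 := by
  funext y; simp [py]
lemma px_const_mul (a : ℝ) {f : Euc 2 → ℝ} (hf : Differentiable ℝ f) :
    px (fun y => a * f y) = fun y => a * px f y := by
  rw [px_mul (differentiable_const a) hf, px_const]; funext y; simp
lemma py_const_mul (a : ℝ) {f : Euc 2 → ℝ} (hf : Differentiable ℝ f) :
    py (fun y => a * f y) = fun y => a * py f y := by
  rw [py_mul (differentiable_const a) hf, py_const]; funext y; simp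
lemma px_sub_const {f : Euc 2 → ℝ} (m : ℝ) : px (fun y => f y - m) = px f := by
  funext y; unfold px; rw [fderiv_sub_const]
lemma py_sub_const {f : Euc 2 → ℝ} (m : ℝ) : py (fun y => f y - m) = py f := by
  funext y; unfold py; rw [fderiv_sub_const]
/-- one-variable chain rule -/
lemma px_comp {f : Euc 2 → ℝ} (hf : Differentiable ℝ f) {h h' : ℝ → ℝ}
    (hh : ∀ y, HasDerivAt h (h' (f y)) (f y)) :
    px (fun y => h (f y)) = fun y => h' (f y) * px f y := by
  funext y
  have := (hh y).comp_hasFDerivAt y (hf y).hasFDerivAt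
  unfold px
  rw [show (fun y => h (f y)) = h ∘ f from rfl, this.fderiv]; simp
lemma py_comp {f : Euc 2 → ℝ} (hf : Differentiable ℝ f) {h h' : ℝ → ℝ}
    (hh : ∀ y, HasDerivAt h (h' (f y)) (f y)) :
    py (fun y => h (f y)) = fun y => h' (f y) * py f y := by
  funext y
  have := (hh y).comp_hasFDerivAt y (hf y).hasFDerivAt
  unfold py
  rw [show (fun y => h (f y)) = h ∘ f from rfl, this.fderiv]; simp

lemma px_py_comm {f : Euc 2 → ℝ} (hf : ContDiff ℝ 2 f) : px (py f) = py (px f) := by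
  funext y
  have h1 : DifferentiableAt ℝ (fderiv ℝ f) y :=
    ((hf.fderiv_right (m := 1) (by norm_num)).differentiable (by norm_num)) y
  have key : ∀ v w : Euc 2, fderiv ℝ (fun z => fderiv ℝ f z v) y w = fderiv ℝ (fderiv ℝ f) y w v := by
    intro v w
    have := (h1.hasFDerivAt.clm_apply (hasFDerivAt_const v y)).fderiv
    rw [this]; simp
  have hsymm : IsSymmSndFDerivAt ℝ f y := hf.contDiffAt.isSymmSndFDerivAt (by simp)
  unfold px py
  rw [key, key]
  exact hsymm _ _

lemma vec_decomp (v : Euc 2) : v = v 0 • (basisVec 0 : Euc 2) + v 1 • (basisVec 1 : Euc 2) := by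
  ext i; fin_cases i <;> simp [basisVec]

lemma norm_sq_eq (v : Euc 2) : ‖v‖ ^ 2 = v 0 ^ 2 + v 1 ^ 2 := by
  rw [EuclideanSpace.norm_sq_eq, Fin.sum_univ_two]; simp

lemma norm_fderiv_le (f : Euc 2 → ℝ) (y : Euc 2) : ‖fderiv ℝ f y‖ ≤ |px f y| + |py f y| := by
  refine ContinuousLinearMap.opNorm_le_bound _ (by positivity) (fun v => ?_)
  have h0 : |v 0| ≤ ‖v‖ := by
    simpa using PiLp.norm_apply_le v 0
  have h1 : |v 1| ≤ ‖v‖ := by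
    simpa using PiLp.norm_apply_le v 1
  have : fderiv ℝ f y v = v 0 * px f y + v 1 * py f y := by
    conv_lhs => rw [vec_decomp v]
    simp [px, py]
  rw [this, Real.norm_eq_abs]
  calc |v 0 * px f y + v 1 * py f y| ≤ |v 0| * |px f y| + |v 1| * |py f y| := by
        rw [← abs_mul, ← abs_mul]; exact abs_add_le _ _
    _ ≤ ‖v‖ * |px f y| + ‖v‖ * |py f y| := by gcongr
    _ = _ := by ring

lemma norm_basisVec (i : Fin 2) : ‖(basisVec i : Euc 2)‖ = 1 := by
  simp [basisVec]

lemma abs_px_le (f : Euc 2 → ℝ) (y : Euc 2) : |px f y| ≤ ‖fderiv ℝ f y‖ := by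
  have := (fderiv ℝ f y).le_opNorm (basisVec 0)
  simpa [norm_basisVec, px] using this
lemma abs_py_le (f : Euc 2 → ℝ) (y : Euc 2) : |py f y| ≤ ‖fderiv ℝ f y‖ := by
  have := (fderiv ℝ f y).le_opNorm (basisVec 1)
  simpa [norm_basisVec, py] using this

lemma px_compact {f : Euc 2 → ℝ} (hf : HasCompactSupport f) : HasCompactSupport (px f) :=
  (hf.fderiv (𝕜 := ℝ)).comp_left (g := fun L : Euc 2 →L[ℝ] ℝ => L (basisVec 0)) (by simp)
lemma py_compact {f : Euc 2 → ℝ} (hf : HasCompactSupport f) : HasCompactSupport (py f) :=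
  (hf.fderiv (𝕜 := ℝ)).comp_left (g := fun L : Euc 2 →L[ℝ] ℝ => L (basisVec 1)) (by simp)

lemma integral_fderiv_zero {F : Euc 2 → ℝ} (hF : ContDiff ℝ 1 F) (hc : HasCompactSupport F) (v : Euc 2) :
    ∫ y, fderiv ℝ F y v = 0 := by
  have hcont : Continuous (fun y => fderiv ℝ F y v) :=
    (hF.continuous_fderiv (by norm_num)).clm_apply continuous_const
  have hcc : HasCompactSupport (fun y => fderiv ℝ F y v) :=
    (hc.fderiv (𝕜 := ℝ)).comp_left (g := fun L : Euc 2 →L[ℝ] ℝ => L v) (by simp)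
  have := integral_mul_fderiv_eq_neg_fderiv_mul_of_integrable (μ := (volume : Measure (Euc 2)))
    (f := fun _ : Euc 2 => (1 : ℝ)) (g := F) (v := v) (by simp) 
    (by simpa using hcont.integrable_of_hasCompactSupport hcc)
    (by simpa using hF.continuous.integrable_of_hasCompactSupport hc)
    (fun x _ => by fun_prop) (fun x _ => (hF.differentiable (by norm_num)) x)
  simpa using this

lemma integral_px {F : Euc 2 → ℝ} (hF : ContDiff ℝ 1 F) (hc : HasCompactSupport F) :
    ∫ y, px F y = 0 := integral_fderiv_zero hF hc _
lemma integral_py {F : Euc 2 → ℝ} (hF : ContDiff ℝ 1 F) (hc : HasCompactSupport F) :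
    ∫ y, py F y = 0 := integral_fderiv_zero hF hc _

/-- divergence theorem with a compactly supported weight -/
lemma integral_div {ζ P Q : Euc 2 → ℝ} (hζ : ContDiff ℝ 1 ζ) (hc : HasCompactSupport ζ)
    (hP : ContDiff ℝ 1 P) (hQ : ContDiff ℝ 1 Q) :
    ∫ y, ζ y * (px P y + py Q y) = - ∫ y, (px ζ y * P y + py ζ y * Q y) := by
  have dζ := hζ.differentiable (by norm_num)
  have dP := hP.differentiable (by norm_num)
  have dQ := hQ.differentiable (by norm_num)
  have h1 := integral_px (hζ.mul hP) (hc.mul_right (f' := P))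
  have h2 := integral_py (hζ.mul hQ) (hc.mul_right (f' := Q))
  change ∫ y, px (fun y => ζ y * P y) y = 0 at h1
  change ∫ y, py (fun y => ζ y * Q y) y = 0 at h2
  rw [px_mul dζ dP] at h1
  rw [py_mul dζ dQ] at h2
  have i1 : Integrable (fun y => px ζ y * P y) :=
    ((px_cont hζ).mul hP.continuous).integrable_of_hasCompactSupport ((px_compact hc).mul_right)
  have i2 : Integrable (fun y => py ζ y * Q y) :=
    ((py_cont hζ).mul hQ.continuous).integrable_of_hasCompactSupport ((py_compact hc).mul_right)
  have i3 : Integrable (fun y => ζ y * px P y) :=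
    (hζ.continuous.mul (px_cont hP)).integrable_of_hasCompactSupport (hc.mul_right)
  have i4 : Integrable (fun y => ζ y * py Q y) :=
    (hζ.continuous.mul (py_cont hQ)).integrable_of_hasCompactSupport (hc.mul_right)
  rw [integral_add i1 i3] at h1
  rw [integral_add i2 i4] at h2
  rw [integral_add i1 i2]
  simp_rw [mul_add]
  rw [integral_add i3 i4]
  linarith

lemma hasDerivAt_integral_shift {f g : Euc 2 → ℝ} (hf : Continuous f) (hfc : HasCompactSupport f)
    (hg : ContDiff ℝ 1 g) (hgc : HasCompactSupport g) (v : Euc 2) :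
    HasDerivAt (fun h : ℝ => ∫ y, f y * g (y + h • v)) (∫ y, f y * fderiv ℝ g y v) 0 := by
  have hcont : Continuous (fun y => fderiv ℝ g y v) :=
    (hg.continuous_fderiv (by norm_num)).clm_apply continuous_const
  have hcc : HasCompactSupport (fun y => fderiv ℝ g y v) :=
    (hgc.fderiv (𝕜 := ℝ)).comp_left (g := fun L : Euc 2 →L[ℝ] ℝ => L v) (by simp)
  obtain ⟨K, hK⟩ := hcc.exists_bound_of_continuous hcont
  have key := hasDerivAt_integral_of_dominated_loc_of_deriv_le (μ := (volume : Measure (Euc 2)))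
    (F := fun (h : ℝ) y => f y * g (y + h • v)) (F' := fun h y => f y * fderiv ℝ g (y + h • v) v)
    (x₀ := (0 : ℝ)) (s := Set.univ) (bound := fun y => |f y| * K) Filter.univ_mem
    (by
      filter_upwards with h
      exact (hf.mul (hg.continuous.comp (by fun_prop))).aestronglyMeasurable)
    ((hf.mul (hg.continuous.comp (by fun_prop))).integrable_of_hasCompactSupport hfc.mul_right)
    ((hf.mul (hcont.comp (by fun_prop : Continuous fun y : Euc 2 => y + (0:ℝ) • v))).aestronglyMeasurable)
    (by
      filter_upwards with y h _
      rw [norm_mul]; exact mul_le_mul_of_nonneg_left (hK _) (norm_nonneg _))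
    ((hf.integrable_of_hasCompactSupport hfc).abs.mul_const K)
    (by
      filter_upwards with y h _
      have h1 : HasDerivAt (fun h : ℝ => y + h • v) v h := by
        simpa using ((hasDerivAt_id h).smul_const v).const_add y
      have h2 := ((hg.differentiable (by norm_num)) (y + h • v)).hasFDerivAt.comp_hasDerivAt h h1
      exact h2.const_mul (f y))
  simpa using key.2

lemma jac_identity_aux {w q : Euc 2 → ℝ} (hw : ContDiff ℝ 1 w) (hc : HasCompactSupport w)
    (hq : ContDiff ℝ 1 q) (hqc : HasCompactSupport q) :
    ∫ y, px w y * py q y = ∫ y, py w y * px q y := by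
  have h1 := hasDerivAt_integral_shift (px_cont hw) (px_compact hc) hq hqc (basisVec 1)
  have h2 := hasDerivAt_integral_shift (px_cont hq) (px_compact hqc) hw hc (-basisVec 1)
  have e : ∀ h : ℝ, ∫ y, px w y * q (y + h • basisVec 1)
      = - ∫ y, px q y * w (y + h • (-basisVec 1)) := by
    intro h
    have hs : ContDiff ℝ 1 (fun y => q (y + h • basisVec 1)) := hq.comp (by fun_prop)
    have a1 := integral_px (hw.mul hs) (hc.mul_right)
    change ∫ y, px (fun y => w y * q (y + h • basisVec 1)) y = 0 at a1
    rw [px_mul (hw.differentiable (by norm_num)) (hs.differentiable (by norm_num))] at a1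
    have a2 : px (fun y => q (y + h • basisVec 1)) = fun y => px q (y + h • basisVec 1) := by
      funext y; unfold px; rw [fderiv_comp_add_right]
    have hcq : Continuous (fun y => px q (y + h • basisVec 1)) :=
      (px_cont hq).comp (by fun_prop)
    have i1 : Integrable (fun y => px w y * q (y + h • basisVec 1)) :=
      ((px_cont hw).mul hs.continuous).integrable_of_hasCompactSupport (px_compact hc).mul_right
    have i2 : Integrable (fun y => w y * px q (y + h • basisVec 1)) :=
      (hw.continuous.mul hcq).integrable_of_hasCompactSupport hc.mul_right
    rw [a2] at a1
    beta_reduce at a1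
    rw [integral_add i1 i2] at a1
    have a3 : ∫ y, px q y * w (y + h • (-basisVec 1)) = ∫ y, w y * px q (y + h • basisVec 1) := by
      rw [← integral_add_right_eq_self _ (h • basisVec 1)]
      congr 1; funext y
      rw [show y + h • basisVec 1 + h • -basisVec 1 = y by simp]; ring
    rw [a3]; linarith
  have h3 : HasDerivAt (fun h : ℝ => ∫ y, px w y * q (y + h • basisVec 1))
      (- ∫ y, px q y * fderiv ℝ w y (-basisVec 1)) 0 := by
    have := h2.neg
    refine this.congr_of_eventuallyEq ?_
    filter_upwards with h
    exact e h
  have h4 := h1.unique h3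
  have h5 : (- ∫ y, px q y * fderiv ℝ w y (-basisVec 1)) = ∫ y, py w y * px q y := by
    rw [← integral_neg]; congr 1; funext y; simp [py, mul_comm]
  rw [← h5, ← h4]; rfl

/-- base cutoff: `1` on the unit ball, supported in the ball of radius `2`. -/
def bumpE : ContDiffBump (0 : Euc 2) := ⟨1, 2, one_pos, one_lt_two⟩
def eta (R : ℝ) (y : Euc 2) : ℝ := bumpE (R⁻¹ • y)

lemma eta_contDiff (R : ℝ) : ContDiff ℝ (⊤ : ℕ∞) (eta R) :=
  bumpE.contDiff.comp (contDiff_const_smul _)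
lemma eta_nonneg (R : ℝ) (y : Euc 2) : 0 ≤ eta R y := bumpE.nonneg
lemma eta_le_one (R : ℝ) (y : Euc 2) : eta R y ≤ 1 := bumpE.le_one
lemma eta_one {R : ℝ} (hR : 0 < R) {y : Euc 2} (hy : ‖y‖ ≤ R) : eta R y = 1 := by
  apply bumpE.one_of_mem_closedBall
  simp only [mem_closedBall, dist_zero_right, norm_smul, norm_inv, Real.norm_eq_abs, abs_of_pos hR]
  change R⁻¹ * ‖y‖ ≤ 1
  rw [inv_mul_le_iff₀ hR]; linarith
lemma eta_zero {R : ℝ} (hR : 0 < R) {y : Euc 2} (hy : 2 * R ≤ ‖y‖) : eta R y = 0 := by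
  apply bumpE.zero_of_le_dist
  simp only [dist_zero_right, norm_smul, norm_inv, Real.norm_eq_abs, abs_of_pos hR]
  change 2 ≤ R⁻¹ * ‖y‖
  rw [le_inv_mul_iff₀ hR]; linarith
lemma eta_compact {R : ℝ} (hR : 0 < R) : HasCompactSupport (eta R) := by
  apply HasCompactSupport.intro (isCompact_closedBall (0 : Euc 2) (2 * R))
  intro y hy
  apply eta_zero hR
  simp only [mem_closedBall, dist_zero_right, not_le] at hy
  exact hy.le

lemma px_zero_of_eventually {f : Euc 2 → ℝ} {y : Euc 2} {a : ℝ} (h : f =ᶠ[𝓝 y] fun _ => a) : px f y = 0 := by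
  unfold px; rw [h.fderiv_eq]; simp
lemma py_zero_of_eventually {f : Euc 2 → ℝ} {y : Euc 2} {a : ℝ} (h : f =ᶠ[𝓝 y] fun _ => a) : py f y = 0 := by
  unfold py; rw [h.fderiv_eq]; simp

lemma px_scale {f : Euc 2 → ℝ} (hf : Differentiable ℝ f) (a : ℝ) :
    px (fun y => f (a • y)) = fun y => a * px f (a • y) := by
  funext y
  have h1 : HasFDerivAt (fun y : Euc 2 => a • y) (a • ContinuousLinearMap.id ℝ (Euc 2)) y :=
    (hasFDerivAt_id y).const_smul a
  have := (hf (a • y)).hasFDerivAt.comp y h1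
  unfold px
  rw [show (fun y => f (a • y)) = f ∘ (fun y => a • y) from rfl, this.fderiv]; simp
lemma py_scale {f : Euc 2 → ℝ} (hf : Differentiable ℝ f) (a : ℝ) :
    py (fun y => f (a • y)) = fun y => a * py f (a • y) := by
  funext y
  have h1 : HasFDerivAt (fun y : Euc 2 => a • y) (a • ContinuousLinearMap.id ℝ (Euc 2)) y :=
    (hasFDerivAt_id y).const_smul a
  have := (hf (a • y)).hasFDerivAt.comp y h1
  unfold py
  rw [show (fun y => f (a • y)) = f ∘ (fun y => a • y) from rfl, this.fderiv]; simp

lemma bdd_of_compact {f : Euc 2 → ℝ} (hf : Continuous f) (hc : HasCompactSupport f) :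
    ∃ K, ∀ y, |f y| ≤ K := by
  obtain ⟨K, hK⟩ := hc.exists_bound_of_continuous hf
  exact ⟨K, fun y => hK y⟩

lemma eta_bounds : ∃ K : ℝ, 1 ≤ K ∧ ∀ R : ℝ, 0 < R → ∀ y : Euc 2,
    |px (eta R) y| ≤ K / R ∧ |py (eta R) y| ≤ K / R ∧
    |px (px (eta R)) y| ≤ K / R ^ 2 ∧ |py (py (eta R)) y| ≤ K / R ^ 2 := by
  have hb : ContDiff ℝ (⊤ : ℕ∞) (fun y => bumpE y) := bumpE.contDiff
  have hbc : HasCompactSupport (fun y => bumpE y) := bumpE.hasCompactSupport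
  have h1 := px_contDiff_top hb
  have h2 := py_contDiff_top hb
  have h3 := px_contDiff_top h1
  have h4 := py_contDiff_top h2
  have d0 : Differentiable ℝ (fun y => bumpE y) := hb.differentiable (by simp)
  have d1 : Differentiable ℝ (px (fun y => bumpE y)) := h1.differentiable (by simp)
  have d2 : Differentiable ℝ (py (fun y => bumpE y)) := h2.differentiable (by simp)
  obtain ⟨K1, k1⟩ := bdd_of_compact h1.continuous (px_compact hbc)
  obtain ⟨K2, k2⟩ := bdd_of_compact h2.continuous (py_compact hbc)
  obtain ⟨K3, k3⟩ := bdd_of_compact h3.continuous (px_compact (px_compact hbc))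
  obtain ⟨K4, k4⟩ := bdd_of_compact h4.continuous (py_compact (py_compact hbc))
  refine ⟨1 + |K1| + |K2| + |K3| + |K4|, by linarith [abs_nonneg K1, abs_nonneg K2, abs_nonneg K3, abs_nonneg K4], ?_⟩
  intro R hR y
  have a1 : px (eta R) = fun y => R⁻¹ * px (fun y => bumpE y) (R⁻¹ • y) := px_scale d0 _
  have a2 : py (eta R) = fun y => R⁻¹ * py (fun y => bumpE y) (R⁻¹ • y) := py_scale d0 _
  have s1 : Differentiable ℝ (fun y => px (fun y => bumpE y) (R⁻¹ • y)) := by fun_prop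
  have s2 : Differentiable ℝ (fun y => py (fun y => bumpE y) (R⁻¹ • y)) := by fun_prop
  have a3 : px (px (eta R)) = fun y => R⁻¹ * (R⁻¹ * px (px (fun y => bumpE y)) (R⁻¹ • y)) := by
    rw [a1, px_const_mul _ s1, px_scale d1]
  have a4 : py (py (eta R)) = fun y => R⁻¹ * (R⁻¹ * py (py (fun y => bumpE y)) (R⁻¹ • y)) := by
    rw [a2, py_const_mul _ s2, py_scale d2]
  have e1 := abs_nonneg K1
  have e2 := abs_nonneg K2
  have e3 := abs_nonneg K3
  have e4 := abs_nonneg K4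
  have l1 := le_abs_self K1
  have l2 := le_abs_self K2
  have l3 := le_abs_self K3
  have l4 := le_abs_self K4
  have b1 := k1 (R⁻¹ • y)
  have b2 := k2 (R⁻¹ • y)
  have b3 := k3 (R⁻¹ • y)
  have b4 := k4 (R⁻¹ • y)
  rw [a3, a4, a1, a2]
  simp only [abs_mul, abs_inv, abs_of_pos hR]
  refine ⟨?_, ?_, ?_, ?_⟩
  · rw [div_eq_inv_mul]; gcongr; linarith
  · rw [div_eq_inv_mul]; gcongr; linarith
  · rw [div_eq_inv_mul, ← mul_assoc, show R⁻¹ * R⁻¹ = (R ^ 2)⁻¹ by rw [pow_two, mul_inv]]; gcongr; linarith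
  · rw [div_eq_inv_mul, ← mul_assoc, show R⁻¹ * R⁻¹ = (R ^ 2)⁻¹ by rw [pow_two, mul_inv]]; gcongr; linarith

/-- the derivative of the cutoff vanishes off the annulus -/
lemma px_eta_zero {R : ℝ} (hR : 0 < R) {y : Euc 2} (hy : ‖y‖ < R ∨ 2 * R < ‖y‖) : px (eta R) y = 0 := by
  rcases hy with h | h
  · apply px_zero_of_eventually (a := 1)
    filter_upwards [(continuous_norm.continuousAt (x := y)).eventually_lt_const h] with z hz
    exact eta_one hR hz.le
  · apply px_zero_of_eventually (a := 0)
    filter_upwards [(continuous_norm.continuousAt (x := y)).eventually_const_lt h] with z hz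
    exact eta_zero hR hz.le
lemma py_eta_zero {R : ℝ} (hR : 0 < R) {y : Euc 2} (hy : ‖y‖ < R ∨ 2 * R < ‖y‖) : py (eta R) y = 0 := by
  rcases hy with h | h
  · apply py_zero_of_eventually (a := 1)
    filter_upwards [(continuous_norm.continuousAt (x := y)).eventually_lt_const h] with z hz
    exact eta_one hR hz.le
  · apply py_zero_of_eventually (a := 0)
    filter_upwards [(continuous_norm.continuousAt (x := y)).eventually_const_lt h] with z hz
    exact eta_zero hR hz.le

/-- the null-Lagrangian identity for a `C¹` pair -/
lemma jac_identity {w q : Euc 2 → ℝ} (hw : ContDiff ℝ 1 w) (hc : HasCompactSupport w)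
    (hq : ContDiff ℝ 1 q) : ∫ y, px w y * py q y = ∫ y, py w y * px q y := by
  obtain ⟨r, hr⟩ := hc.isCompact.isBounded.subset_closedBall (0 : Euc 2)
  set R := |r| + 1 with hR
  have hR0 : 0 < R := by positivity
  have hout : ∀ y : Euc 2, R ≤ ‖y‖ → px w y = 0 ∧ py w y = 0 := by
    intro y hy
    have : y ∉ tsupport w := by
      intro h
      have := hr h
      simp only [mem_closedBall, dist_zero_right] at this
      linarith [le_abs_self r]
    have h0 : w =ᶠ[𝓝 y] fun _ => 0 := notMem_tsupport_iff_eventuallyEq.mp this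
    exact ⟨px_zero_of_eventually h0, py_zero_of_eventually h0⟩
  have he : ContDiff ℝ 1 (eta R) := (eta_contDiff R).of_le (by exact_mod_cast le_top)
  have h := jac_identity_aux hw hc (he.mul hq) ((eta_compact hR0).mul_right)
  change ∫ y, px w y * py (fun y => eta R y * q y) y = ∫ y, py w y * px (fun y => eta R y * q y) y at h
  rw [px_mul (he.differentiable (by norm_num)) (hq.differentiable (by norm_num)),
    py_mul (he.differentiable (by norm_num)) (hq.differentiable (by norm_num))] at h
  have e1 : ∀ y, px w y * (py (eta R) y * q y + eta R y * py q y) = px w y * py q y := by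
    intro y
    by_cases hy : R ≤ ‖y‖
    · rw [(hout y hy).1]; simp
    · push Not at hy
      rw [py_eta_zero hR0 (Or.inl hy), eta_one hR0 hy.le]; ring
  have e2 : ∀ y, py w y * (px (eta R) y * q y + eta R y * px q y) = py w y * px q y := by
    intro y
    by_cases hy : R ≤ ‖y‖
    · rw [(hout y hy).2]; simp
    · push Not at hy
      rw [px_eta_zero hR0 (Or.inl hy), eta_one hR0 hy.le]; ring
  simpa only [e1, e2] using h

/-- `W^{1,1} ⊂ L²` in the plane -/
lemma gns_sq : ∃ K : ℝ, 0 ≤ K ∧ ∀ F : Euc 2 → ℝ, ContDiff ℝ 1 F → HasCompactSupport F →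
    ∫ y, F y ^ 2 ≤ K * (∫ y, (|px F y| + |py F y|)) ^ 2 := by
  have hp : Real.HolderConjugate (Module.finrank ℝ (Euc 2)) 2 := by
    rw [finrank_euclideanSpace_fin]; exact ⟨by norm_num, by norm_num, by norm_num⟩
  refine ⟨(lintegralPowLePowLIntegralFDerivConst (volume : Measure (Euc 2)) 2 : ℝ), by positivity, ?_⟩
  intro F hF hc
  have h := lintegral_pow_le_pow_lintegral_fderiv (volume : Measure (Euc 2)) hF hc hp
  have i1 : Integrable (fun y => F y ^ 2) :=
    (hF.continuous.pow 2).integrable_of_hasCompactSupport (by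
      simp_rw [pow_two]; exact hc.mul_right)
  have i2 : Integrable (fun y => fderiv ℝ F y) :=
    (hF.continuous_fderiv (by norm_num)).integrable_of_hasCompactSupport (hc.fderiv (𝕜 := ℝ))
  have i3 : Integrable (fun y => |px F y| + |py F y|) :=
    ((px_cont hF).integrable_of_hasCompactSupport (px_compact hc)).abs.add
      ((py_cont hF).integrable_of_hasCompactSupport (py_compact hc)).abs
  have e1 : ∫⁻ y, ‖F y‖ₑ ^ (2 : ℝ) = ENNReal.ofReal (∫ y, F y ^ 2) := by
    rw [ofReal_integral_eq_lintegral_ofReal i1 (by filter_upwards with y; positivity)]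
    congr 1; funext y
    rw [← ofReal_norm, ENNReal.ofReal_rpow_of_nonneg (norm_nonneg _) (by norm_num)]
    congr 1
    rw [Real.rpow_two]; simp
  have e2 : ∫⁻ y, ‖fderiv ℝ F y‖ₑ = ENNReal.ofReal (∫ y, ‖fderiv ℝ F y‖) :=
    (ofReal_integral_norm_eq_lintegral_enorm i2).symm
  rw [e1, e2, ENNReal.ofReal_rpow_of_nonneg (by positivity) (by norm_num)] at h
  rw [← ENNReal.ofReal_coe_nnreal, ← ENNReal.ofReal_mul (by positivity)] at h
  rw [ENNReal.ofReal_le_ofReal_iff (by positivity)] at h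
  refine h.trans ?_
  rw [Real.rpow_two]
  gcongr
  · exact i2.norm
  · intro y; exact norm_fderiv_le _ _

/-- energy density -/
def XX (s φ : Euc 2 → ℝ) (y : Euc 2) : ℝ :=
  s y ^ 2 + px s y ^ 2 + py s y ^ 2 + px φ y ^ 2 + py φ y ^ 2

/-- the hydrodynamical system outside a ball -/
structure TW (c R0 : ℝ) (s φ : Euc 2 → ℝ) : Prop where
  c_pos : 0 < c
  c_lt : c ^ 2 < 2
  R0_ge : 1 ≤ R0
  hs : ContDiff ℝ 2 s
  hφ : ContDiff ℝ 2 φ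
  eq1 : ∀ y, R0 ≤ ‖y‖ → px (px s) y + py (py s) y + px s y ^ 2 + py s y ^ 2
    - px φ y ^ 2 - py φ y ^ 2 - c * py φ y + 1 - Real.exp (2 * s y) = 0
  eq2 : ∀ y, R0 ≤ ‖y‖ → px (px φ) y + py (py φ) y
    + 2 * (px s y * px φ y + py s y * py φ y) + c * py s y = 0
  small : ∀ ε > 0, ∃ R, ∀ y : Euc 2, R ≤ ‖y‖ → |s y| ≤ ε ∧ |φ y| ≤ ε ∧ |px s y| ≤ ε ∧ |py s y| ≤ ε
    ∧ |px φ y| ≤ ε ∧ |py φ y| ≤ ε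
  int : Integrable (XX s φ)

def extS (R : ℝ) : Set (Euc 2) := {y | R ≤ ‖y‖}
def annS (a b : ℝ) : Set (Euc 2) := {y | a ≤ ‖y‖ ∧ ‖y‖ ≤ b}
lemma extS_meas (R : ℝ) : MeasurableSet (extS R) :=
  (isClosed_le continuous_const continuous_norm).measurableSet
lemma annS_meas (a b : ℝ) : MeasurableSet (annS a b) :=
  ((isClosed_le continuous_const continuous_norm).inter
    (isClosed_le continuous_norm continuous_const)).measurableSet
lemma annS_compact (a b : ℝ) : IsCompact (annS a b) := by
  refine (isCompact_closedBall (0 : Euc 2) b).of_isClosed_subset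
    ((isClosed_le continuous_const continuous_norm).inter
    (isClosed_le continuous_norm continuous_const)) ?_
  intro y hy
  simpa using hy.2

lemma XX_nonneg (s φ : Euc 2 → ℝ) (y : Euc 2) : 0 ≤ XX s φ y := by unfold XX; positivity

/-- exterior energy -/
def EE (s φ : Euc 2 → ℝ) (R : ℝ) : ℝ := ∫ y in extS R, XX s φ y

lemma EE_nonneg (s φ : Euc 2 → ℝ) (R : ℝ) : 0 ≤ EE s φ R :=
  setIntegral_nonneg (extS_meas R) (fun y _ => XX_nonneg s φ y)

lemma EE_anti {s φ : Euc 2 → ℝ} (h : Integrable (XX s φ)) {R R' : ℝ} (hR : R ≤ R') :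
    EE s φ R' ≤ EE s φ R := by
  apply setIntegral_mono_set h.integrableOn
  · filter_upwards with y; exact XX_nonneg s φ y
  · have hsub : extS R' ⊆ extS R := fun y (hy : R' ≤ ‖y‖) => hR.trans hy
    exact hsub.eventuallyLE

lemma EE_tendsto {s φ : Euc 2 → ℝ} (h : Integrable (XX s φ)) :
    Tendsto (EE s φ) atTop (𝓝 0) := by
  have := tendsto_setIntegral_of_antitone (μ := (volume : Measure (Euc 2))) (f := XX s φ)
    (s := fun n : ℕ => extS n) (fun n => extS_meas _)
    (fun m n hmn y (hy : (n : ℝ) ≤ ‖y‖) => (by exact_mod_cast hmn : (m : ℝ) ≤ n).trans hy)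
    ⟨0, h.integrableOn⟩
  have he : ⋂ n : ℕ, extS (n : ℝ) = ∅ := by
    ext y
    simp only [Set.mem_iInter, Set.mem_empty_iff_false, iff_false, not_forall]
    obtain ⟨n, hn⟩ := exists_nat_gt ‖y‖
    exact ⟨n, fun hy : (n : ℝ) ≤ ‖y‖ => by linarith⟩
  rw [he] at this
  simp only [Measure.restrict_empty, integral_zero_measure] at this
  rw [Metric.tendsto_atTop] at this ⊢
  intro ε hε
  obtain ⟨N, hN⟩ := this ε hε
  refine ⟨N, fun R hR => ?_⟩
  have h1 := hN N le_rfl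
  simp only [dist_zero_right, Real.norm_eq_abs] at h1 ⊢
  have h2 := EE_anti h hR
  rw [abs_of_nonneg (EE_nonneg _ _ _)]
  calc _ ≤ _ := h2
    _ ≤ _ := le_abs_self _
    _ < _ := h1

lemma exp_bound_two {x : ℝ} (hx : |x| ≤ 1) : |Real.exp x - 1 - x| ≤ x ^ 2 :=
  Real.abs_exp_sub_one_sub_id_le hx

lemma coercive_alg {c s f a b p q : ℝ} (hc : 0 < c) (hc2 : c ^ 2 < 2)
    (hs : |s| ≤ (2 - c ^ 2) / 32) (hf : |f| ≤ (2 - c ^ 2) / 32) :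
    (2 - c ^ 2) / 8 * (s ^ 2 + a ^ 2 + b ^ 2 + p ^ 2 + q ^ 2) ≤
      a ^ 2 + b ^ 2 + p ^ 2 + q ^ 2 + 2 * c * s * q + s * (Real.exp (2 * s) - 1)
      - s * (a ^ 2 + b ^ 2) + s * (p ^ 2 + q ^ 2) - 2 * f * (a * p + b * q) := by
  set μ := (2 - c ^ 2) / 4 with hμ
  have hμ0 : 0 < μ := by rw [hμ]; linarith
  have hμ1 : μ ≤ 1 / 2 := by rw [hμ]; nlinarith [sq_nonneg c]
  have hs' : |s| ≤ μ / 8 := by rw [hμ]; linarith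
  have hf' : |f| ≤ μ / 8 := by rw [hμ]; linarith
  have e1 : s * (Real.exp (2 * s) - 1) ≥ 2 * s ^ 2 - μ / 2 * s ^ 2 := by
    have h1 := exp_bound_two (x := 2 * s) (by rw [abs_mul]; norm_num; linarith)
    have h2 : |s * (Real.exp (2 * s) - 1 - 2 * s)| ≤ μ / 8 * (2 * s) ^ 2 := by
      rw [abs_mul]; exact mul_le_mul hs' h1 (abs_nonneg _) (by positivity)
    have h3 := (abs_le.mp h2).1
    nlinarith
  have e2 : 2 * s ^ 2 + 2 * c * s * q + q ^ 2 ≥ μ * (s ^ 2 + q ^ 2) := by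
    have h1 : (2 - μ) * (2 * s ^ 2 + 2 * c * s * q + q ^ 2 - μ * (s ^ 2 + q ^ 2))
      = ((2 - μ) * s + c * q) ^ 2 + ((2 - μ) * (1 - μ) - c ^ 2) * q ^ 2 := by ring
    have h2 : 0 ≤ (2 - μ) * (1 - μ) - c ^ 2 := by
      have : c ^ 2 = 2 - 4 * μ := by rw [hμ]; ring
      rw [this]; nlinarith
    have h3 : 0 ≤ (2 - μ) * (2 * s ^ 2 + 2 * c * s * q + q ^ 2 - μ * (s ^ 2 + q ^ 2)) := by
      rw [h1]; positivity
    have h4 := nonneg_of_mul_nonneg_right h3 (by linarith)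
    linarith
  have e3 : |s * (a ^ 2 + b ^ 2)| ≤ μ / 8 * (a ^ 2 + b ^ 2) := by
    rw [abs_mul, abs_of_nonneg (by positivity : 0 ≤ a ^ 2 + b ^ 2)]; gcongr
  have e4 : |s * (p ^ 2 + q ^ 2)| ≤ μ / 8 * (p ^ 2 + q ^ 2) := by
    rw [abs_mul, abs_of_nonneg (by positivity : 0 ≤ p ^ 2 + q ^ 2)]; gcongr
  have e5 : |f * (2 * (a * p + b * q))| ≤ μ / 8 * (a ^ 2 + b ^ 2 + p ^ 2 + q ^ 2) := by
    rw [abs_mul]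
    have : |2 * (a * p + b * q)| ≤ a ^ 2 + b ^ 2 + p ^ 2 + q ^ 2 := by
      rw [abs_le]; constructor <;> nlinarith [sq_nonneg (a - p), sq_nonneg (b - q), sq_nonneg (a + p), sq_nonneg (b + q)]
    exact mul_le_mul hf' this (abs_nonneg _) (by positivity)
  have f3 := (abs_le.mp e3).2
  have f4 := (abs_le.mp e4).1
  have f5 := (abs_le.mp e5).2
  have : (2 - c ^ 2) / 8 = μ / 2 := by rw [hμ]; ring
  rw [this]
  nlinarith [sq_nonneg a, sq_nonneg b, sq_nonneg p, sq_nonneg q, sq_nonneg s]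

lemma cross_alg {l x k u v : ℝ} (hl : 0 < l) : 2 * |x| * |k| * (|u| * |v|) ≤ l * x ^ 2 * v ^ 2 + 1 / l * k ^ 2 * u ^ 2 := by
  rw [← sq_abs x, ← sq_abs k, ← sq_abs u, ← sq_abs v]
  have h : l * (l * |x| ^ 2 * |v| ^ 2 + 1 / l * |k| ^ 2 * |u| ^ 2 - 2 * |x| * |k| * (|u| * |v|))
     = (l * (|x| * |v|) - |k| * |u|) ^ 2 := by field_simp; ring
  have := nonneg_of_mul_nonneg_right (h ▸ sq_nonneg _ : 0 ≤ l * (l * |x| ^ 2 * |v| ^ 2 + 1 / l * |k| ^ 2 * |u| ^ 2 - 2 * |x| * |k| * (|u| * |v|))) hl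
  linarith

lemma amgm_sq {l x k P B X : ℝ} (hl : 0 < l) (hP : P ^ 2 ≤ B * X) (hB : 0 ≤ B) (hX : 0 ≤ X) :
    2 * |x * k * P| ≤ l * x ^ 2 * X + 1 / l * k ^ 2 * B := by
  have ha : 0 ≤ l * x ^ 2 * X := by positivity
  have hb : 0 ≤ 1 / l * k ^ 2 * B := by positivity
  have hab : (l * x ^ 2 * X) * (1 / l * k ^ 2 * B) = x ^ 2 * k ^ 2 * (B * X) := by field_simp
  have h1 : (x * k * P) ^ 2 ≤ (l * x ^ 2 * X) * (1 / l * k ^ 2 * B) := by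
    rw [hab, mul_pow, mul_pow]; gcongr
  have h2 : (2 * |x * k * P|) ^ 2 ≤ (l * x ^ 2 * X + 1 / l * k ^ 2 * B) ^ 2 := by
    rw [mul_pow, sq_abs]
    nlinarith [sq_nonneg (l * x ^ 2 * X - 1 / l * k ^ 2 * B)]
  exact (le_abs_self _).trans (abs_le_of_sq_le_sq h2 (by positivity))

lemma TW.contX {c R0 : ℝ} {s φ : Euc 2 → ℝ} (h : TW c R0 s φ) : Continuous (XX s φ) := by
  have a := h.hs.continuous
  have h1 := px_cont (h.hs.of_le (by norm_num) : ContDiff ℝ 1 s)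
  have h2 := py_cont (h.hs.of_le (by norm_num) : ContDiff ℝ 1 s)
  have h3 := px_cont (h.hφ.of_le (by norm_num) : ContDiff ℝ 1 φ)
  have h4 := py_cont (h.hφ.of_le (by norm_num) : ContDiff ℝ 1 φ)
  unfold XX; fun_prop

lemma vol_ball_scale (T : ℝ) (hT : 0 < T) :
    (volume : Measure (Euc 2)).real (closedBall 0 T) = T ^ 2 * (volume : Measure (Euc 2)).real (closedBall 0 1) := by
  have := Measure.addHaar_closedBall_mul (volume : Measure (Euc 2)) 0 hT.le zero_le_one
  rw [mul_one, finrank_euclideanSpace_fin] at this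
  rw [Measure.real, this, ENNReal.toReal_mul, ENNReal.toReal_ofReal (by positivity)]; rfl

set_option maxHeartbeats 2000000 in
/-- core inequality in Caccioppoli -/
lemma cacc_core {c R0 : ℝ} {s φ : Euc 2 → ℝ} (h : TW c R0 s φ) {K : ℝ} (hK1 : 1 ≤ K)
    (hK : ∀ R : ℝ, 0 < R → ∀ y : Euc 2,
    |px (eta R) y| ≤ K / R ∧ |py (eta R) y| ≤ K / R ∧
    |px (px (eta R)) y| ≤ K / R ^ 2 ∧ |py (py (eta R)) y| ≤ K / R ^ 2)
    {R m : ℝ} (hR : R0 ≤ R) 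
    (hsm : ∀ y : Euc 2, R ≤ ‖y‖ → |s y| ≤ (2 - c ^ 2) / 32 ∧ |φ y - m| ≤ (2 - c ^ 2) / 32)
    {θ : ℝ} (hθ : 0 < θ) {T : ℝ} (hT : 2 * R ≤ T) :
    (2 - c ^ 2) / 16 * (EE s φ (2 * R) - EE s φ T) ≤
      (80 / (2 - c ^ 2) * 4 * K ^ 2 / R ^ 2) * (∫ y in annS R (2 * R), (s y ^ 2 + (φ y - m) ^ 2))
      + θ * (8 * K ^ 2 * (volume : Measure (Euc 2)).real (closedBall 0 1)) + 3 / θ * EE s φ T := by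
  have hc0 : 0 < 2 - c ^ 2 := by linarith [h.c_lt]
  have hR0 : 0 < R := by linarith [h.R0_ge]
  have hT0 : 0 < T := by linarith
  set l := (2 - c ^ 2) / 8 with hl
  have hl0 : 0 < l := by positivity
  have hs1 : ContDiff ℝ 1 s := h.hs.of_le (by norm_num)
  have hφ1 : ContDiff ℝ 1 φ := h.hφ.of_le (by norm_num)
  have ds := hs1.differentiable (by norm_num)
  have dφ := hφ1.differentiable (by norm_num)
  have hm1 : ContDiff ℝ 1 (fun y => φ y - m) := hφ1.sub contDiff_const
  have dm := hm1.differentiable (by norm_num)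
  set P : Euc 2 → ℝ := fun y => s y * px s y + (φ y - m) * px φ y with hP
  set Q : Euc 2 → ℝ := fun y => s y * py s y + ((φ y - m) * py φ y + c * (s y * (φ y - m))) with hQ
  have hP1 : ContDiff ℝ 1 P := (hs1.mul (px_contDiff h.hs)).add (hm1.mul (px_contDiff h.hφ))
  have hQ1 : ContDiff ℝ 1 Q := (hs1.mul (py_contDiff h.hs)).add ((hm1.mul (py_contDiff h.hφ)).add
    (contDiff_const.mul (hs1.mul hm1)))
  have eP : ∀ y, px P y = px s y ^ 2 + s y * px (px s) y + px φ y ^ 2 + (φ y - m) * px (px φ) y := by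
    intro y
    have d1 := px_diff h.hs
    have d2 := px_diff h.hφ
    rw [hP, px_add, px_mul, px_mul, px_sub_const]
    · ring
    all_goals fun_prop
  have eQ : ∀ y, py Q y = py s y ^ 2 + s y * py (py s) y + py φ y ^ 2 + (φ y - m) * py (py φ) y
      + c * (py s y * (φ y - m) + s y * py φ y) := by
    intro y
    have d1 := py_diff h.hs
    have d2 := py_diff h.hφ
    rw [hQ, py_add, py_mul, py_add, py_mul dm d2, py_const_mul, py_mul ds dm, py_sub_const]
    · ring
    all_goals fun_prop
  have hdiv : ∀ y, R ≤ ‖y‖ → l * XX s φ y ≤ px P y + py Q y := by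
    intro y hy
    obtain ⟨h1, h2⟩ := hsm y hy
    have key := coercive_alg (a := px s y) (b := py s y) (p := px φ y) (q := py φ y) h.c_pos h.c_lt h1 h2
    rw [eP, eQ]
    have q1 := h.eq1 y (hR.trans hy)
    have q2 := h.eq2 y (hR.trans hy)
    unfold XX
    refine key.trans (le_of_eq ?_)
    linear_combination (-s y) * q1 - (φ y - m) * q2
  have hPb : ∀ y, P y ^ 2 ≤ (5 * (s y ^ 2 + (φ y - m) ^ 2)) * XX s φ y := by
    intro y
    have e : P y ^ 2 ≤ (s y ^ 2 + (φ y - m) ^ 2) * (px s y ^ 2 + px φ y ^ 2) := by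
      rw [hP]; beta_reduce; nlinarith [sq_nonneg (s y * px φ y - (φ y - m) * px s y)]
    refine e.trans ?_
    rw [mul_comm 5, mul_assoc]
    gcongr
    unfold XX; nlinarith [sq_nonneg (s y), sq_nonneg (px s y), sq_nonneg (py s y), sq_nonneg (px φ y), sq_nonneg (py φ y)]
  have hQb : ∀ y, Q y ^ 2 ≤ (5 * (s y ^ 2 + (φ y - m) ^ 2)) * XX s φ y := by
    intro y
    have e : Q y ^ 2 ≤ (s y ^ 2 + (φ y - m) ^ 2) * (py s y ^ 2 + (py φ y + c * s y) ^ 2) := by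
      have : Q y = s y * py s y + (φ y - m) * (py φ y + c * s y) := by rw [hQ]; ring
      rw [this]; nlinarith [sq_nonneg (s y * (py φ y + c * s y) - (φ y - m) * py s y)]
    refine e.trans ?_
    rw [mul_comm 5, mul_assoc]
    gcongr
    have : (py φ y + c * s y) ^ 2 ≤ 2 * py φ y ^ 2 + 4 * s y ^ 2 := by
      nlinarith [sq_nonneg (py φ y - c * s y), mul_nonneg hc0.le (sq_nonneg (s y))]
    unfold XX; nlinarith [sq_nonneg (s y), sq_nonneg (px s y), sq_nonneg (py s y), sq_nonneg (px φ y), sq_nonneg (py φ y)]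
  set χ : Euc 2 → ℝ := fun y => 1 - eta R y with hχ
  have eR := eta_contDiff R
  have eT := eta_contDiff T
  have dR : Differentiable ℝ (eta R) := eR.differentiable (by simp)
  have dT : Differentiable ℝ (eta T) := eT.differentiable (by simp)
  have dχ : Differentiable ℝ χ := (differentiable_const 1).sub dR
  have pxχ : px χ = fun y => - px (eta R) y := by
    rw [hχ, px_sub (differentiable_const 1) dR, px_const]; funext y; ring
  have pyχ : py χ = fun y => - py (eta R) y := by
    rw [hχ, py_sub (differentiable_const 1) dR, py_const]; funext y; ring
  set ζ : Euc 2 → ℝ := fun y => (χ y * χ y) * eta T y with hζ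
  have χ1 : ContDiff ℝ 1 χ := contDiff_const.sub (eR.of_le (by exact_mod_cast le_top))
  have ζ1 : ContDiff ℝ 1 ζ := (χ1.mul χ1).mul (eT.of_le (by exact_mod_cast le_top))
  have ζc : HasCompactSupport ζ := (eta_compact hT0).mul_left
  have pxζ : ∀ y, px ζ y = -2 * (χ y * px (eta R) y) * eta T y + χ y ^ 2 * px (eta T) y := by
    intro y
    rw [hζ, px_mul (by fun_prop) dT, px_mul dχ dχ, pxχ]; ring
  have pyζ : ∀ y, py ζ y = -2 * (χ y * py (eta R) y) * eta T y + χ y ^ 2 * py (eta T) y := by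
    intro y
    rw [hζ, py_mul (by fun_prop) dT, py_mul dχ dχ, pyχ]; ring
  have hdivI := integral_div ζ1 ζc hP1 hQ1
  have X0 := XX_nonneg s φ
  have χ0 : ∀ y, 0 ≤ χ y ∧ χ y ≤ 1 := fun y => ⟨by rw [hχ]; linarith [eta_le_one R y], by rw [hχ]; linarith [eta_nonneg R y]⟩
  have χin : ∀ y, ‖y‖ ≤ R → χ y = 0 := fun y hy => by rw [hχ]; simp [eta_one hR0 hy]
  have χout : ∀ y, 2 * R ≤ ‖y‖ → χ y = 1 := fun y hy => by rw [hχ]; simp [eta_zero hR0 hy]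
  have ζ0 : ∀ y, 0 ≤ ζ y := fun y => mul_nonneg (mul_self_nonneg _) (eta_nonneg T y)
  have cX := h.contX
  have cs := hs1.continuous
  have cφ := hφ1.continuous
  have ccg : Continuous (fun y => s y ^ 2 + (φ y - m) ^ 2) := by fun_prop
  -- pointwise inequality
  set A : ℝ := 20 / l * (K / R) ^ 2 with hA
  set g1 : Euc 2 → ℝ := (annS R (2 * R)).indicator (fun y => A * (s y ^ 2 + (φ y - m) ^ 2)) with hg1
  set g2 : Euc 2 → ℝ := (closedBall (0 : Euc 2) (2 * T)).indicator (fun _ => 2 * θ * (K / T) ^ 2) with hg2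
  set g3 : Euc 2 → ℝ := (extS T).indicator (fun y => 3 / θ * XX s φ y) with hg3
  have g1n : ∀ y, 0 ≤ g1 y := fun y => Set.indicator_nonneg (fun y _ => by positivity) y
  have g2n : ∀ y, 0 ≤ g2 y := fun y => Set.indicator_nonneg (fun y _ => by positivity) y
  have g3n : ∀ y, 0 ≤ g3 y := fun y => Set.indicator_nonneg (fun y _ => by have := X0 y; positivity) y
  have cross : ∀ (k t V : ℝ) (y : Euc 2), |k| ≤ K / R → (y ∉ annS R (2 * R) → k = 0) → 
      |t| ≤ K / T → (y ∉ extS T ∩ closedBall 0 (2 * T) → t = 0) → 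
      V ^ 2 ≤ (5 * (s y ^ 2 + (φ y - m) ^ 2)) * XX s φ y → 
      |(-2 * (χ y * k) * eta T y + χ y ^ 2 * t) * V| ≤ l / 4 * (ζ y * XX s φ y) + g1 y + g2 y / 2 + g3 y / 2 := by
    intro k t V y hk hk0 ht ht0 hV
    have hB0 : 0 ≤ 5 * (s y ^ 2 + (φ y - m) ^ 2) := by positivity
    have a1 := amgm_sq (l := l / 4) (x := χ y) (k := k) (by positivity) hV hB0 (X0 y)
    have e1 : 1 / (l / 4) * k ^ 2 * (5 * (s y ^ 2 + (φ y - m) ^ 2)) ≤ g1 y := by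
      by_cases hy : y ∈ annS R (2 * R)
      · rw [hg1, Set.indicator_of_mem hy]
        have : k ^ 2 ≤ (K / R) ^ 2 := sq_le_sq' (by linarith [(abs_le.mp hk).1]) (abs_le.mp hk).2
        calc _ ≤ 1 / (l / 4) * (K / R) ^ 2 * (5 * (s y ^ 2 + (φ y - m) ^ 2)) := by gcongr
          _ = _ := by rw [hA]; field_simp; ring
      · rw [hk0 hy]; simpa using g1n y
    have e2 : |χ y ^ 2 * t * V| ≤ g2 y / 2 + g3 y / 2 := by
      by_cases hy : y ∈ extS T ∩ closedBall 0 (2 * T)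
      · rw [hg2, hg3, Set.indicator_of_mem hy.1, Set.indicator_of_mem hy.2]
        have hRy : R ≤ ‖y‖ := by have : T ≤ ‖y‖ := hy.1; linarith
        obtain ⟨h1, h2⟩ := hsm y hRy
        have hc1 : (2 - c ^ 2) / 32 ≤ 1 / 4 := by nlinarith [sq_nonneg c]
        have hV' : V ^ 2 ≤ 1 * XX s φ y := by
          refine hV.trans ?_
          have := X0 y
          gcongr
          have k1 : s y ^ 2 ≤ (1 / 4) ^ 2 := sq_le_sq.mpr ((h1.trans hc1).trans (le_abs_self _))
          have k2 : (φ y - m) ^ 2 ≤ (1 / 4) ^ 2 := sq_le_sq.mpr ((h2.trans hc1).trans (le_abs_self _))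
          linarith
        have b1 := amgm_sq (l := 1 / θ) (x := 1) (k := t) (by positivity) hV' zero_le_one (X0 y)
        have b2 : |χ y ^ 2 * t * V| ≤ |1 * t * V| := by
          rw [mul_assoc, mul_assoc, abs_mul, abs_mul 1]
          gcongr
          have := χ0 y
          nlinarith
        have b3 : t ^ 2 ≤ (K / T) ^ 2 := sq_le_sq' (by linarith [(abs_le.mp ht).1]) (abs_le.mp ht).2
        have b4 : 1 / (1 / θ) * t ^ 2 * 1 ≤ θ * (K / T) ^ 2 := by
          rw [one_div_one_div, mul_one]; gcongr
        have b5 : 0 ≤ 1 / θ * XX s φ y := by have := X0 y; positivity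
        have b6 : 3 / θ * XX s φ y = 3 * (1 / θ * XX s φ y) := by ring
        have b7 : 0 ≤ θ * (K / T) ^ 2 := by positivity
        have b8 : 2 * |1 * t * V| ≤ 1 / θ * XX s φ y + θ * (K / T) ^ 2 := by
          refine b1.trans ?_
          rw [one_pow, mul_one]; linarith
        rw [b6]
        linarith
      · rw [ht0 hy]; simp only [mul_zero, zero_mul, abs_zero]; linarith [g2n y, g3n y]
    have e3 : |-2 * (χ y * k) * eta T y * V| ≤ l / 4 * (ζ y * XX s φ y) + g1 y / 2 + g1 y / 2 := by
      have : |-2 * (χ y * k) * eta T y * V| = eta T y * (2 * |χ y * k * V|) := by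
        rw [show -2 * (χ y * k) * eta T y * V = -(eta T y * (2 * (χ y * k * V))) by ring, abs_neg, abs_mul, abs_mul,
          abs_of_nonneg (eta_nonneg T y)]; norm_num
      rw [this]
      have f0 := eta_nonneg T y
      have f1 := eta_le_one T y
      calc _ ≤ eta T y * (l / 4 * χ y ^ 2 * XX s φ y + g1 y) := by gcongr; linarith
        _ = l / 4 * (ζ y * XX s φ y) + eta T y * g1 y := by rw [hζ]; ring
        _ ≤ l / 4 * (ζ y * XX s φ y) + 1 * g1 y := by gcongr; exact g1n y
        _ = _ := by ring
    rw [add_mul]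
    refine (abs_add_le _ _).trans ?_
    linarith
  have key : ∀ y, -(px ζ y * P y + py ζ y * Q y) ≤ l / 2 * (ζ y * XX s φ y) + 2 * g1 y + g2 y + g3 y := by
    intro y
    have kz : ∀ z : Euc 2, z ∉ annS R (2 * R) → ‖z‖ < R ∨ 2 * R < ‖z‖ := by
      intro z hz
      simp only [annS, Set.mem_ofPred_eq, not_and_or, not_le] at hz
      exact hz
    have tz : ∀ z : Euc 2, z ∉ extS T ∩ closedBall 0 (2 * T) → ‖z‖ < T ∨ 2 * T < ‖z‖ := by
      intro z hz
      simpa only [extS, Set.mem_inter_iff, Set.mem_ofPred_eq, mem_closedBall, dist_zero_right, not_and_or, not_le] using hz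
    have a1 := cross (px (eta R) y) (px (eta T) y) (P y) y (hK R hR0 y).1 (fun hy => px_eta_zero hR0 (kz y hy))
      (hK T hT0 y).1 (fun hy => px_eta_zero hT0 (tz y hy)) (hPb y)
    have a2 := cross (py (eta R) y) (py (eta T) y) (Q y) y (hK R hR0 y).2.1 (fun hy => py_eta_zero hR0 (kz y hy))
      (hK T hT0 y).2.1 (fun hy => py_eta_zero hT0 (tz y hy)) (hQb y)
    rw [pxζ, pyζ]
    have b1 := neg_le_of_abs_le a1
    have b2 := neg_le_of_abs_le a2
    linarith
  have iζX : Integrable (fun y => ζ y * XX s φ y) :=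
    (ζ1.continuous.mul cX).integrable_of_hasCompactSupport ζc.mul_right
  have iann : IntegrableOn (fun y => s y ^ 2 + (φ y - m) ^ 2) (annS R (2 * R)) :=
    ccg.continuousOn.integrableOn_compact (annS_compact _ _)
  have i1 : Integrable g1 := (integrable_indicator_iff (annS_meas _ _)).mpr (iann.const_mul A)
  have i2 : Integrable g2 := by
    refine (integrable_indicator_iff isClosed_closedBall.measurableSet).mpr ?_
    exact continuous_const.continuousOn.integrableOn_compact (isCompact_closedBall _ _)
  have i3 : Integrable g3 := (integrable_indicator_iff (extS_meas _)).mpr (h.int.const_mul _).integrableOn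
  have I1 : ∫ y, g1 y = A * ∫ y in annS R (2 * R), (s y ^ 2 + (φ y - m) ^ 2) := by
    rw [hg1, integral_indicator (annS_meas _ _), integral_const_mul]
  have I2 : ∫ y, g2 y = θ * (8 * K ^ 2 * (volume : Measure (Euc 2)).real (closedBall 0 1)) := by
    rw [hg2, integral_indicator isClosed_closedBall.measurableSet, setIntegral_const,
      vol_ball_scale _ (by positivity), smul_eq_mul]
    field_simp; ring
  have I3 : ∫ y, g3 y = 3 / θ * EE s φ T := by
    rw [hg3, integral_indicator (extS_meas _), integral_const_mul]; rfl
  have low : ∫ y, l * (ζ y * XX s φ y) ≤ ∫ y, ζ y * (px P y + py Q y) := by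
    refine integral_mono (iζX.const_mul l) ?_ ?_
    · exact (ζ1.continuous.mul ((px_cont hP1).add (py_cont hQ1))).integrable_of_hasCompactSupport ζc.mul_right
    · intro y
      beta_reduce
      by_cases hy : R ≤ ‖y‖
      · calc _ = ζ y * (l * XX s φ y) := by ring
          _ ≤ _ := mul_le_mul_of_nonneg_left (hdiv y hy) (ζ0 y)
      · have : ζ y = 0 := by rw [hζ]; simp [χin y (le_of_not_ge hy)]
        simp [this]
  have up : - ∫ y, (px ζ y * P y + py ζ y * Q y) ≤ ∫ y, (l / 2 * (ζ y * XX s φ y) + 2 * g1 y + g2 y + g3 y) := by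
    rw [← integral_neg]
    refine integral_mono ?_ ((((iζX.const_mul _).add (i1.const_mul 2)).add i2).add i3) key
    have c1 : Continuous (fun y => px ζ y * P y) := (px_cont ζ1).mul hP1.continuous
    have c2 : Continuous (fun y => py ζ y * Q y) := (py_cont ζ1).mul hQ1.continuous
    exact ((c1.integrable_of_hasCompactSupport (px_compact ζc).mul_right).add
      (c2.integrable_of_hasCompactSupport (py_compact ζc).mul_right)).neg
  have eI : ∫ y, (l / 2 * (ζ y * XX s φ y) + 2 * g1 y + g2 y + g3 y) = l / 2 * (∫ y, ζ y * XX s φ y) + 2 * (∫ y, g1 y)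
      + (∫ y, g2 y) + ∫ y, g3 y := by
    have j1 : Integrable (fun y => l / 2 * (ζ y * XX s φ y)) := iζX.const_mul _
    have j2 : Integrable (fun y => 2 * g1 y) := i1.const_mul 2
    have j3 : Integrable (fun y => l / 2 * (ζ y * XX s φ y) + 2 * g1 y) := j1.add j2
    have j4 : Integrable (fun y => l / 2 * (ζ y * XX s φ y) + 2 * g1 y + g2 y) := j3.add i2
    rw [integral_add j4 i3, integral_add j3 i2, integral_add j1 j2, integral_const_mul, integral_const_mul]
  rw [integral_const_mul] at low
  have fin : EE s φ (2 * R) - EE s φ T ≤ ∫ y, ζ y * XX s φ y := by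
    unfold EE
    rw [← integral_indicator (extS_meas _), ← integral_indicator (extS_meas _), ← integral_sub
      (h.int.indicator (extS_meas _)) (h.int.indicator (extS_meas _))]
    refine integral_mono ((h.int.indicator (extS_meas _)).sub (h.int.indicator (extS_meas _))) iζX ?_
    intro y
    beta_reduce
    have hz := mul_nonneg (ζ0 y) (X0 y)
    by_cases h1 : y ∈ extS (2 * R)
    · by_cases h2 : y ∈ extS T
      · rw [Set.indicator_of_mem h1, Set.indicator_of_mem h2]; simpa using hz
      · rw [Set.indicator_of_mem h1, Set.indicator_of_notMem h2]
        have : ζ y = 1 := by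
          rw [hζ]; simp [χout y h1, eta_one hT0 (le_of_not_ge h2)]
        simp [this]
    · rw [Set.indicator_of_notMem h1]
      have : 0 ≤ (extS T).indicator (XX s φ) y := Set.indicator_nonneg (fun y _ => X0 y) y
      linarith
  have e16 : (2 - c ^ 2) / 16 = l / 2 := by rw [hl]; ring
  have eA : 80 / (2 - c ^ 2) * 4 * K ^ 2 / R ^ 2 = 2 * A := by rw [hA, hl]; field_simp; ring
  rw [e16, eA]
  have := mul_le_mul_of_nonneg_left fin (by positivity : 0 ≤ l / 2)
  rw [eI, I1, I2, I3] at up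
  linarith

lemma caccioppoli {c R0 : ℝ} {s φ : Euc 2 → ℝ} (h : TW c R0 s φ) : ∃ C > 0, ∃ R1 ≥ R0, ∃ ε > 0,
    ∀ R ≥ R1, ∀ m, |m| ≤ ε → EE s φ (2 * R) ≤ C / R ^ 2 * ∫ y in annS R (2 * R), (s y ^ 2 + (φ y - m) ^ 2) := by
  obtain ⟨K, hK1, hK⟩ := eta_bounds
  have hc0 : 0 < 2 - c ^ 2 := by linarith [h.c_lt]
  set e := (2 - c ^ 2) / 64 with he
  have he0 : 0 < e := by positivity
  obtain ⟨r, hr⟩ := h.small e he0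
  refine ⟨16 / (2 - c ^ 2) * (80 / (2 - c ^ 2) * 4 * K ^ 2), by positivity, max r R0, le_max_right _ _, e, he0, ?_⟩
  intro R hR m hm
  have hRr : r ≤ R := (le_max_left _ _).trans hR
  have hR0 : R0 ≤ R := (le_max_right _ _).trans hR
  have core := fun θ (hθ : 0 < θ) T (hT : 2 * R ≤ T) => cacc_core h hK1 hK (m := m) hR0 (fun y hy => by
    obtain ⟨h1, h2, _⟩ := hr y (hRr.trans hy)
    constructor
    · refine h1.trans ?_; rw [he]; linarith
    · refine (abs_sub _ _).trans ?_; rw [he] at h2 hm; linarith) hθ hT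
  set A := (80 / (2 - c ^ 2) * 4 * K ^ 2 / R ^ 2) * (∫ y in annS R (2 * R), (s y ^ 2 + (φ y - m) ^ 2)) with hA
  set B := 8 * K ^ 2 * (volume : Measure (Euc 2)).real (closedBall 0 1) with hB
  have hB0 : 0 ≤ B := by positivity
  have t1 : ∀ θ > 0, (2 - c ^ 2) / 16 * EE s φ (2 * R) ≤ A + θ * B := by
    intro θ hθ
    have tt : Tendsto (fun T => A + θ * B + (3 / θ + (2 - c ^ 2) / 16) * EE s φ T) atTop
        (𝓝 (A + θ * B + (3 / θ + (2 - c ^ 2) / 16) * 0)) := ((EE_tendsto h.int).const_mul _).const_add _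
    rw [mul_zero, add_zero] at tt
    refine ge_of_tendsto tt ?_
    filter_upwards [eventually_ge_atTop (2 * R)] with T hT
    have := core θ hθ T hT
    linarith
  have t2 : (2 - c ^ 2) / 16 * EE s φ (2 * R) ≤ A := by
    have tt : Tendsto (fun θ : ℝ => A + θ * B) (𝓝[>] 0) (𝓝 (A + 0 * B)) :=
      ((tendsto_id.mono_left nhdsWithin_le_nhds).mul_const B).const_add A
    rw [zero_mul, add_zero] at tt
    refine ge_of_tendsto tt ?_
    filter_upwards [self_mem_nhdsWithin] with θ hθ
    exact t1 θ hθ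
  calc EE s φ (2 * R) = 16 / (2 - c ^ 2) * ((2 - c ^ 2) / 16 * EE s φ (2 * R)) := by field_simp
    _ ≤ 16 / (2 - c ^ 2) * A := by gcongr
    _ = _ := by rw [hA]; ring

/-- polar point -/
def pt (r t : ℝ) : Euc 2 := r • (Real.cos t • (basisVec 0 : Euc 2) + Real.sin t • (basisVec 1 : Euc 2))

lemma pt_zero (r t : ℝ) : pt r t 0 = r * Real.cos t := by simp [pt, basisVec]
lemma pt_one (r t : ℝ) : pt r t 1 = r * Real.sin t := by simp [pt, basisVec]
lemma pt_norm {r : ℝ} (hr : 0 ≤ r) (t : ℝ) : ‖pt r t‖ = r := by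
  have : ‖pt r t‖ ^ 2 = r ^ 2 := by
    rw [norm_sq_eq, pt_zero, pt_one]; nlinarith [Real.sin_sq_add_cos_sq t]
  exact (pow_left_inj₀ (norm_nonneg _) hr two_ne_zero).mp this
lemma pt_cont : Continuous (fun p : ℝ × ℝ => pt p.1 p.2) := by unfold pt; fun_prop

lemma pt_eq (p : ℝ × ℝ) : pt p.1 p.2 = WithLp.toLp 2 ((MeasurableEquiv.finTwoArrow (α := ℝ)).symm (polarCoord.symm p)) := by
  ext i; fin_cases i
  · simp [pt, basisVec]
  · simp [pt, basisVec]

lemma integral_polar (F : Euc 2 → ℝ) :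
    ∫ y, F y = ∫ p in Set.Ioi (0:ℝ) ×ˢ Set.Ioo (-Real.pi) Real.pi, p.1 * F (pt p.1 p.2) := by
  rw [← (PiLp.volume_preserving_toLp (Fin 2)).integral_comp (MeasurableEquiv.toLp 2 _).measurableEmbedding,
    ← ((volume_preserving_finTwoArrow ℝ).symm).integral_comp (MeasurableEquiv.finTwoArrow (α := ℝ)).symm.measurableEmbedding,
    ← integral_comp_polarCoord_symm]
  simp only [pt_eq, smul_eq_mul]
  rfl

lemma integral_ann_polar {F : Euc 2 → ℝ} (hF : Continuous F) {a b : ℝ} (ha : 0 < a) (hab : a ≤ b) :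
    ∫ y in annS a b, F y = ∫ r in a..b, ∫ t in (-Real.pi)..Real.pi, r * F (pt r t) := by
  have hpi : -Real.pi ≤ Real.pi := by linarith [Real.pi_pos]
  rw [← integral_indicator (annS_meas _ _), integral_polar]
  have e : ∀ p : ℝ × ℝ, p ∈ Set.Ioi (0:ℝ) ×ˢ Set.Ioo (-Real.pi) Real.pi → p.1 * (annS a b).indicator F (pt p.1 p.2)
      = (Set.Icc a b ×ˢ Set.univ).indicator (fun p : ℝ × ℝ => p.1 * F (pt p.1 p.2)) p := by
    intro p hp
    have h0 : 0 < p.1 := hp.1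
    by_cases h : p ∈ Set.Icc a b ×ˢ (Set.univ : Set ℝ)
    · rw [Set.indicator_of_mem h, Set.indicator_of_mem]
      change a ≤ ‖_‖ ∧ ‖_‖ ≤ b
      rw [pt_norm h0.le]; exact h.1
    · rw [Set.indicator_of_notMem h, Set.indicator_of_notMem, mul_zero]
      intro h'
      apply h
      change a ≤ ‖_‖ ∧ ‖_‖ ≤ b at h'
      rw [pt_norm h0.le] at h'
      exact ⟨h', trivial⟩
  rw [setIntegral_congr_fun (measurableSet_Ioi.prod measurableSet_Ioo) e,
    setIntegral_indicator (measurableSet_Icc.prod MeasurableSet.univ), Set.prod_inter_prod]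
  have e1 : Set.Ioi (0:ℝ) ∩ Set.Icc a b = Set.Icc a b :=
    Set.inter_eq_right.mpr (fun x hx => lt_of_lt_of_le ha hx.1)
  rw [e1, Set.inter_univ, Measure.volume_eq_prod, setIntegral_prod]
  · rw [intervalIntegral.integral_of_le hab, integral_Icc_eq_integral_Ioc]
    congr 1; funext r
    rw [intervalIntegral.integral_of_le hpi, ← integral_Ioc_eq_integral_Ioo]
  · have hc : Continuous (fun p : ℝ × ℝ => p.1 * F (pt p.1 p.2)) := continuous_fst.mul (hF.comp pt_cont)
    refine (hc.continuousOn.integrableOn_compact (isCompact_Icc.prod isCompact_Icc) : IntegrableOn _ (Set.Icc a b ×ˢ Set.Icc (-Real.pi) Real.pi) _).mono_set ?_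
    exact Set.prod_mono le_rfl Set.Ioo_subset_Icc_self

lemma cs_interval {a b : ℝ} (hab : a ≤ b) {u : ℝ → ℝ} (hu : Continuous u) :
    (∫ x in a..b, u x) ^ 2 ≤ (b - a) * ∫ x in a..b, u x ^ 2 := by
  rcases hab.eq_or_lt with rfl | h
  · simp
  set I := ∫ x in a..b, u x with hI
  have h0 : 0 ≤ ∫ x in a..b, ((b - a) * u x - I) ^ 2 := intervalIntegral.integral_nonneg hab (fun x _ => sq_nonneg _)
  have e : ∫ x in a..b, ((b - a) * u x - I) ^ 2 = (b - a) ^ 2 * (∫ x in a..b, u x ^ 2) - 2 * (b - a) * I * I + (b - a) * I ^ 2 := by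
    have : ∀ x, ((b - a) * u x - I) ^ 2 = (b - a) ^ 2 * u x ^ 2 - 2 * (b - a) * I * u x + I ^ 2 := fun x => by ring
    simp only [this]
    have c1 : Continuous (fun x => (b - a) ^ 2 * u x ^ 2) := by fun_prop
    have c2 : Continuous (fun x => 2 * (b - a) * I * u x) := by fun_prop
    have c3 : Continuous (fun x => (b - a) ^ 2 * u x ^ 2 - 2 * (b - a) * I * u x) := by fun_prop
    rw [intervalIntegral.integral_add (c3.intervalIntegrable _ _) (continuous_const.intervalIntegrable _ _),
      intervalIntegral.integral_sub (c1.intervalIntegrable _ _) (c2.intervalIntegrable _ _)]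
    simp only [intervalIntegral.integral_const_mul, intervalIntegral.integral_const, smul_eq_mul]
    rw [← hI]
  rw [e] at h0
  have hba : 0 < b - a := by linarith
  have : 0 ≤ (b - a) * ((b - a) * (∫ x in a..b, u x ^ 2) - I ^ 2) := by nlinarith
  linarith [nonneg_of_mul_nonneg_right this hba]

lemma ftc_sq {a b : ℝ} {u u' : ℝ → ℝ} (hu : ∀ x, HasDerivAt u (u' x) x) (hu' : Continuous u') {x z : ℝ}
    (hx : x ∈ Set.Icc a b) (hz : z ∈ Set.Icc a b) : (u x - u z) ^ 2 ≤ (b - a) * ∫ t in a..b, u' t ^ 2 := by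
  wlog hzx : z ≤ x generalizing x z
  · rw [← neg_sub, neg_sq]; exact this hz hx (le_of_not_ge hzx)
  have hab : a ≤ b := hx.1.trans hx.2
  rw [← intervalIntegral.integral_eq_sub_of_hasDerivAt (fun t _ => hu t) (hu'.intervalIntegrable _ _)]
  refine (cs_interval hzx hu').trans ?_
  have c2 : Continuous (fun t => u' t ^ 2) := by fun_prop
  have h1 : ∫ t in z..x, u' t ^ 2 ≤ ∫ t in a..b, u' t ^ 2 := by
    apply intervalIntegral.integral_mono_interval hz.1 hzx hx.2
    · filter_upwards with t; exact sq_nonneg _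
    · exact c2.intervalIntegrable _ _
  have h2 : 0 ≤ ∫ t in z..x, u' t ^ 2 := intervalIntegral.integral_nonneg hzx (fun t _ => sq_nonneg _)
  have : x - z ≤ b - a := by linarith [hx.2, hz.1]
  exact mul_le_mul this h1 h2 (by linarith)

lemma exists_le_avg {a b : ℝ} (hab : a < b) {h : ℝ → ℝ} (hh : Continuous h) :
    ∃ t ∈ Set.Icc a b, (b - a) * h t ≤ ∫ x in a..b, h x := by
  obtain ⟨t, ht, hmin⟩ := isCompact_Icc.exists_isMinOn (Set.nonempty_Icc.mpr hab.le) hh.continuousOn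
  refine ⟨t, ht, ?_⟩
  have : ∫ x in a..b, h t ≤ ∫ x in a..b, h x :=
    intervalIntegral.integral_mono_on hab.le (continuous_const.intervalIntegrable _ _) (hh.intervalIntegrable _ _)
      (fun x hx => hmin hx)
  simpa using this

lemma interval_swap {a b a' b' : ℝ} (hab : a ≤ b) (hab' : a' ≤ b') {f : ℝ → ℝ → ℝ} (hf : Continuous (Function.uncurry f)) :
    ∫ x in a..b, ∫ y in a'..b', f x y = ∫ y in a'..b', ∫ x in a..b, f x y := by
  simp only [intervalIntegral.integral_of_le hab, intervalIntegral.integral_of_le hab']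
  apply integral_integral_swap
  rw [Measure.prod_restrict]
  exact (hf.continuousOn.integrableOn_compact (isCompact_Icc.prod isCompact_Icc) : IntegrableOn _ (Set.Icc a b ×ˢ Set.Icc a' b') _).mono_set
    (Set.prod_mono Set.Ioc_subset_Icc_self Set.Ioc_subset_Icc_self)

lemma poincare_ann {f : Euc 2 → ℝ} (hf : ContDiff ℝ 1 f) {R : ℝ} (hR : 0 < R) :
    ∃ y0 : Euc 2, ‖y0‖ = R ∧ ∫ y in annS R (2 * R), (f y - f y0) ^ 2 ≤
      (64 * Real.pi ^ 2 + 8) * R ^ 2 * ∫ y in annS R (2 * R), (px f y ^ 2 + py f y ^ 2) := by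
  have hpi := Real.pi_pos
  have hpi' : -Real.pi < Real.pi := by linarith
  have cpx := px_cont hf
  have cpy := py_cont hf
  have hR2 : R ≤ 2 * R := by linarith
  have df := hf.differentiable (by norm_num)
  set G : Euc 2 → ℝ := fun y => px f y ^ 2 + py f y ^ 2 with hG
  have cG : Continuous G := by fun_prop
  have G0 : ∀ y, 0 ≤ G y := fun y => by positivity
  have cp1 : ∀ t, Continuous (fun r => pt r t) := fun t => by unfold pt; fun_prop
  have cp2 : ∀ r, Continuous (fun t => pt r t) := fun r => by unfold pt; fun_prop
  rw [integral_ann_polar cG hR hR2]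
  have cu : Continuous (Function.uncurry (fun r t => r * G (pt r t))) := continuous_fst.mul (cG.comp pt_cont)
  have cu' : Continuous (Function.uncurry (fun t r => r * G (pt r t))) := cu.comp continuous_swap
  set D := ∫ r in R..(2 * R), ∫ t in (-Real.pi)..Real.pi, r * G (pt r t) with hD
  have hsw := interval_swap hR2 hpi'.le cu
  rw [← hD] at hsw
  have ch : Continuous (fun t => ∫ r in R..(2 * R), r * G (pt r t)) :=
    intervalIntegral.continuous_parametric_intervalIntegral_of_continuous' cu' _ _
  obtain ⟨t0, ht0, hle⟩ := exists_le_avg hpi' ch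
  rw [← hsw] at hle
  have fd : ∀ (y v : Euc 2), fderiv ℝ f y v = v 0 * px f y + v 1 * py f y := by
    intro y v
    conv_lhs => rw [vec_decomp v]
    simp [px, py]
  have dr : ∀ t r, HasDerivAt (fun r => f (pt r t)) (Real.cos t * px f (pt r t) + Real.sin t * py f (pt r t)) r := by
    intro t r
    have h1 : HasDerivAt (fun r => pt r t) (Real.cos t • (basisVec 0 : Euc 2) + Real.sin t • (basisVec 1 : Euc 2)) r := by
      have := (hasDerivAt_id r).smul_const (Real.cos t • (basisVec 0 : Euc 2) + Real.sin t • (basisVec 1 : Euc 2))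
      simpa [pt] using this
    have := (df (pt r t)).hasFDerivAt.comp_hasDerivAt r h1
    rw [fd] at this
    have e : Real.cos t * px f (pt r t) + Real.sin t * py f (pt r t) =
      (Real.cos t • (basisVec 0 : Euc 2) + Real.sin t • (basisVec 1 : Euc 2)) 0 * px f (pt r t) +
      (Real.cos t • (basisVec 0 : Euc 2) + Real.sin t • (basisVec 1 : Euc 2)) 1 * py f (pt r t) := by
      simp [basisVec]
    rw [e]
    exact this
  have dt : ∀ r t, HasDerivAt (fun t => f (pt r t)) (r * (-Real.sin t * px f (pt r t) + Real.cos t * py f (pt r t))) t := by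
    intro r t
    have h1 : HasDerivAt (fun t => pt r t) (r • ((-Real.sin t) • (basisVec 0 : Euc 2) + Real.cos t • (basisVec 1 : Euc 2))) t :=
      (((Real.hasDerivAt_cos t).smul_const (basisVec 0 : Euc 2)).add ((Real.hasDerivAt_sin t).smul_const (basisVec 1 : Euc 2))).const_smul r
    have := (df (pt r t)).hasFDerivAt.comp_hasDerivAt t h1
    rw [fd] at this
    have e : r * (-Real.sin t * px f (pt r t) + Real.cos t * py f (pt r t)) =
      (r • ((-Real.sin t) • (basisVec 0 : Euc 2) + Real.cos t • (basisVec 1 : Euc 2))) 0 * px f (pt r t) +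
      (r • ((-Real.sin t) • (basisVec 0 : Euc 2) + Real.cos t • (basisVec 1 : Euc 2))) 1 * py f (pt r t) := by
      simp [basisVec]; ring
    rw [e]
    exact this
  have rb : ∀ r t, (Real.cos t * px f (pt r t) + Real.sin t * py f (pt r t)) ^ 2 ≤ G (pt r t) := by
    intro r t
    rw [hG]; beta_reduce
    nlinarith [sq_nonneg (Real.sin t * px f (pt r t) - Real.cos t * py f (pt r t)), Real.sin_sq_add_cos_sq t]
  have tb : ∀ r t, (r * (-Real.sin t * px f (pt r t) + Real.cos t * py f (pt r t))) ^ 2 ≤ r ^ 2 * G (pt r t) := by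
    intro r t
    rw [mul_pow]
    gcongr
    rw [hG]; beta_reduce
    nlinarith [sq_nonneg (Real.cos t * px f (pt r t) + Real.sin t * py f (pt r t)), Real.sin_sq_add_cos_sq t]
  refine ⟨pt R t0, pt_norm hR.le _, ?_⟩
  have D0 : 0 ≤ D := intervalIntegral.integral_nonneg hR2 (fun r hr => intervalIntegral.integral_nonneg hpi'.le
    (fun t _ => mul_nonneg (hR.le.trans hr.1) (G0 _)))
  rw [integral_ann_polar (by have := hf.continuous; fun_prop) hR hR2]
  have cc : Continuous (fun y => (f y - f (pt R t0)) ^ 2) := by have := hf.continuous; fun_prop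
  -- radial bound
  have B1 : ∀ r ∈ Set.Icc R (2 * R), (f (pt r t0) - f (pt R t0)) ^ 2 ≤ D / (2 * Real.pi) := by
    intro r hr
    have h1 := ftc_sq (dr t0) (by have := cp1 t0; fun_prop) hr (Set.left_mem_Icc.mpr hR2)
    refine h1.trans ?_
    have h2 : ∫ r in R..(2 * R), (Real.cos t0 * px f (pt r t0) + Real.sin t0 * py f (pt r t0)) ^ 2 ≤
        ∫ r in R..(2 * R), R⁻¹ * (r * G (pt r t0)) := by
      apply intervalIntegral.integral_mono_on hR2
      · apply Continuous.intervalIntegrable; have := cp1 t0; fun_prop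
      · apply Continuous.intervalIntegrable; have := cp1 t0; fun_prop
      · intro x hx
        refine (rb x t0).trans ?_
        rw [← mul_assoc]
        refine le_mul_of_one_le_left (G0 _) ?_
        rw [inv_mul_eq_div, le_div_iff₀ hR]; linarith [hx.1]
    rw [intervalIntegral.integral_const_mul] at h2
    have h3 : (2 * R - R) * (R⁻¹ * ∫ r in R..(2 * R), r * G (pt r t0)) = ∫ r in R..(2 * R), r * G (pt r t0) := by
      rw [show 2 * R - R = R by ring, mul_inv_cancel_left₀ hR.ne']
    have h4 : (2 * R - R) * ∫ r in R..(2 * R), (Real.cos t0 * px f (pt r t0) + Real.sin t0 * py f (pt r t0)) ^ 2 ≤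
      (2 * R - R) * (R⁻¹ * ∫ r in R..(2 * R), r * G (pt r t0)) := mul_le_mul_of_nonneg_left h2 (by linarith)
    rw [h3] at h4
    refine h4.trans ?_
    rw [le_div_iff₀ (by positivity)]
    linarith
  have B2 : ∀ r ∈ Set.Icc R (2 * R), ∀ t ∈ Set.Icc (-Real.pi) Real.pi,
      (f (pt r t) - f (pt r t0)) ^ 2 ≤ 2 * Real.pi * (4 * R * ∫ t in (-Real.pi)..Real.pi, r * G (pt r t)) / 2 := by
    intro r hr t ht
    have r0 : 0 < r := by linarith [hr.1]
    have h1 := ftc_sq (dt r) (by have := cp2 r; fun_prop) ht ht0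
    refine h1.trans ?_
    have h2 : ∫ t in (-Real.pi)..Real.pi, (r * (-Real.sin t * px f (pt r t) + Real.cos t * py f (pt r t))) ^ 2 ≤
        ∫ t in (-Real.pi)..Real.pi, (2 * R) * (r * G (pt r t)) := by
      apply intervalIntegral.integral_mono_on hpi'.le
      · apply Continuous.intervalIntegrable; have := cp2 r; fun_prop
      · apply Continuous.intervalIntegrable; have := cp2 r; fun_prop
      · intro x hx
        refine (tb r x).trans ?_
        rw [← mul_assoc, sq]
        have := G0 (pt r x)
        gcongr
        exact hr.2
    rw [intervalIntegral.integral_const_mul] at h2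
    have := mul_le_mul_of_nonneg_left h2 (by linarith : 0 ≤ Real.pi - -Real.pi)
    refine this.trans (le_of_eq ?_)
    ring
  have B3 : ∀ r ∈ Set.Icc R (2 * R), ∫ t in (-Real.pi)..Real.pi, r * (f (pt r t) - f (pt R t0)) ^ 2 ≤
      (32 * Real.pi ^ 2 * R ^ 2) * (∫ t in (-Real.pi)..Real.pi, r * G (pt r t)) + 4 * R * D := by
    intro r hr
    have r0 : 0 < r := by linarith [hr.1]
    set J := ∫ t in (-Real.pi)..Real.pi, r * G (pt r t) with hJ
    have J0 : 0 ≤ J := intervalIntegral.integral_nonneg hpi'.le (fun t _ => mul_nonneg r0.le (G0 _))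
    have : ∫ t in (-Real.pi)..Real.pi, r * (f (pt r t) - f (pt R t0)) ^ 2 ≤
       ∫ t in (-Real.pi)..Real.pi, (2 * R) * (2 * (4 * Real.pi * R * J) + 2 * (D / (2 * Real.pi))) := by
      apply intervalIntegral.integral_mono_on hpi'.le
      · apply Continuous.intervalIntegrable
        exact continuous_const.mul (cc.comp (cp2 r))
      · exact continuous_const.intervalIntegrable _ _
      · intro t ht
        have b1 := B1 r hr
        have b2 := B2 r hr t ht
        rw [← hJ] at b2
        have : (f (pt r t) - f (pt R t0)) ^ 2 ≤ 2 * (4 * Real.pi * R * J) + 2 * (D / (2 * Real.pi)) := by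
          nlinarith [sq_nonneg ((f (pt r t) - f (pt r t0)) - (f (pt r t0) - f (pt R t0)))]
        exact mul_le_mul hr.2 this (sq_nonneg _) (by linarith)
    refine this.trans (le_of_eq ?_)
    rw [intervalIntegral.integral_const, smul_eq_mul]
    field_simp; ring
  have cJ : Continuous (fun r => ∫ t in (-Real.pi)..Real.pi, r * G (pt r t)) :=
    intervalIntegral.continuous_parametric_intervalIntegral_of_continuous' cu _ _
  have cK0 : Continuous (Function.uncurry fun r t => r * (f (pt r t) - f (pt R t0)) ^ 2) :=
    Continuous.mul (f := fun p : ℝ × ℝ => p.1) (g := fun p : ℝ × ℝ => (f (pt p.1 p.2) - f (pt R t0)) ^ 2) continuous_fst (cc.comp pt_cont)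
  have cK : Continuous (fun r => ∫ t in (-Real.pi)..Real.pi, r * (f (pt r t) - f (pt R t0)) ^ 2) :=
    intervalIntegral.continuous_parametric_intervalIntegral_of_continuous'
      (f := fun r t => r * (f (pt r t) - f (pt R t0)) ^ 2) cK0 _ _
  have fin : ∫ r in R..(2 * R), ∫ t in (-Real.pi)..Real.pi, r * (f (pt r t) - f (pt R t0)) ^ 2 ≤
      ∫ r in R..(2 * R), ((32 * Real.pi ^ 2 * R ^ 2) * (∫ t in (-Real.pi)..Real.pi, r * G (pt r t)) + 4 * R * D) := by
    apply intervalIntegral.integral_mono_on hR2 (cK.intervalIntegrable _ _) _ B3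
    apply Continuous.intervalIntegrable
    exact (continuous_const.mul cJ).add continuous_const
  refine fin.trans ?_
  have cJ2 : Continuous (fun r => (32 * Real.pi ^ 2 * R ^ 2) * ∫ t in (-Real.pi)..Real.pi, r * G (pt r t)) := continuous_const.mul cJ
  rw [intervalIntegral.integral_add (cJ2.intervalIntegrable _ _) (continuous_const.intervalIntegrable _ _),
    intervalIntegral.integral_const_mul, intervalIntegral.integral_const, smul_eq_mul, ← hD]
  have : 0 ≤ Real.pi ^ 2 * R ^ 2 * D := by positivity
  have : 0 ≤ R ^ 2 * D := by positivity
  nlinarith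

lemma geom_decay {E : ℝ → ℝ} (E0 : ∀ R, 0 ≤ E R) (Ea : ∀ R R', R ≤ R' → E R' ≤ E R) {R1 θ : ℝ} (hR1 : 1 ≤ R1)
    (hθ : θ < 1) (h : ∀ R ≥ R1, E (4 * R) ≤ θ * E R) :
    ∃ C > (0:ℝ), ∃ α > (0:ℝ), α ≤ 1 ∧ ∀ R ≥ R1, E R ≤ C * R ^ (-α) := by
  have : ∃ α : ℝ, 0 < α ∧ α ≤ 1 ∧ θ * 4 ^ α ≤ 1 := by
    have hc : Tendsto (fun α : ℝ => θ * 4 ^ α) (𝓝[>] 0) (𝓝 (θ * 4 ^ (0:ℝ))) := by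
      apply Tendsto.mono_left _ nhdsWithin_le_nhds
      exact ((Real.continuous_const_rpow (by norm_num : (4:ℝ) ≠ 0)).tendsto 0).const_mul θ
    rw [Real.rpow_zero, mul_one] at hc
    have h1 := hc.eventually_lt_const hθ
    have h2 : ∀ᶠ α : ℝ in 𝓝[>] 0, α ∈ Set.Ioc (0:ℝ) 1 := Ioc_mem_nhdsGT one_pos
    obtain ⟨α, h3, h4⟩ := (h1.and h2).exists
    exact ⟨α, h4.1, h4.2, h3.le⟩
  obtain ⟨α, hα, hα1, hθα⟩ := this
  have hR10 : 0 < R1 := by linarith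
  set C := (E R1 + 1) * (4 * R1) ^ α with hC
  have C0 : 0 < C := by have := E0 R1; positivity
  refine ⟨C, C0, α, hα, hα1, ?_⟩
  have key : ∀ n : ℕ, ∀ R, R1 ≤ R → R ≤ 4 ^ (n + 1) * R1 → E R ≤ C * R ^ (-α) := by
    intro n
    induction n with
    | zero =>
      intro R h1 h2
      norm_num at h2
      have hR : 0 < R := by linarith
      have h3 : R ^ α ≤ (4 * R1) ^ α := Real.rpow_le_rpow hR.le (by linarith) hα.le
      rw [Real.rpow_neg hR.le, ← div_eq_mul_inv, le_div_iff₀ (by positivity), hC]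
      have := Ea _ _ h1
      have := E0 R
      have := E0 R1
      exact mul_le_mul (by linarith) h3 (by positivity) (by linarith)
    | succ n ih =>
      intro R h1 h2
      by_cases h4 : R ≤ 4 ^ (n + 1) * R1
      · exact ih R h1 h4
      · push Not at h4
        have h5 : 4 * R1 ≤ R := by
          have : (4:ℝ) ≤ 4 ^ (n + 1) := by
            rw [pow_succ]; have : (1:ℝ) ≤ 4 ^ n := one_le_pow₀ (by norm_num)
            linarith
          nlinarith
        have hR : 0 < R := by linarith
        have h6 := h (R / 4) (by linarith)
        have h7 := ih (R / 4) (by linarith) (by rw [pow_succ] at h2; linarith)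
        rw [show 4 * (R / 4) = R by ring] at h6
        have hθ0 : 0 ≤ θ ∨ θ < 0 := le_or_gt 0 θ
        rcases hθ0 with hθ0 | hθ0
        · calc E R ≤ θ * (C * (R / 4) ^ (-α)) := h6.trans (by gcongr)
            _ = (θ * 4 ^ α) * (C * R ^ (-α)) := by
              rw [Real.div_rpow hR.le (by norm_num), Real.rpow_neg (by norm_num : (0:ℝ) ≤ 4), div_inv_eq_mul]; ring
            _ ≤ 1 * (C * R ^ (-α)) := by gcongr
            _ = _ := one_mul _
        · have : E R ≤ 0 := h6.trans (mul_nonpos_of_nonpos_of_nonneg hθ0.le (E0 _))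
          exact this.trans (by positivity)
  intro R hR
  obtain ⟨n, hn⟩ := pow_unbounded_of_one_lt (R / R1) (by norm_num : (1:ℝ) < 4)
  refine key n R hR ?_
  rw [div_lt_iff₀ hR10] at hn
  rw [pow_succ]
  nlinarith

lemma TW.s_int {c R0 : ℝ} {s φ : Euc 2 → ℝ} (h : TW c R0 s φ) (a b : ℝ) :
    ∫ y in annS a b, s y ^ 2 ≤ ∫ y in annS a b, XX s φ y := by
  apply setIntegral_mono_on _ h.int.integrableOn (annS_meas _ _)
  · intro y _; unfold XX; nlinarith [sq_nonneg (px s y), sq_nonneg (py s y), sq_nonneg (px φ y), sq_nonneg (py φ y)]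
  · have := h.hs.continuous
    exact (by fun_prop : Continuous (fun y => s y ^ 2)).continuousOn.integrableOn_compact (annS_compact _ _)

lemma TW.ann_le {c R0 : ℝ} {s φ : Euc 2 → ℝ} (h : TW c R0 s φ) (a b d : ℝ) (hbd : b < d) (had : a ≤ d) :
    ∫ y in annS a b, XX s φ y ≤ EE s φ a - EE s φ d := by
  have h1 : ∫ y in annS a b ∪ extS d, XX s φ y = (∫ y in annS a b, XX s φ y) + EE s φ d := by
    apply setIntegral_union _ (extS_meas _) h.int.integrableOn h.int.integrableOn
    rw [Set.disjoint_left]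
    intro y h1 (h2 : d ≤ ‖y‖)
    have : ‖y‖ ≤ b := h1.2
    linarith
  have h2 : ∫ y in annS a b ∪ extS d, XX s φ y ≤ EE s φ a := by
    apply setIntegral_mono_set h.int.integrableOn
    · filter_upwards with y; exact XX_nonneg s φ y
    · have hsub : annS a b ∪ extS d ⊆ extS a := by
        rintro y (h1 | h1)
        · exact h1.1
        · exact had.trans h1
      exact hsub.eventuallyLE
  linarith

lemma energy_decay {c R0 : ℝ} {s φ : Euc 2 → ℝ} (h : TW c R0 s φ) :
    ∃ C > (0:ℝ), ∃ α > (0:ℝ), α ≤ 1 ∧ ∃ R1 ≥ R0, ∀ R ≥ R1, EE s φ R ≤ C * R ^ (-α) := by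
  obtain ⟨C, hC, R1, hR1, ε, hε, hcac⟩ := caccioppoli h
  obtain ⟨r, hr⟩ := h.small ε hε
  set B := C * (64 * Real.pi ^ 2 + 9) with hB
  have B0 : 0 < B := by positivity
  have R01 := h.R0_ge
  have key : ∀ R ≥ max R1 r, EE s φ (4 * R) ≤ B / (1 + B) * EE s φ R := by
    intro R hR
    have hRR1 : R1 ≤ R := (le_max_left _ _).trans hR
    have hRr : r ≤ R := (le_max_right _ _).trans hR
    have hR0 : 0 < R := by linarith
    obtain ⟨y0, hy0, hp⟩ := poincare_ann (h.hφ.of_le (by norm_num) : ContDiff ℝ 1 φ) hR0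
    have hc := hcac R hRR1 (φ y0) (hr y0 (by linarith)).2.1
    have cs := h.hs.continuous
    have cφ := h.hφ.continuous
    have c1 : IntegrableOn (fun y => s y ^ 2) (annS R (2 * R)) :=
      (by fun_prop : Continuous (fun y => s y ^ 2)).continuousOn.integrableOn_compact (annS_compact _ _)
    have c2 : IntegrableOn (fun y => (φ y - φ y0) ^ 2) (annS R (2 * R)) :=
      (by fun_prop : Continuous (fun y => (φ y - φ y0) ^ 2)).continuousOn.integrableOn_compact (annS_compact _ _)
    rw [integral_add c1 c2] at hc
    have h1 := h.s_int R (2 * R)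
    have h2 : ∫ y in annS R (2 * R), (px φ y ^ 2 + py φ y ^ 2) ≤ ∫ y in annS R (2 * R), XX s φ y := by
      apply setIntegral_mono_on _ h.int.integrableOn (annS_meas _ _)
      · intro y _; unfold XX; nlinarith [sq_nonneg (px s y), sq_nonneg (py s y), sq_nonneg (s y)]
      · have a1 := px_cont (h.hφ.of_le (by norm_num) : ContDiff ℝ 1 φ)
        have a2 := py_cont (h.hφ.of_le (by norm_num) : ContDiff ℝ 1 φ)
        exact (by fun_prop : Continuous (fun y => px φ y ^ 2 + py φ y ^ 2)).continuousOn.integrableOn_compact (annS_compact _ _)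
    set I := ∫ y in annS R (2 * R), XX s φ y with hI
    have I0 : 0 ≤ I := setIntegral_nonneg (annS_meas _ _) (fun y _ => XX_nonneg s φ y)
    have h3 : EE s φ (2 * R) ≤ B * I := by
      have h4 : C / R ^ 2 * ((∫ y in annS R (2 * R), s y ^ 2) + ∫ y in annS R (2 * R), (φ y - φ y0) ^ 2) ≤
        C / R ^ 2 * (R ^ 2 * I + (64 * Real.pi ^ 2 + 8) * R ^ 2 * I) := by
        gcongr
        · have : 1 ≤ R ^ 2 := one_le_pow₀ (by linarith)
          nlinarith
        · exact hp.trans (by gcongr)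
      refine hc.trans (h4.trans (le_of_eq ?_))
      rw [hB]; field_simp; ring
    have h5 := h.ann_le R (2 * R) (4 * R) (by linarith) (by linarith)
    have h6 := EE_anti h.int (by linarith : 2 * R ≤ 4 * R)
    have h7 : EE s φ (4 * R) ≤ B * (EE s φ R - EE s φ (4 * R)) := by
      have := mul_le_mul_of_nonneg_left h5 B0.le
      linarith
    rw [div_mul_eq_mul_div, le_div_iff₀ (by positivity)]
    linarith
  obtain ⟨C', hC', α, hα, hα1, hh⟩ := geom_decay (fun R => EE_nonneg s φ R) (fun R R' hR => EE_anti h.int hR)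
    (R1 := max R1 r) (θ := B / (1 + B)) (by have := le_max_left R1 r; linarith) (by rw [div_lt_one (by positivity)]; linarith) key
  exact ⟨C', hC', α, hα, hα1, max R1 r, hR1.le.trans (le_max_left _ _), hh⟩

/-- second order density -/
def Z2 (s φ : Euc 2 → ℝ) (y : Euc 2) : ℝ :=
  (px (px s) y + py (py s) y) ^ 2 + (px s y ^ 2 + py s y ^ 2)
  + (px (px φ) y ^ 2 + 2 * px (py φ) y ^ 2 + py (py φ) y ^ 2)

set_option maxHeartbeats 1000000 in
lemma second_alg {c s a b p q f11 f12 f22 D e : ℝ} (hc : 0 < c) (hc2 : c ^ 2 < 2)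
    (he : e = (2 - c ^ 2) / 100) (hs : |s| ≤ e) (ha : |a| ≤ e) (hb : |b| ≤ e) (hp : |p| ≤ e) (hq : |q| ≤ e) :
    1 / 2 * D ^ 2 + 4 / 5 * (2 - c ^ 2) * (a ^ 2 + b ^ 2) - (2 - c ^ 2) / 100 * (f11 ^ 2 + 2 * f12 ^ 2 + f22 ^ 2) ≤
    D ^ 2 + 2 * Real.exp (2 * s) * (a ^ 2 + b ^ 2) - c ^ 2 * b ^ 2 - 2 * c * b * (a * p + b * q)
      + 2 * (p * (f11 * a + f12 * b) + q * (f12 * a + f22 * b)) + (a ^ 2 + b ^ 2) * D := by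
  have he0 : 0 < e := by rw [he]; linarith
  have he1 : e ≤ 1 / 50 := by rw [he]; nlinarith [sq_nonneg c]
  have hc3 : c < 3 / 2 := by nlinarith
  have hE : 1 - 2 * e ≤ Real.exp (2 * s) := by
    have := Real.add_one_le_exp (2 * s)
    have := (abs_le.mp hs).1
    linarith
  have g0 : 0 ≤ a ^ 2 + b ^ 2 := by positivity
  have t1 : (2 - 4 * e) * (a ^ 2 + b ^ 2) ≤ 2 * Real.exp (2 * s) * (a ^ 2 + b ^ 2) := by
    apply mul_le_mul_of_nonneg_right _ g0; linarith
  have gen : ∀ x u v : ℝ, |x| ≤ e → 2 * |x * (u * v)| ≤ e * (u ^ 2 + v ^ 2) := by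
    intro x u v hx
    rw [abs_mul, ← mul_assoc, mul_comm 2, mul_assoc]
    apply mul_le_mul hx _ (by positivity) he0.le
    rw [abs_mul, ← sq_abs u, ← sq_abs v]; nlinarith [sq_nonneg (|u| - |v|)]
  have u1 := gen p b a hp
  have u2 := gen q b b hq
  have u3 := gen p f11 a hp
  have u4 := gen p f12 b hp
  have u5 := gen q f12 a hq
  have u6 := gen q f22 b hq
  have u7 := gen a a D ha
  have u8 := gen b b D hb
  have v1 : 2 * c * b * (a * p + b * q) ≤ 3 * (|p * (b * a)| + |q * (b * b)|) := by
    have w1 := le_abs_self (p * (b * a))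
    have w2 := le_abs_self (q * (b * b))
    have w3 : 2 * c * b * (a * p + b * q) = 2 * c * (p * (b * a) + q * (b * b)) := by ring
    rw [w3]
    have w4 : 0 ≤ |p * (b * a)| + |q * (b * b)| := by positivity
    nlinarith
  have x3 := neg_abs_le (p * (f11 * a))
  have x4 := neg_abs_le (p * (f12 * b))
  have x5 := neg_abs_le (q * (f12 * a))
  have x6 := neg_abs_le (q * (f22 * b))
  have x7 := neg_abs_le (a * (a * D))
  have x8 := neg_abs_le (b * (b * D))
  have hμ : 2 - c ^ 2 = 100 * e := by rw [he]; ring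
  have hcc : c ^ 2 = 2 - 100 * e := by linarith
  have y1 : 0 ≤ e * a ^ 2 := by positivity
  have y2 : 0 ≤ e * b ^ 2 := by positivity
  have y3 : 0 ≤ e * f11 ^ 2 := by positivity
  have y4 : 0 ≤ e * f12 ^ 2 := by positivity
  have y5 : 0 ≤ e * f22 ^ 2 := by positivity
  have y6 : e * D ^ 2 ≤ 1 / 50 * D ^ 2 := by gcongr
  have y7 : 0 ≤ D ^ 2 := sq_nonneg _
  have y8 : c ^ 2 * b ^ 2 ≤ (2 - 100 * e) * (a ^ 2 + b ^ 2) := by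
    rw [← hcc]; nlinarith [mul_nonneg (sq_nonneg c) (sq_nonneg a)]
  rw [hμ]
  linarith

set_option maxHeartbeats 1000000 in
lemma second_order {c R0 : ℝ} {s φ : Euc 2 → ℝ} (h : TW c R0 s φ) {R1 : ℝ} (hR1 : R0 ≤ R1)
    (hsm : ∀ y : Euc 2, R1 ≤ ‖y‖ → |s y| ≤ (2 - c ^ 2) / 100 ∧ |φ y| ≤ (2 - c ^ 2) / 100 ∧ |px s y| ≤ (2 - c ^ 2) / 100
      ∧ |py s y| ≤ (2 - c ^ 2) / 100 ∧ |px φ y| ≤ (2 - c ^ 2) / 100 ∧ |py φ y| ≤ (2 - c ^ 2) / 100)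
    {χ : Euc 2 → ℝ} (hχ : ContDiff ℝ 1 χ) (hχc : HasCompactSupport χ) (hsup : ∀ y, χ y ≠ 0 → R1 ≤ ‖y‖)
    {k a b : ℝ} (hk : ∀ y, |px χ y| ≤ k ∧ |py χ y| ≤ k) (hk0 : ∀ y, y ∉ annS a b → px χ y = 0 ∧ py χ y = 0) (ha : R1 ≤ a) :
    (2 - c ^ 2) * ∫ y, χ y ^ 2 * Z2 s φ y ≤ 50000 / (2 - c ^ 2) * k ^ 2 * ∫ y in annS a b, XX s φ y := by
  set μ := 2 - c ^ 2 with hμ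
  have μ0 : 0 < μ := by rw [hμ]; linarith [h.c_lt]
  have μ2 : μ ≤ 2 := by rw [hμ]; nlinarith [sq_nonneg c]
  have hc3 : c < 3 / 2 := by nlinarith [h.c_lt, h.c_pos]
  have hs1 : ContDiff ℝ 1 s := h.hs.of_le (by norm_num)
  have hφ1 : ContDiff ℝ 1 φ := h.hφ.of_le (by norm_num)
  have ds := hs1.differentiable (by norm_num)
  have dφ := hφ1.differentiable (by norm_num)
  have k1 := px_contDiff h.hs
  have k2 := py_contDiff h.hs
  have k3 := px_contDiff h.hφ
  have k4 := py_contDiff h.hφ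
  have d1 := px_diff h.hs
  have d2 := py_diff h.hs
  have d3 := px_diff h.hφ
  have d4 := py_diff h.hφ
  have cs := hs1.continuous
  have c1 := k1.continuous
  have c2 := k2.continuous
  have c3 := k3.continuous
  have c4 := k4.continuous
  have c11 := px_cont k1
  have c22 := py_cont k2
  have f11 := px_cont k3
  have f12 := px_cont k4
  have f22 := py_cont k4
  have coms := px_py_comm h.hs
  have comφ := px_py_comm h.hφ
  have cχ := hχ.continuous
  have dχ := hχ.differentiable (by norm_num)
  have X0 := XX_nonneg s φ
  -- the weight
  set ζ : Euc 2 → ℝ := fun y => χ y * χ y with hζ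
  have ζ1 : ContDiff ℝ 1 ζ := hχ.mul hχ
  have dζ := ζ1.differentiable (by norm_num)
  have cζ := ζ1.continuous
  have ζc : HasCompactSupport ζ := hχc.mul_left
  have pxζ : ∀ y, px ζ y = 2 * (χ y * px χ y) := by intro y; rw [hζ, px_mul dχ dχ]; ring
  have pyζ : ∀ y, py ζ y = 2 * (χ y * py χ y) := by intro y; rw [hζ, py_mul dχ dχ]; ring
  have ζ0 : ∀ y, 0 ≤ ζ y := fun y => mul_self_nonneg _
  have ζs : ∀ y, ζ y = χ y ^ 2 := fun y => by rw [hζ]; ring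
  have hInt : ∀ {F : Euc 2 → ℝ}, Continuous F → Integrable (fun y => ζ y * F y) := fun hF =>
    (cζ.mul hF).integrable_of_hasCompactSupport ζc.mul_right
  -- vector field
  set H : Euc 2 → ℝ := fun y => Real.exp (2 * s y) - 1 + px φ y * px φ y + py φ y * py φ y + c * py φ y with hH
  have H1 : ContDiff ℝ 1 H := by rw [hH]; fun_prop
  have dH := H1.differentiable (by norm_num)
  have cH := H1.continuous
  have dE : Differentiable ℝ (fun y => Real.exp (2 * s y)) := by fun_prop
  have hE : ∀ y : Euc 2, HasDerivAt (fun x => Real.exp (2 * x)) ((fun x => 2 * Real.exp (2 * x)) (s y)) (s y) := by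
    intro y
    have := ((hasDerivAt_id (s y)).const_mul 2).exp
    simpa [mul_comm] using this
  have pxE : px (fun y => Real.exp (2 * s y)) = fun y => 2 * Real.exp (2 * s y) * px s y :=
    px_comp (h := fun x => Real.exp (2 * x)) (h' := fun x => 2 * Real.exp (2 * x)) ds hE
  have pyE : py (fun y => Real.exp (2 * s y)) = fun y => 2 * Real.exp (2 * s y) * py s y :=
    py_comp (h := fun x => Real.exp (2 * x)) (h' := fun x => 2 * Real.exp (2 * x)) ds hE
  have pxH : ∀ y, px H y = 2 * Real.exp (2 * s y) * px s y + 2 * (px φ y * px (px φ) y + py φ y * px (py φ) y) + c * px (py φ) y := by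
    intro y
    rw [hH, px_add, px_add, px_add, px_sub_const, px_mul d3 d3, px_mul d4 d4, px_const_mul, pxE]
    · ring
    all_goals fun_prop
  have pyH : ∀ y, py H y = 2 * Real.exp (2 * s y) * py s y + 2 * (px φ y * px (py φ) y + py φ y * py (py φ) y) + c * py (py φ) y := by
    intro y
    rw [hH, py_add, py_add, py_add, py_sub_const, py_mul d3 d3, py_mul d4 d4, py_const_mul, pyE, comφ]
    · ring
    all_goals fun_prop
  set Y1 : Euc 2 → ℝ := fun y => H y * px s y + c * (py s y * px φ y) with hY1
  set Y2 : Euc 2 → ℝ := fun y => H y * py s y - c * (px s y * px φ y) with hY2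
  have Y1c : ContDiff ℝ 1 Y1 := by rw [hY1]; fun_prop
  have Y2c : ContDiff ℝ 1 Y2 := by rw [hY2]; fun_prop
  have pY1 : ∀ y, px Y1 y = px H y * px s y + H y * px (px s) y + c * (px (py s) y * px φ y + py s y * px (px φ) y) := by
    intro y
    rw [hY1, px_add, px_mul dH d1, px_const_mul, px_mul d2 d3]
    all_goals fun_prop
  have pY2 : ∀ y, py Y2 y = py H y * py s y + H y * py (py s) y - c * (px (py s) y * px φ y + px s y * px (py φ) y) := by
    intro y
    rw [hY2, py_sub, py_mul dH d2, py_const_mul, py_mul d1 d3, comφ, coms]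
    all_goals fun_prop
  set g : Euc 2 → ℝ := fun y => px s y ^ 2 + py s y ^ 2 with hg
  set D2 : Euc 2 → ℝ := fun y => px (px φ) y ^ 2 + 2 * px (py φ) y ^ 2 + py (py φ) y ^ 2 with hD2
  set L : Euc 2 → ℝ := fun y => px (px s) y + py (py s) y with hL
  have cg : Continuous g := by rw [hg]; fun_prop
  have cD2 : Continuous D2 := by rw [hD2]; fun_prop
  have cL : Continuous (fun y => L y ^ 2) := by rw [hL]; fun_prop
  have cX := h.contX
  have pw : ∀ y, R1 ≤ ‖y‖ → 1 / 2 * L y ^ 2 + 4 / 5 * μ * g y - μ / 100 * D2 y ≤ px Y1 y + py Y2 y := by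
    intro y hy
    obtain ⟨h1, h2, h3, h4, h5, h6⟩ := hsm y hy
    have key := second_alg (D := L y) (f11 := px (px φ) y) (f12 := px (py φ) y) (f22 := py (py φ) y) h.c_pos h.c_lt rfl h1 h3 h4 h5 h6
    refine key.trans (le_of_eq ?_)
    have q1 := h.eq1 y (hR1.trans hy)
    have q2 := h.eq2 y (hR1.trans hy)
    rw [pY1, pY2, pxH, pyH, hH, hL]
    linear_combination (px (px s) y + py (py s) y) * q1 - c * py s y * q2
  have Hb : ∀ y, R1 ≤ ‖y‖ → H y ^ 2 ≤ 36 * XX s φ y := by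
    intro y hy
    obtain ⟨h1, h2, h3, h4, h5, h6⟩ := hsm y hy
    have e1 : μ / 100 ≤ 1 / 50 := by linarith
    have t1 : |2 * s y| ≤ 1 := by rw [abs_mul]; norm_num; linarith
    have t2 := exp_bound_two t1
    have t3 : |Real.exp (2 * s y) - 1| ≤ 3 * |s y| := by
      have a1 : |Real.exp (2 * s y) - 1| ≤ |Real.exp (2 * s y) - 1 - 2 * s y| + |2 * s y| := by
        have := abs_add_le (Real.exp (2 * s y) - 1 - 2 * s y) (2 * s y)
        simpa using this
      have a2 : (2 * s y) ^ 2 ≤ |s y| := by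
        rw [← sq_abs, abs_mul]; norm_num
        nlinarith [abs_nonneg (s y)]
      have a3 : |2 * s y| = 2 * |s y| := by rw [abs_mul]; norm_num
      linarith
    have t4 : (Real.exp (2 * s y) - 1) ^ 2 ≤ 9 * s y ^ 2 := by
      rw [← sq_abs, ← sq_abs (s y)]; nlinarith [abs_nonneg (Real.exp (2 * s y) - 1)]
    have t5 : (px φ y * px φ y) ^ 2 ≤ px φ y ^ 2 := by
      have : px φ y ^ 2 ≤ 1 := by rw [← sq_abs]; exact pow_le_one₀ (abs_nonneg _) (by linarith)
      nlinarith [sq_nonneg (px φ y)]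
    have t6 : (py φ y * py φ y) ^ 2 ≤ py φ y ^ 2 := by
      have : py φ y ^ 2 ≤ 1 := by rw [← sq_abs]; exact pow_le_one₀ (abs_nonneg _) (by linarith)
      nlinarith [sq_nonneg (py φ y)]
    have t7 : (c * py φ y) ^ 2 ≤ 2 * py φ y ^ 2 := by
      rw [mul_pow]; have := h.c_lt; gcongr
    have t8 : ∀ a b d e : ℝ, (a + b + d + e) ^ 2 ≤ 4 * (a ^ 2 + b ^ 2 + d ^ 2 + e ^ 2) := by
      intro a b d e
      nlinarith [sq_nonneg (a - b), sq_nonneg (a - d), sq_nonneg (a - e), sq_nonneg (b - d), sq_nonneg (b - e), sq_nonneg (d - e)]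
    refine (t8 _ _ _ _).trans ?_
    unfold XX
    nlinarith [sq_nonneg (px s y), sq_nonneg (py s y), sq_nonneg (px φ y), sq_nonneg (py φ y), sq_nonneg (s y)]
  have Y1b : ∀ y, R1 ≤ ‖y‖ → Y1 y ^ 2 ≤ (80 * XX s φ y) * g y := by
    intro y hy
    have e1 := Hb y hy
    have e2 : Y1 y ^ 2 ≤ 2 * (H y ^ 2 * px s y ^ 2) + 2 * (c ^ 2 * (py s y ^ 2 * px φ y ^ 2)) := by
      rw [hY1]; beta_reduce; nlinarith [sq_nonneg (H y * px s y - c * (py s y * px φ y))]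
    have e3 : px φ y ^ 2 ≤ XX s φ y := by
      unfold XX; nlinarith [sq_nonneg (px s y), sq_nonneg (py s y), sq_nonneg (py φ y), sq_nonneg (s y)]
    have e4 : H y ^ 2 * px s y ^ 2 ≤ 36 * XX s φ y * px s y ^ 2 := by gcongr
    have e5 : c ^ 2 * (py s y ^ 2 * px φ y ^ 2) ≤ 2 * (py s y ^ 2 * XX s φ y) := by
      have := h.c_lt; gcongr
    have := X0 y
    rw [hg]; beta_reduce
    nlinarith [mul_nonneg this (sq_nonneg (px s y)), mul_nonneg this (sq_nonneg (py s y))]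
  have Y2b : ∀ y, R1 ≤ ‖y‖ → Y2 y ^ 2 ≤ (80 * XX s φ y) * g y := by
    intro y hy
    have e1 := Hb y hy
    have e2 : Y2 y ^ 2 ≤ 2 * (H y ^ 2 * py s y ^ 2) + 2 * (c ^ 2 * (px s y ^ 2 * px φ y ^ 2)) := by
      rw [hY2]; beta_reduce; nlinarith [sq_nonneg (H y * py s y + c * (px s y * px φ y))]
    have e3 : px φ y ^ 2 ≤ XX s φ y := by
      unfold XX; nlinarith [sq_nonneg (px s y), sq_nonneg (py s y), sq_nonneg (py φ y), sq_nonneg (s y)]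
    have e4 : H y ^ 2 * py s y ^ 2 ≤ 36 * XX s φ y * py s y ^ 2 := by gcongr
    have e5 : c ^ 2 * (px s y ^ 2 * px φ y ^ 2) ≤ 2 * (px s y ^ 2 * XX s φ y) := by
      have := h.c_lt; gcongr
    have := X0 y
    rw [hg]; beta_reduce
    nlinarith [mul_nonneg this (sq_nonneg (px s y)), mul_nonneg this (sq_nonneg (py s y))]
  set G : Euc 2 → ℝ := (annS a b).indicator (fun y => k ^ 2 * XX s φ y) with hG
  have G0 : ∀ y, 0 ≤ G y := fun y => Set.indicator_nonneg (fun y _ => by have := X0 y; positivity) y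
  have iG : Integrable G := (integrable_indicator_iff (annS_meas _ _)).mpr (h.int.const_mul _).integrableOn
  have IG : ∫ y, G y = k ^ 2 * ∫ y in annS a b, XX s φ y := by
    rw [hG, integral_indicator (annS_meas _ _), integral_const_mul]
  have kb : ∀ (t : ℝ) (y : Euc 2), |t| ≤ k → (y ∉ annS a b → t = 0) → t ^ 2 * XX s φ y ≤ G y := by
    intro t y ht ht0
    by_cases hy : y ∈ annS a b
    · rw [hG, Set.indicator_of_mem hy]
      have := X0 y
      have : t ^ 2 ≤ k ^ 2 := sq_le_sq' (by linarith [(abs_le.mp ht).1]) (abs_le.mp ht).2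
      gcongr
    · rw [ht0 hy]; simpa using G0 y
  have kout : ∀ (t : ℝ) (y : Euc 2), (y ∉ annS a b → t = 0) → t ≠ 0 → R1 ≤ ‖y‖ := by
    intro t y ht0 ht
    by_contra hh
    apply ht
    apply ht0
    intro hy
    exact hh (ha.trans hy.1)
  -- first estimate
  have E1 : ∫ y, ζ y * (1 / 2 * L y ^ 2 + 4 / 5 * μ * g y - μ / 100 * D2 y) ≤ ∫ y, (μ / 5 * (ζ y * g y) + 1600 / μ * G y) := by
    have s1 : ∫ y, ζ y * (1 / 2 * L y ^ 2 + 4 / 5 * μ * g y - μ / 100 * D2 y) ≤ ∫ y, ζ y * (px Y1 y + py Y2 y) := by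
      refine integral_mono (hInt (by fun_prop)) (hInt ((px_cont Y1c).add (py_cont Y2c))) ?_
      intro y; beta_reduce
      by_cases hy : χ y = 0
      · simp [hζ, hy]
      · exact mul_le_mul_of_nonneg_left (pw y (hsup y hy)) (ζ0 y)
    refine s1.trans ?_
    rw [integral_div ζ1 ζc Y1c Y2c, ← integral_neg]
    refine integral_mono ?_ (((hInt cg).const_mul _).add (iG.const_mul _)) ?_
    · have e1 : Continuous (fun y => px ζ y * Y1 y) := (px_cont ζ1).mul Y1c.continuous
      have e2 : Continuous (fun y => py ζ y * Y2 y) := (py_cont ζ1).mul Y2c.continuous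
      exact ((e1.integrable_of_hasCompactSupport (px_compact ζc).mul_right).add
        (e2.integrable_of_hasCompactSupport (py_compact ζc).mul_right)).neg
    · intro y; beta_reduce
      have gen : ∀ t V : ℝ, |t| ≤ k → (y ∉ annS a b → t = 0) → (R1 ≤ ‖y‖ → V ^ 2 ≤ (80 * XX s φ y) * g y) →
          -(2 * (χ y * t) * V) ≤ μ / 10 * (ζ y * g y) + 800 / μ * G y := by
        intro t V h1 h2 h3
        have g0 : 0 ≤ g y := by rw [hg]; positivity
        by_cases ht : t = 0
        · rw [ht]
          have := G0 y
          have := ζ0 y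
          have : 0 ≤ μ / 10 * (ζ y * g y) + 800 / μ * G y := by positivity
          simpa using this
        · have a1 := amgm_sq (l := μ / 10) (x := χ y) (k := t) (by positivity) (h3 (kout t y h2 ht)) (by have := X0 y; positivity) g0
          have a2 := kb t y h1 h2
          have a3 := neg_abs_le (χ y * t * V)
          have a4 : 1 / (μ / 10) * t ^ 2 * (80 * XX s φ y) ≤ 800 / μ * G y := by
            calc _ = 800 / μ * (t ^ 2 * XX s φ y) := by field_simp; ring
              _ ≤ _ := by gcongr
          rw [ζs]
          linarith
      have b1 := gen _ (Y1 y) (hk y).1 (fun hy => (hk0 y hy).1) (Y1b y)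
      have b2 := gen _ (Y2 y) (hk y).2 (fun hy => (hk0 y hy).2) (Y2b y)
      rw [pxζ, pyζ]
      have : 1600 / μ * G y = 2 * (800 / μ * G y) := by ring
      rw [this]
      linarith
  have iL : Integrable (fun y => ζ y * L y ^ 2) := hInt cL
  have ig : Integrable (fun y => ζ y * g y) := hInt cg
  have iD : Integrable (fun y => ζ y * D2 y) := hInt cD2
  have E1' : 1 / 2 * (∫ y, ζ y * L y ^ 2) + 4 / 5 * μ * (∫ y, ζ y * g y) - μ / 100 * (∫ y, ζ y * D2 y)
      ≤ μ / 5 * (∫ y, ζ y * g y) + 1600 / μ * ∫ y, G y := by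
    have j1 : Integrable (fun y => μ / 5 * (ζ y * g y)) := ig.const_mul _
    have j2 : Integrable (fun y => 1600 / μ * G y) := iG.const_mul _
    rw [integral_add j1 j2, integral_const_mul, integral_const_mul] at E1
    refine le_trans (le_of_eq ?_) E1
    have j3 : Integrable (fun y => 1 / 2 * (ζ y * L y ^ 2)) := iL.const_mul _
    have j4 : Integrable (fun y => 4 / 5 * μ * (ζ y * g y)) := ig.const_mul _
    have j5 : Integrable (fun y => μ / 100 * (ζ y * D2 y)) := iD.const_mul _
    have j6 : Integrable (fun y => 1 / 2 * (ζ y * L y ^ 2) + 4 / 5 * μ * (ζ y * g y)) := j3.add j4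
    rw [← integral_const_mul, ← integral_const_mul, ← integral_const_mul, ← integral_add j3 j4, ← integral_sub j6 j5]
    congr 1; funext y; ring
  -- second estimate
  have E2 : 3 / 4 * ∫ y, ζ y * D2 y ≤ 5 * (∫ y, ζ y * g y) + 32 * ∫ y, G y := by
    have w1 : ContDiff ℝ 1 (fun y => ζ y * px φ y) := ζ1.mul k3
    have J := jac_identity w1 ζc.mul_right k4
    rw [px_mul dζ d3, py_mul dζ d3] at J
    have cz1 := px_cont ζ1
    have cz2 := py_cont ζ1
    have i1 : Integrable (fun y => px ζ y * (px φ y * py (py φ) y)) :=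
      (Continuous.mul cz1 (c3.mul f22)).integrable_of_hasCompactSupport (px_compact ζc).mul_right
    have i2 : Integrable (fun y => py ζ y * (px φ y * px (py φ) y)) :=
      (Continuous.mul cz2 (c3.mul f12)).integrable_of_hasCompactSupport (py_compact ζc).mul_right
    have i3 : Integrable (fun y => ζ y * (px (px φ) y * py (py φ) y)) := hInt (f11.mul f22)
    have i4 : Integrable (fun y => ζ y * (px (py φ) y ^ 2)) := hInt (f12.pow 2)
    have J2 : (∫ y, px ζ y * (px φ y * py (py φ) y)) + (∫ y, ζ y * (px (px φ) y * py (py φ) y))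
        = (∫ y, py ζ y * (px φ y * px (py φ) y)) + (∫ y, ζ y * (px (py φ) y ^ 2)) := by
      rw [← integral_add i1 i3, ← integral_add i2 i4]
      refine Eq.trans ?_ (J.trans ?_)
      · congr 1; funext y; ring
      · congr 1; funext y; rw [← comφ]; ring
    have i5 : Integrable (fun y => ζ y * (px (px φ) y + py (py φ) y) ^ 2) := hInt (by fun_prop)
    have J3 : (∫ y, ζ y * D2 y) + 2 * (∫ y, ζ y * (px (px φ) y * py (py φ) y)) - 2 * (∫ y, ζ y * (px (py φ) y ^ 2))
        = ∫ y, ζ y * (px (px φ) y + py (py φ) y) ^ 2 := by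
      have i6 : Integrable (fun y => 2 * (ζ y * (px (px φ) y * py (py φ) y))) := i3.const_mul 2
      have i7 : Integrable (fun y => 2 * (ζ y * (px (py φ) y ^ 2))) := i4.const_mul 2
      have i8 : Integrable (fun y => ζ y * D2 y + 2 * (ζ y * (px (px φ) y * py (py φ) y))) := iD.add i6
      rw [← integral_const_mul, ← integral_const_mul, ← integral_add iD i6, ← integral_sub i8 i7]
      congr 1; funext y; rw [hD2]; ring
    have J4 : ∫ y, ζ y * (px (px φ) y + py (py φ) y) ^ 2 ≤ 5 * ∫ y, ζ y * g y := by
      rw [← integral_const_mul]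
      refine integral_mono i5 (ig.const_mul 5) ?_
      intro y; beta_reduce
      by_cases hy : χ y = 0
      · simp [hζ, hy]
      have hy' := hsup y hy
      obtain ⟨h1, h2, h3, h4, h5, h6⟩ := hsm y hy'
      have q2 := h.eq2 y (hR1.trans hy')
      have e1 : px (px φ) y + py (py φ) y = -(2 * px φ y * px s y + (2 * py φ y + c) * py s y) := by linarith
      have e2 : (2 * px φ y) ^ 2 ≤ 1 := by
        have : |2 * px φ y| ≤ 1 := by rw [abs_mul]; norm_num; linarith
        rw [← sq_abs]; exact pow_le_one₀ (abs_nonneg _) this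
      have e3 : (2 * py φ y + c) ^ 2 ≤ 4 := by
        have a1 := abs_le.mp h6
        have := h.c_pos
        nlinarith
      have e4 : (px (px φ) y + py (py φ) y) ^ 2 ≤ 5 * g y := by
        rw [e1, hg]
        beta_reduce
        have cs : (2 * px φ y * px s y + (2 * py φ y + c) * py s y) ^ 2 ≤ ((2 * px φ y) ^ 2 + (2 * py φ y + c) ^ 2) * (px s y ^ 2 + py s y ^ 2) := by
          nlinarith [sq_nonneg (2 * px φ y * py s y - (2 * py φ y + c) * px s y)]
        have : ((2 * px φ y) ^ 2 + (2 * py φ y + c) ^ 2) * (px s y ^ 2 + py s y ^ 2) ≤ 5 * (px s y ^ 2 + py s y ^ 2) := by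
          apply mul_le_mul_of_nonneg_right _ (by positivity); linarith
        rw [neg_sq]; linarith
      calc _ ≤ ζ y * (5 * g y) := mul_le_mul_of_nonneg_left e4 (ζ0 y)
        _ = _ := by ring
    have J5 : 2 * (∫ y, px ζ y * (px φ y * py (py φ) y)) - 2 * (∫ y, py ζ y * (px φ y * px (py φ) y))
        ≤ 1 / 4 * (∫ y, ζ y * D2 y) + 32 * ∫ y, G y := by
      have i6 := i1.const_mul 2
      have i7 := i2.const_mul 2
      have i8 := iD.const_mul (1 / 4)
      have i9 := iG.const_mul 32
      rw [← integral_const_mul, ← integral_const_mul, ← integral_const_mul, ← integral_const_mul, ← integral_sub i6 i7, ← integral_add i8 i9]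
      refine integral_mono (i6.sub i7) (i8.add i9) ?_
      intro y; beta_reduce
      have gen : ∀ t V : ℝ, |t| ≤ k → (y ∉ annS a b → t = 0) →
          |4 * (χ y * t) * (px φ y * V)| ≤ 1 / 4 * (ζ y * V ^ 2) + 16 * G y := by
        intro t V h1 h2
        have xb : (2 * px φ y * V) ^ 2 ≤ (4 * XX s φ y) * V ^ 2 := by
          have e3 : px φ y ^ 2 ≤ XX s φ y := by
            unfold XX; nlinarith [sq_nonneg (px s y), sq_nonneg (py s y), sq_nonneg (py φ y), sq_nonneg (s y)]
          have : (2 * px φ y * V) ^ 2 = (4 * px φ y ^ 2) * V ^ 2 := by ring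
          rw [this]; gcongr
        have a1 := amgm_sq (l := 1 / 4) (x := χ y) (k := t) (by norm_num) xb (by have := X0 y; positivity) (sq_nonneg V)
        have a2 := kb t y h1 h2
        have a3 : |4 * (χ y * t) * (px φ y * V)| = 2 * |χ y * t * (2 * px φ y * V)| := by
          rw [show 4 * (χ y * t) * (px φ y * V) = 2 * (χ y * t * (2 * px φ y * V)) by ring, abs_mul]; norm_num
        rw [a3, ζs]
        refine a1.trans ?_
        norm_num
        linarith
      have b1 := (abs_le.mp (gen _ (py (py φ) y) (hk y).1 (fun hy => (hk0 y hy).1))).2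
      have b2 := (abs_le.mp (gen _ (px (py φ) y) (hk y).2 (fun hy => (hk0 y hy).2))).1
      rw [pxζ, pyζ]
      have z0 := mul_nonneg (ζ0 y) (sq_nonneg (px (px φ) y))
      have z1 := mul_nonneg (ζ0 y) (sq_nonneg (px (py φ) y))
      have e : ζ y * D2 y = ζ y * px (px φ) y ^ 2 + 2 * (ζ y * px (py φ) y ^ 2) + ζ y * py (py φ) y ^ 2 := by rw [hD2]; ring
      rw [e]
      linarith
    linarith
  have IZ : ∫ y, χ y ^ 2 * Z2 s φ y = (∫ y, ζ y * L y ^ 2) + (∫ y, ζ y * g y) + ∫ y, ζ y * D2 y := by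
    have i8 : Integrable (fun y => ζ y * L y ^ 2 + ζ y * g y) := iL.add ig
    rw [← integral_add iL ig, ← integral_add i8 iD]
    congr 1; funext y; rw [← ζs, hL, hg, hD2]; unfold Z2; ring
  rw [IZ, mul_assoc, ← IG]
  have nL : 0 ≤ ∫ y, ζ y * L y ^ 2 := integral_nonneg (fun y => mul_nonneg (ζ0 y) (sq_nonneg _))
  have ng : 0 ≤ ∫ y, ζ y * g y := integral_nonneg (fun y => mul_nonneg (ζ0 y) (by rw [hg]; positivity))
  have nG : 0 ≤ ∫ y, G y := integral_nonneg G0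
  generalize (∫ y, ζ y * L y ^ 2) = IL at *
  generalize (∫ y, ζ y * g y) = Ig at *
  generalize (∫ y, ζ y * D2 y) = ID at *
  generalize (∫ y, G y) = J at *
  have m1 : μ * J ≤ 4 * (J / μ) := by
    rw [← mul_div_assoc, le_div_iff₀ μ0]; nlinarith [mul_nonneg nG μ0.le]
  have e2 := mul_le_mul_of_nonneg_left E2 μ0.le
  have e3 : μ * IL ≤ 2 * IL := mul_le_mul_of_nonneg_right μ2 nL
  have e4 : 1600 / μ * J = 1600 * (J / μ) := by ring
  have e5 : 50000 / μ * J = 50000 * (J / μ) := by ring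
  rw [e4] at E1'
  rw [e5]
  have e6 : 0 ≤ J / μ := by positivity
  nlinarith

/-- annular cutoff -/
def chi (R : ℝ) (y : Euc 2) : ℝ := eta (2 * R) y * (1 - eta (R / 2) y)
lemma chi_contDiff (R : ℝ) : ContDiff ℝ (⊤ : ℕ∞) (chi R) :=
  (eta_contDiff _).mul (contDiff_const.sub (eta_contDiff _))
lemma chi_compact {R : ℝ} (hR : 0 < R) : HasCompactSupport (chi R) :=
  (eta_compact (by linarith)).mul_right
lemma chi_nonneg (R : ℝ) (y : Euc 2) : 0 ≤ chi R y :=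
  mul_nonneg (eta_nonneg _ _) (by linarith [eta_le_one (R / 2) y])
lemma chi_le_one (R : ℝ) (y : Euc 2) : chi R y ≤ 1 :=
  mul_le_one₀ (eta_le_one _ _) (by linarith [eta_le_one (R / 2) y]) (by linarith [eta_nonneg (R / 2) y])
lemma chi_one {R : ℝ} (hR : 0 < R) {y : Euc 2} (hy : y ∈ annS R (2 * R)) : chi R y = 1 := by
  unfold chi
  rw [eta_one (by linarith) hy.2, eta_zero (by linarith) (by linarith [hy.1])]; norm_num
lemma chi_zero {R : ℝ} (hR : 0 < R) {y : Euc 2} (hy : y ∉ annS (R / 2) (4 * R)) : chi R y = 0 := by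
  unfold chi
  by_cases h : R / 2 ≤ ‖y‖
  · have : 4 * R < ‖y‖ := by
      by_contra h2; exact hy ⟨h, not_lt.mp h2⟩
    rw [eta_zero (by linarith) (by linarith)]; simp
  · rw [eta_one (R := R / 2) (by linarith) (by linarith)]; simp
lemma chi_bounds : ∃ K : ℝ, 1 ≤ K ∧ ∀ R : ℝ, 0 < R → ∀ y : Euc 2, (|px (chi R) y| ≤ K / R ∧ |py (chi R) y| ≤ K / R) ∧
    (y ∉ annS (R / 2) (4 * R) → px (chi R) y = 0 ∧ py (chi R) y = 0) := by
  obtain ⟨K, hK1, hK⟩ := eta_bounds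
  refine ⟨3 * K, by linarith, fun R hR y => ?_⟩
  have d1 : Differentiable ℝ (eta (2 * R)) := (eta_contDiff _).differentiable (by simp)
  have d2 : Differentiable ℝ (eta (R / 2)) := (eta_contDiff _).differentiable (by simp)
  have d3 : Differentiable ℝ (fun y => 1 - eta (R / 2) y) := by fun_prop
  have dc : Differentiable ℝ (fun _ : Euc 2 => (1:ℝ)) := by fun_prop
  have ex : px (chi R) y = px (eta (2 * R)) y * (1 - eta (R / 2) y) - eta (2 * R) y * px (eta (R / 2)) y := by
    change px (fun y => eta (2 * R) y * (1 - eta (R / 2) y)) y = _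
    rw [px_mul d1 d3, px_sub dc d2, px_const]; ring
  have ey : py (chi R) y = py (eta (2 * R)) y * (1 - eta (R / 2) y) - eta (2 * R) y * py (eta (R / 2)) y := by
    change py (fun y => eta (2 * R) y * (1 - eta (R / 2) y)) y = _
    rw [py_mul d1 d3, py_sub dc d2, py_const]; ring
  have b1 := hK (2 * R) (by linarith) y
  have b2 := hK (R / 2) (by linarith) y
  have gen : ∀ t u p q : ℝ, |t| ≤ K / (2 * R) → |u| ≤ K / (R / 2) → 0 ≤ p → p ≤ 1 → 0 ≤ q → q ≤ 1 → |t * (1 - p) - q * u| ≤ 3 * K / R := by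
    intro t u p q ht hu hp hp1 hq hq1
    have e1 : |t * (1 - p)| ≤ K / (2 * R) := by
      rw [abs_mul, abs_of_nonneg (by linarith : 0 ≤ 1 - p)]
      nlinarith [abs_nonneg t]
    have e2 : |q * u| ≤ K / (R / 2) := by
      rw [abs_mul, abs_of_nonneg hq]
      nlinarith [abs_nonneg u]
    have e3 := abs_sub (t * (1 - p)) (q * u)
    have e4 : K / (2 * R) + K / (R / 2) = 5 / 2 * (K / R) := by field_simp; norm_num
    have e5 : 3 * K / R = 3 * (K / R) := by ring
    have e6 : 0 < K / R := by positivity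
    linarith
  refine ⟨⟨?_, ?_⟩, ?_⟩
  · rw [ex]; exact gen _ _ _ _ b1.1 b2.1 (eta_nonneg _ _) (eta_le_one _ _) (eta_nonneg _ _) (eta_le_one _ _)
  · rw [ey]; exact gen _ _ _ _ b1.2.1 b2.2.1 (eta_nonneg _ _) (eta_le_one _ _) (eta_nonneg _ _) (eta_le_one _ _)
  · intro hy
    have hy' : ‖y‖ < R / 2 ∨ 4 * R < ‖y‖ := by
      by_contra hh; push Not at hh; exact hy hh
    have a1 : ‖y‖ < 2 * R ∨ 2 * (2 * R) < ‖y‖ := by rcases hy' with h | h; left; linarith; right; linarith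
    have a2 : ‖y‖ < R / 2 ∨ 2 * (R / 2) < ‖y‖ := by rcases hy' with h | h; left; linarith; right; linarith
    rw [ex, ey, px_eta_zero (by linarith) a1, py_eta_zero (by linarith) a1, px_eta_zero (by linarith) a2, py_eta_zero (by linarith) a2]
    simp

def eF (c : ℝ) (s φ : Euc 2 → ℝ) (y : Euc 2) : ℝ := s y + c / 2 * py φ y
def fF (c : ℝ) (s φ : Euc 2 → ℝ) (y : Euc 2) : ℝ := px (px φ) y + py (py φ) y + c * py s y

lemma TW.ann_le_EE {c R0 : ℝ} {s φ : Euc 2 → ℝ} (h : TW c R0 s φ) (a b : ℝ) :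
    ∫ y in annS a b, XX s φ y ≤ EE s φ a := by
  apply setIntegral_mono_set h.int.integrableOn
  · filter_upwards with y; exact XX_nonneg s φ y
  · have hsub : annS a b ⊆ extS a := fun y hy => hy.1
    exact hsub.eventuallyLE

lemma TW.contZ {c R0 : ℝ} {s φ : Euc 2 → ℝ} (h : TW c R0 s φ) : Continuous (Z2 s φ) := by
  have k1 := px_contDiff h.hs
  have k2 := py_contDiff h.hs
  have k3 := px_contDiff h.hφ
  have k4 := py_contDiff h.hφ
  have c1 := k1.continuous
  have c2 := k2.continuous
  have c11 := px_cont k1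
  have c22 := py_cont k2
  have f11 := px_cont k3
  have f12 := px_cont k4
  have f22 := py_cont k4
  unfold Z2; fun_prop
lemma Z2_nonneg (s φ : Euc 2 → ℝ) (y : Euc 2) : 0 ≤ Z2 s φ y := by unfold Z2; positivity

/-- Step C -/
lemma stepC {c R0 : ℝ} {s φ : Euc 2 → ℝ} (h : TW c R0 s φ) : ∃ C > (0:ℝ), ∃ R1 ≥ R0, 
    (∀ y : Euc 2, R1 ≤ ‖y‖ → |s y| ≤ (2 - c ^ 2) / 100 ∧ |φ y| ≤ (2 - c ^ 2) / 100 ∧ |px s y| ≤ (2 - c ^ 2) / 100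
      ∧ |py s y| ≤ (2 - c ^ 2) / 100 ∧ |px φ y| ≤ (2 - c ^ 2) / 100 ∧ |py φ y| ≤ (2 - c ^ 2) / 100) ∧
    ∀ R ≥ 2 * R1, ∫ y, chi R y ^ 2 * Z2 s φ y ≤ C / R ^ 2 * ∫ y in annS (R / 2) (4 * R), XX s φ y := by
  obtain ⟨K, hK1, hK⟩ := chi_bounds
  have μ0 : 0 < 2 - c ^ 2 := by linarith [h.c_lt]
  obtain ⟨r, hr⟩ := h.small ((2 - c ^ 2) / 100) (by positivity)
  have h1 := h.R0_ge
  refine ⟨50000 / (2 - c ^ 2) ^ 2 * K ^ 2, by positivity, max r R0, le_max_right _ _, fun y hy => hr y ((le_max_left _ _).trans hy), ?_⟩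
  intro R hR
  have hm : 1 ≤ max r R0 := h1.trans (le_max_right _ _)
  have R0' : 0 < R := by linarith
  have := second_order h (le_max_right r R0) (fun y hy => hr y ((le_max_left _ _).trans hy)) ((chi_contDiff R).of_le (by exact_mod_cast le_top))
    (chi_compact R0') (χ := chi R) (k := K / R) (a := R / 2) (b := 4 * R) ?_ (fun y => (hK R R0' y).1) (fun y => (hK R R0' y).2) (by linarith)
  · rw [← le_div_iff₀' μ0] at this
    refine this.trans (le_of_eq ?_)
    field_simp
  · intro y hy
    by_contra hh
    apply hy
    apply chi_zero R0'
    intro h2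
    linarith [h2.1]

set_option maxHeartbeats 4000000 in
lemma stepD {c R0 : ℝ} {s φ : Euc 2 → ℝ} (h : TW c R0 s φ) : ∃ C > (0:ℝ), ∃ R1 ≥ R0, ∀ R ≥ R1,
    ∫ y in annS R (2 * R), eF c s φ y ^ 2 ≤ C / R ^ 2 * EE s φ (R / 2) ∧
    ∫ y in annS R (2 * R), |fF c s φ y| ≤ C / R * EE s φ (R / 2) := by
  obtain ⟨C, hC, R1, hR1, hsm, hZ⟩ := stepC h
  obtain ⟨K, hK1, hK⟩ := chi_bounds
  obtain ⟨N, hN0, hN⟩ := gns_sq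
  have μ0 : 0 < 2 - c ^ 2 := by linarith [h.c_lt]
  have μ2 : 2 - c ^ 2 ≤ 2 := by nlinarith [sq_nonneg c]
  set M := 4 * K + 4 + 4 * C with hM
  have hM0 : 0 < M := by positivity
  set T := EE s φ 0 with hT
  have hT0 : 0 ≤ T := EE_nonneg _ _ _
  refine ⟨C + 16 * N * M ^ 2 * T + (C + 1), by positivity, 2 * R1, by linarith [h.R0_ge], ?_⟩
  intro R hR
  have R0' : 0 < R := by linarith [h.R0_ge]
  set I := ∫ y in annS (R / 2) (4 * R), XX s φ y with hI
  have I0 : 0 ≤ I := setIntegral_nonneg (annS_meas _ _) (fun y _ => XX_nonneg s φ y)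
  have IE : I ≤ EE s φ (R / 2) := h.ann_le_EE _ _
  have IT : I ≤ T := IE.trans (EE_anti h.int (by positivity))
  have hZR := hZ R hR
  have hs1 : ContDiff ℝ 1 s := h.hs.of_le (by norm_num)
  have hφ1 : ContDiff ℝ 1 φ := h.hφ.of_le (by norm_num)
  have ds := hs1.differentiable (by norm_num)
  have dφ := hφ1.differentiable (by norm_num)
  have k1 := px_contDiff h.hs
  have k2 := py_contDiff h.hs
  have k3 := px_contDiff h.hφ
  have k4 := py_contDiff h.hφ
  have d3 := px_diff h.hφ
  have d4 := py_diff h.hφ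
  have cs := hs1.continuous
  have c1 := k1.continuous
  have c2 := k2.continuous
  have c3 := k3.continuous
  have c4 := k4.continuous
  have c11 := px_cont k1
  have c22 := py_cont k2
  have f11 := px_cont k3
  have f12 := px_cont k4
  have f22 := py_cont k4
  have comφ := px_py_comm h.hφ
  have X0 := XX_nonneg s φ
  have Z0 := Z2_nonneg s φ
  have cX := h.contX
  have cZ := h.contZ
  set χ := chi R with hχ
  have χ1 : ContDiff ℝ 1 χ := (chi_contDiff R).of_le (by exact_mod_cast le_top)
  have dχ := χ1.differentiable (by norm_num)
  have cχ := χ1.continuous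
  have χc : HasCompactSupport χ := chi_compact R0'
  set q : Euc 2 → ℝ := fun y => px φ y * px φ y + py φ y * py φ y + s y * s y with hq
  have q1 : ContDiff ℝ 1 q := by rw [hq]; fun_prop
  have dq := q1.differentiable (by norm_num)
  have pxq : ∀ y, px q y = 2 * (px φ y * px (px φ) y + py φ y * px (py φ) y + s y * px s y) := by
    intro y
    rw [hq, px_add, px_add, px_mul d3 d3, px_mul d4 d4, px_mul ds ds]
    · ring
    all_goals fun_prop
  have pyq : ∀ y, py q y = 2 * (px φ y * px (py φ) y + py φ y * py (py φ) y + s y * py s y) := by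
    intro y
    rw [hq, py_add, py_add, py_mul d3 d3, py_mul d4 d4, py_mul ds ds, comφ]
    · ring
    all_goals fun_prop
  set ζ : Euc 2 → ℝ := fun y => χ y * χ y with hζ
  have ζ1 : ContDiff ℝ 1 ζ := χ1.mul χ1
  have dζ := ζ1.differentiable (by norm_num)
  have ζc : HasCompactSupport ζ := χc.mul_left
  set F : Euc 2 → ℝ := fun y => ζ y * q y with hF
  have F1 : ContDiff ℝ 1 F := ζ1.mul q1
  have Fc : HasCompactSupport F := ζc.mul_right
  have GN := hN F F1 Fc
  set G : Euc 2 → ℝ := (annS (R / 2) (4 * R)).indicator (XX s φ) with hG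
  have G0 : ∀ y, 0 ≤ G y := fun y => Set.indicator_nonneg (fun y _ => X0 y) y
  have iG : Integrable G := (integrable_indicator_iff (annS_meas _ _)).mpr h.int.integrableOn
  have IG : ∫ y, G y = I := by rw [hG, integral_indicator (annS_meas _ _)]
  have iZ : Integrable (fun y => χ y ^ 2 * Z2 s φ y) := by
    have : Continuous (fun y => χ y ^ 2 * Z2 s φ y) := by fun_prop
    apply this.integrable_of_hasCompactSupport
    have : HasCompactSupport (fun y => χ y ^ 2) := by simpa [pow_two] using ζc
    exact this.mul_right
  have qX : ∀ y, q y ≤ XX s φ y := by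
    intro y; rw [hq]; unfold XX; linarith [sq_nonneg (px s y), sq_nonneg (py s y)]
  have q0 : ∀ y, 0 ≤ q y := by intro y; rw [hq]; linarith [sq_nonneg (px φ y), sq_nonneg (py φ y), sq_nonneg (s y)]
  -- gradient estimate
  have gen : ∀ (y : Euc 2) (t u v w : ℝ), |t| ≤ K / R → (y ∉ annS (R / 2) (4 * R) → t = 0) → u ^ 2 + v ^ 2 + w ^ 2 ≤ Z2 s φ y →
      |2 * (χ y * t) * q y + χ y * χ y * (2 * (px φ y * u + py φ y * v + s y * w))| ≤ (2 * K + 1) / R * G y + R * (χ y ^ 2 * Z2 s φ y) := by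
    intro y t u v w ht ht0 hu
    by_cases hy : y ∈ annS (R / 2) (4 * R)
    · have gy : G y = XX s φ y := by rw [hG, Set.indicator_of_mem hy]
      rw [gy]
      have x0 := chi_nonneg R y
      have x1 := chi_le_one R y
      rw [← hχ] at x0 x1
      have a1 : |2 * (χ y * t) * q y| ≤ 2 * K / R * XX s φ y := by
        rw [abs_mul, abs_mul, abs_mul, abs_of_nonneg (q0 y), abs_of_nonneg x0]
        have : χ y * |t| ≤ 1 * (K / R) := mul_le_mul x1 ht (abs_nonneg _) zero_le_one
        calc |2| * (χ y * |t|) * q y ≤ 2 * (1 * (K / R)) * XX s φ y := by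
              have := qX y; have := q0 y; norm_num at *; gcongr
          _ = _ := by ring
      have a2 : |2 * (px φ y * u + py φ y * v + s y * w)| ≤ 1 / R * XX s φ y + R * Z2 s φ y := by
        have i1 : 1 / R * q y + R * (u ^ 2 + v ^ 2 + w ^ 2) ≤ 1 / R * XX s φ y + R * Z2 s φ y := by
          have := qX y; gcongr
        refine le_trans ?_ i1
        have am : ∀ a b : ℝ, 2 * |a * b| ≤ 1 / R * (a * a) + R * b ^ 2 := by
          intro a b
          have : 1 / R * (a * a) + R * b ^ 2 - 2 * |a * b| = 1 / R * (|a| - R * |b|) ^ 2 := by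
            rw [abs_mul]; field_simp; rw [sub_sq, ← sq_abs a, ← sq_abs b]; ring
          have : 0 ≤ 1 / R * (|a| - R * |b|) ^ 2 := by positivity
          linarith
        have b1 := am (px φ y) u
        have b2 := am (py φ y) v
        have b3 := am (s y) w
        have b4 : |2 * (px φ y * u + py φ y * v + s y * w)| ≤ 2 * |px φ y * u| + 2 * |py φ y * v| + 2 * |s y * w| := by
          rw [abs_mul, abs_two]
          have := abs_add_three (px φ y * u) (py φ y * v) (s y * w)
          linarith
        rw [hq]; beta_reduce; linarith
      have a3 : |χ y * χ y * (2 * (px φ y * u + py φ y * v + s y * w))| ≤ 1 / R * XX s φ y + R * (χ y ^ 2 * Z2 s φ y) := by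
        rw [abs_mul, abs_of_nonneg (mul_nonneg x0 x0)]
        have x2 : χ y * χ y ≤ 1 := mul_le_one₀ x1 x0 x1
        have x3 := mul_le_mul_of_nonneg_left a2 (mul_nonneg x0 x0)
        have x4 : χ y * χ y * (1 / R * XX s φ y) ≤ 1 * (1 / R * XX s φ y) := by
          apply mul_le_mul_of_nonneg_right x2; have := X0 y; positivity
        calc _ ≤ _ := x3
          _ = χ y * χ y * (1 / R * XX s φ y) + R * (χ y ^ 2 * Z2 s φ y) := by ring
          _ ≤ _ := by linarith
      have a4 := abs_add_le (2 * (χ y * t) * q y) (χ y * χ y * (2 * (px φ y * u + py φ y * v + s y * w)))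
      have a5 : (2 * K + 1) / R * XX s φ y = 2 * K / R * XX s φ y + 1 / R * XX s φ y := by ring
      linarith
    · rw [ht0 hy, hχ, chi_zero R0' hy]
      have := G0 y
      simp; positivity
  have Z11 : ∀ y, px (px φ) y ^ 2 + px (py φ) y ^ 2 + px s y ^ 2 ≤ Z2 s φ y := by
    intro y; unfold Z2
    linarith [sq_nonneg (px (px s) y + py (py s) y), sq_nonneg (py s y), sq_nonneg (px (py φ) y), sq_nonneg (py (py φ) y)]
  have Z22 : ∀ y, px (py φ) y ^ 2 + py (py φ) y ^ 2 + py s y ^ 2 ≤ Z2 s φ y := by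
    intro y; unfold Z2
    linarith [sq_nonneg (px (px s) y + py (py s) y), sq_nonneg (px s y), sq_nonneg (px (py φ) y), sq_nonneg (px (px φ) y)]
  have gx : ∀ y, |px F y| ≤ (2 * K + 1) / R * G y + R * (χ y ^ 2 * Z2 s φ y) := by
    intro y
    have := gen y _ _ _ _ (hK R R0' y).1.1 (fun hy => ((hK R R0' y).2 hy).1) (Z11 y)
    rw [hF, px_mul dζ dq, hζ, px_mul dχ dχ]; beta_reduce; rw [pxq, ← hχ] at *
    refine le_trans (le_of_eq ?_) this
    congr 1; ring
  have gy : ∀ y, |py F y| ≤ (2 * K + 1) / R * G y + R * (χ y ^ 2 * Z2 s φ y) := by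
    intro y
    have := gen y _ _ _ _ (hK R R0' y).1.2 (fun hy => ((hK R R0' y).2 hy).2) (Z22 y)
    rw [hF, py_mul dζ dq, hζ, py_mul dχ dχ]; beta_reduce; rw [pyq, ← hχ] at *
    refine le_trans (le_of_eq ?_) this
    congr 1; ring
  have ZI : ∫ y, χ y ^ 2 * Z2 s φ y ≤ C / R ^ 2 * I := hZR
  have B1 : ∫ y, (|px F y| + |py F y|) ≤ M / R * I := by
    have j1 : Integrable (fun y => 2 * ((2 * K + 1) / R) * G y) := iG.const_mul _
    have j2 : Integrable (fun y => 2 * R * (χ y ^ 2 * Z2 s φ y)) := iZ.const_mul _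
    have : ∫ y, (|px F y| + |py F y|) ≤ ∫ y, (2 * ((2 * K + 1) / R) * G y + 2 * R * (χ y ^ 2 * Z2 s φ y)) := by
      refine integral_mono_of_nonneg (Eventually.of_forall fun y => by positivity) (j1.add j2) (Eventually.of_forall fun y => ?_)
      have := gx y
      have := gy y
      simp only [Pi.add_apply]
      linarith
    refine this.trans ?_
    rw [integral_add j1 j2, integral_const_mul, integral_const_mul, IG]
    have : 2 * R * ∫ y, χ y ^ 2 * Z2 s φ y ≤ 2 * R * (C / R ^ 2 * I) := by gcongr
    have e : 2 * R * (C / R ^ 2 * I) = 2 * C / R * I := by field_simp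
    have e2 : M / R * I = 2 * ((2 * K + 1) / R) * I + 2 * C / R * I + (2 + 2 * C) / R * I := by rw [hM]; ring
    have e3 : 0 ≤ (2 + 2 * C) / R * I := by positivity
    linarith
  have B2 : ∫ y, F y ^ 2 ≤ N * M ^ 2 * T / R ^ 2 * I := by
    refine GN.trans ?_
    have n0 : 0 ≤ ∫ y, (|px F y| + |py F y|) := integral_nonneg fun y => by positivity
    calc N * (∫ y, (|px F y| + |py F y|)) ^ 2 ≤ N * (M / R * I) ^ 2 := by gcongr
      _ = N * M ^ 2 / R ^ 2 * (I * I) := by ring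
      _ ≤ N * M ^ 2 / R ^ 2 * (T * I) := by gcongr
      _ = _ := by ring
  have iF : Integrable (fun y => F y ^ 2) := by
    have : Continuous (fun y => F y ^ 2) := F1.continuous.pow 2
    apply this.integrable_of_hasCompactSupport
    have e : (fun y => F y ^ 2) = fun y => F y * F y := by funext y; ring
    rw [e]; exact Fc.mul_left
  have small1 : ∀ a : ℝ, |a| ≤ (2 - c ^ 2) / 100 → a ^ 2 ≤ 1 / 4 ∧ |a| ≤ 1 / 50 := by
    intro a ha
    have : |a| ≤ 1 / 50 := by linarith
    refine ⟨?_, this⟩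
    rw [← sq_abs]; nlinarith [abs_nonneg a]
  constructor
  · have ce : Continuous (fun y => eF c s φ y ^ 2) := by unfold eF; fun_prop
    have st : ∫ y in annS R (2 * R), eF c s φ y ^ 2 ≤ ∫ y in annS R (2 * R), (χ y ^ 2 * Z2 s φ y + 16 * F y ^ 2) := by
      refine setIntegral_mono_on (ce.continuousOn.integrableOn_compact (annS_compact _ _)) ((iZ.add (iF.const_mul 16)).integrableOn) (annS_meas _ _) ?_
      intro y hy
      have hy1 : R1 ≤ ‖y‖ := by have := hy.1; linarith
      rw [show F y = q y by rw [hF, hζ]; beta_reduce; rw [hχ, chi_one R0' hy]; ring, hχ, chi_one R0' hy]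
      obtain ⟨h1, h2, h3, h4, h5, h6⟩ := hsm y hy1
      have e1 := h.eq1 y (hR1.trans hy1)
      set E := Real.exp (2 * s y) - 1 - 2 * s y with hEd
      have e2 : E ^ 2 ≤ 16 * (s y * s y) ^ 2 := by
        have : |2 * s y| ≤ 1 := by rw [abs_mul]; norm_num; linarith [(small1 _ h1).2]
        have := exp_bound_two this
        rw [← sq_abs]
        calc |E| ^ 2 ≤ ((2 * s y) ^ 2) ^ 2 := by gcongr
          _ = _ := by ring
      have e3 : 2 * eF c s φ y = (px (px s) y + py (py s) y) + (px s y ^ 2 + py s y ^ 2) - (px φ y ^ 2 + py φ y ^ 2) - E := by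
        unfold eF; rw [hEd]; linarith
      set L := px (px s) y + py (py s) y with hL
      set g := px s y ^ 2 + py s y ^ 2 with hg
      set p := px φ y ^ 2 + py φ y ^ 2 with hp
      have t8 : (L + g - p - E) ^ 2 ≤ 4 * (L ^ 2 + g ^ 2 + p ^ 2 + E ^ 2) := by
        linarith [sq_nonneg (L - g), sq_nonneg (L + p), sq_nonneg (L + E), sq_nonneg (g + p), sq_nonneg (g + E), sq_nonneg (p - E)]
      have g0 : 0 ≤ g := by positivity
      have p0 : 0 ≤ p := by positivity
      have g1 : g ≤ 1 := by linarith [(small1 _ h3).1, (small1 _ h4).1]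
      have g2 : g ^ 2 ≤ g := by rw [sq]; exact mul_le_of_le_one_left g0 g1
      have q2 : p ^ 2 + 16 * (s y * s y) ^ 2 ≤ 16 * q y ^ 2 := by
        have : q y = p + s y * s y := by rw [hq, hp]; ring
        rw [this]
        have := mul_nonneg p0 (mul_self_nonneg (s y))
        linarith [sq_nonneg p]
      have z : L ^ 2 + g ≤ Z2 s φ y := by
        unfold Z2; rw [hL, hg]
        linarith [sq_nonneg (px (px φ) y), sq_nonneg (px (py φ) y), sq_nonneg (py (py φ) y)]
      have : 4 * eF c s φ y ^ 2 = (L + g - p - E) ^ 2 := by rw [← e3]; ring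
      linarith
    have st2 : ∫ y in annS R (2 * R), (χ y ^ 2 * Z2 s φ y + 16 * F y ^ 2) ≤ ∫ y, (χ y ^ 2 * Z2 s φ y + 16 * F y ^ 2) := by
      apply setIntegral_le_integral (iZ.add (iF.const_mul 16))
      filter_upwards with y
      have := Z0 y
      simp only [Pi.add_apply, Pi.zero_apply]; positivity
    have st3 : ∫ y, (χ y ^ 2 * Z2 s φ y + 16 * F y ^ 2) ≤ C / R ^ 2 * I + 16 * (N * M ^ 2 * T / R ^ 2 * I) := by
      have j : Integrable (fun y => 16 * F y ^ 2) := iF.const_mul 16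
      rw [integral_add iZ j, integral_const_mul]; linarith
    refine st.trans (st2.trans (st3.trans ?_))
    have e : C / R ^ 2 * I + 16 * (N * M ^ 2 * T / R ^ 2 * I) = (C + 16 * N * M ^ 2 * T + 0) / R ^ 2 * I := by ring
    rw [e]
    gcongr
    positivity
  · have ce : Continuous (fun y => |fF c s φ y|) := by unfold fF; fun_prop
    have iX : Integrable (fun y => 1 / R * G y) := iG.const_mul _
    have iZ' : Integrable (fun y => R * (χ y ^ 2 * Z2 s φ y)) := iZ.const_mul _
    have st : ∫ y in annS R (2 * R), |fF c s φ y| ≤ ∫ y in annS R (2 * R), (1 / R * G y + R * (χ y ^ 2 * Z2 s φ y)) := by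
      refine setIntegral_mono_on (ce.continuousOn.integrableOn_compact (annS_compact _ _)) ((iX.add iZ').integrableOn) (annS_meas _ _) ?_
      intro y hy
      have hy1 : R1 ≤ ‖y‖ := by have := hy.1; linarith
      have hy2 : y ∈ annS (R / 2) (4 * R) := ⟨by linarith [hy.1], by linarith [hy.2]⟩
      rw [hχ, chi_one R0' hy, hG, Set.indicator_of_mem hy2]
      have e2 := h.eq2 y (hR1.trans hy1)
      have e3 : fF c s φ y = -(2 * (px s y * px φ y + py s y * py φ y)) := by unfold fF; linarith
      rw [e3, abs_neg]
      have am : ∀ a b : ℝ, 2 * |a * b| ≤ R * a ^ 2 + 1 / R * b ^ 2 := by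
        intro a b
        have : R * a ^ 2 + 1 / R * b ^ 2 - 2 * |a * b| = 1 / R * (R * |a| - |b|) ^ 2 := by
          rw [abs_mul]; field_simp; rw [sub_sq, ← sq_abs a, ← sq_abs b]; ring
        have : 0 ≤ 1 / R * (R * |a| - |b|) ^ 2 := by positivity
        linarith
      have b1 := am (px s y) (px φ y)
      have b2 := am (py s y) (py φ y)
      have b3 : |2 * (px s y * px φ y + py s y * py φ y)| ≤ 2 * |px s y * px φ y| + 2 * |py s y * py φ y| := by
        rw [abs_mul, abs_two]
        have := abs_add_le (px s y * px φ y) (py s y * py φ y)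
        linarith
      have b4 : px φ y ^ 2 + py φ y ^ 2 ≤ XX s φ y := by
        unfold XX; linarith [sq_nonneg (px s y), sq_nonneg (py s y), sq_nonneg (s y)]
      have b5 : px s y ^ 2 + py s y ^ 2 ≤ Z2 s φ y := by
        unfold Z2; linarith [sq_nonneg (px (px s) y + py (py s) y), sq_nonneg (px (px φ) y), sq_nonneg (px (py φ) y), sq_nonneg (py (py φ) y)]
      have b6 := mul_le_mul_of_nonneg_left b4 (by positivity : 0 ≤ 1 / R)
      have b7 := mul_le_mul_of_nonneg_left b5 R0'.le
      linarith
    have st2 : ∫ y in annS R (2 * R), (1 / R * G y + R * (χ y ^ 2 * Z2 s φ y)) ≤ ∫ y, (1 / R * G y + R * (χ y ^ 2 * Z2 s φ y)) := by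
      apply setIntegral_le_integral (iX.add iZ')
      filter_upwards with y
      have := Z0 y
      have := G0 y
      simp only [Pi.add_apply, Pi.zero_apply]; positivity
    have st3 : ∫ y, (1 / R * G y + R * (χ y ^ 2 * Z2 s φ y)) ≤ 1 / R * I + R * (C / R ^ 2 * I) := by
      rw [integral_add iX iZ', integral_const_mul, integral_const_mul, IG]; gcongr
    refine st.trans (st2.trans (st3.trans ?_))
    have e : 1 / R * I + R * (C / R ^ 2 * I) = (0 + (C + 1)) / R * I := by field_simp; ring
    rw [e]
    gcongr
    positivity

lemma dyadic {G : Euc 2 → ℝ} (hG : Continuous G) (G0 : ∀ y, 0 ≤ G y) {C R1 q β : ℝ} (hR1 : 1 ≤ R1) (hq : 0 ≤ q) (hβ : 0 < β)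
    (h : ∀ R ≥ R1, ∫ y in annS R (2 * R), G y ≤ C * R ^ (-(q + β))) :
    Integrable (fun y : Euc 2 => (1 + ‖y‖) ^ q * G y) := by
  have hcont : Continuous (fun y : Euc 2 => (1 + ‖y‖) ^ q * G y) := by
    refine Continuous.mul ?_ hG
    exact (continuous_const.add continuous_norm).rpow_const (fun y => Or.inr hq)
  have hR0 : 0 < R1 := by linarith
  have hU : (⋃ n : ℕ, annS (2 ^ n * R1) (2 * (2 ^ n * R1))) ∪ closedBall (0 : Euc 2) R1 = Set.univ := by
    rw [Set.eq_univ_iff_forall]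
    intro y
    by_cases hy : ‖y‖ ≤ R1
    · right; simpa using hy
    · left
      push Not at hy
      have h1 : 1 ≤ ‖y‖ / R1 := by rw [le_div_iff₀ hR0]; linarith
      obtain ⟨n, hn1, hn2⟩ := exists_nat_pow_near h1 (by norm_num : (1:ℝ) < 2)
      rw [Set.mem_iUnion]
      refine ⟨n, ?_, ?_⟩
      · rwa [le_div_iff₀ hR0] at hn1
      · rw [div_lt_iff₀ hR0, pow_succ] at hn2; linarith
  rw [← integrableOn_univ, ← hU, integrableOn_union]
  refine ⟨?_, hcont.continuousOn.integrableOn_compact (isCompact_closedBall _ _)⟩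
  apply integrableOn_iUnion_of_summable_integral_norm
  · intro n; exact hcont.continuousOn.integrableOn_compact (annS_compact _ _)
  · set θ : ℝ := 2 ^ (-β) with hθ
    have hθ0 : 0 < θ := by positivity
    have hθ1 : θ < 1 := by
      rw [hθ]; exact Real.rpow_lt_one_of_one_lt_of_neg (by norm_num) (by linarith)
    have hsum : Summable (fun n : ℕ => 4 ^ q * C * R1 ^ (-β) * θ ^ n) :=
      (summable_geometric_of_lt_one hθ0.le hθ1).mul_left _
    refine Summable.of_nonneg_of_le (fun n => integral_nonneg fun y => norm_nonneg _) ?_ hsum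
    intro n
    set R := 2 ^ n * R1 with hR
    have hRge : R1 ≤ R := by
      rw [hR]; nlinarith [one_le_pow₀ (by norm_num : (1:ℝ) ≤ 2) (n := n)]
    have Rpos : 0 < R := by linarith
    have s1 : ∫ y in annS R (2 * R), ‖(1 + ‖y‖) ^ q * G y‖ ≤ ∫ y in annS R (2 * R), (4 * R) ^ q * G y := by
      refine setIntegral_mono_on (hcont.norm.continuousOn.integrableOn_compact (annS_compact _ _))
        ((hG.const_mul _).continuousOn.integrableOn_compact (annS_compact _ _)) (annS_meas _ _) ?_
      intro y hy
      have : 0 ≤ (1 + ‖y‖) ^ q * G y := by have := G0 y; positivity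
      rw [Real.norm_eq_abs, abs_of_nonneg this]
      have := G0 y
      gcongr
      have := hy.2
      linarith
    refine s1.trans ?_
    rw [integral_const_mul]
    have s2 := h R hRge
    calc (4 * R) ^ q * ∫ y in annS R (2 * R), G y ≤ (4 * R) ^ q * (C * R ^ (-(q + β))) := by gcongr
      _ = 4 ^ q * C * (R ^ q * R ^ (-(q + β))) := by rw [Real.mul_rpow (by norm_num) Rpos.le]; ring
      _ = 4 ^ q * C * R ^ (-β) := by rw [← Real.rpow_add Rpos]; congr 2; ring
      _ = _ := by
        rw [hR, Real.mul_rpow (by positivity) hR0.le, hθ, ← Real.rpow_natCast (2 ^ (-β)), ← Real.rpow_mul (by norm_num),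
          ← Real.rpow_natCast 2, ← Real.rpow_mul (by norm_num)]
        rw [show (n : ℝ) * -β = -β * n by ring]; ring

lemma TW.cont_e {c R0 : ℝ} {s φ : Euc 2 → ℝ} (h : TW c R0 s φ) : Continuous (eF c s φ) := by
  have := h.hs.continuous
  have := (py_contDiff h.hφ).continuous
  unfold eF; fun_prop
lemma TW.cont_f {c R0 : ℝ} {s φ : Euc 2 → ℝ} (h : TW c R0 s φ) : Continuous (fF c s φ) := by
  have := px_cont (px_contDiff h.hφ)
  have := py_cont (py_contDiff h.hφ)
  have := (py_contDiff h.hs).continuous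
  unfold fF; fun_prop

lemma weighted {c R0 : ℝ} {s φ : Euc 2 → ℝ} (h : TW c R0 s φ) : ∃ δ > (0:ℝ), δ ≤ 1 ∧
    Integrable (fun y : Euc 2 => (1 + ‖y‖) ^ (2 + δ) * eF c s φ y ^ 2) ∧
    Integrable (fun y : Euc 2 => (1 + ‖y‖) ^ (1 + δ) * |fF c s φ y|) := by
  obtain ⟨C, hC, R1, hR1, hD⟩ := stepD h
  obtain ⟨A, hA, α, hα, hα1, R2, hR2, hE⟩ := energy_decay h
  have h1 := h.R0_ge
  set R3 := max R1 (2 * R2) with hR3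
  have hR31 : 1 ≤ R3 := by have := le_max_left R1 (2 * R2); linarith
  have key : ∀ R ≥ R3, EE s φ (R / 2) ≤ A * 2 ^ α * R ^ (-α) := by
    intro R hR
    have h2 : R ≥ 2 * R2 := (le_max_right R1 (2 * R2)).trans hR
    have := hE (R / 2) (by linarith)
    have Rp : 0 < R := by linarith
    refine this.trans (le_of_eq ?_)
    rw [Real.div_rpow Rp.le (by norm_num), Real.rpow_neg (by norm_num : (0:ℝ) ≤ 2)]
    field_simp
  have ce := h.cont_e
  have cf := h.cont_f
  refine ⟨α / 2, by positivity, by linarith, ?_, ?_⟩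
  · refine dyadic (C := C * (A * 2 ^ α)) (R1 := R3) (β := α / 2) (ce.pow 2) (fun y => sq_nonneg _) hR31 (by positivity) (by positivity) ?_
    intro R hR
    have Rp : 0 < R := by linarith
    refine (hD R ((le_max_left _ _).trans hR)).1.trans ?_
    calc C / R ^ 2 * EE s φ (R / 2) ≤ C / R ^ 2 * (A * 2 ^ α * R ^ (-α)) := by gcongr; exact key R hR
      _ = C * (A * 2 ^ α) * (R ^ (-2:ℝ) * R ^ (-α)) := by
        have : R ^ (-2:ℝ) = (R ^ 2)⁻¹ := by rw [Real.rpow_neg Rp.le, Real.rpow_two]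
        rw [this]; ring
      _ = _ := by rw [← Real.rpow_add Rp]; congr 2; ring
  · refine dyadic (C := C * (A * 2 ^ α)) (R1 := R3) (β := α / 2) cf.abs (fun y => abs_nonneg _) hR31 (by positivity) (by positivity) ?_
    intro R hR
    have Rp : 0 < R := by linarith
    refine (hD R ((le_max_left _ _).trans hR)).2.trans ?_
    calc C / R * EE s φ (R / 2) ≤ C / R * (A * 2 ^ α * R ^ (-α)) := by gcongr; exact key R hR
      _ = C * (A * 2 ^ α) * (R ^ (-1:ℝ) * R ^ (-α)) := by
        rw [Real.rpow_neg_one]; ring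
      _ = _ := by rw [← Real.rpow_add Rp]; congr 2; ring

lemma coord_contDiff (i : Fin 2) {n : WithTop ℕ∞} : ContDiff ℝ n (fun z : Euc 2 => z i) :=
  (EuclideanSpace.proj i : Euc 2 →L[ℝ] ℝ).contDiff
lemma coord_diff (i : Fin 2) : Differentiable ℝ (fun z : Euc 2 => z i) :=
  (coord_contDiff i (n := 1)).differentiable (by norm_num)
lemma coord_cont (i : Fin 2) : Continuous (fun z : Euc 2 => z i) :=
  (coord_contDiff i (n := 1)).continuous
lemma fderiv_coord (i : Fin 2) (y : Euc 2) (v : Euc 2) : fderiv ℝ (fun z : Euc 2 => z i) y v = v i := by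
  have : HasFDerivAt (fun z : Euc 2 => z i) (EuclideanSpace.proj i : Euc 2 →L[ℝ] ℝ) y :=
    (EuclideanSpace.proj i : Euc 2 →L[ℝ] ℝ).hasFDerivAt
  rw [this.fderiv]; rfl
lemma px_c0 : px (fun z : Euc 2 => z 0) = fun _ => 1 := by
  funext y; unfold px; rw [fderiv_coord]; simp [basisVec]
lemma px_c1 : px (fun z : Euc 2 => z 1) = fun _ => 0 := by
  funext y; unfold px; rw [fderiv_coord]; simp [basisVec]
lemma py_c0 : py (fun z : Euc 2 => z 0) = fun _ => 0 := by
  funext y; unfold py; rw [fderiv_coord]; simp [basisVec]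
lemma py_c1 : py (fun z : Euc 2 => z 1) = fun _ => 1 := by
  funext y; unfold py; rw [fderiv_coord]; simp [basisVec]

def QQ (k ε : ℝ) (z : Euc 2) : ℝ := k * (z 0 * z 0) + z 1 * z 1 + ε ^ 2
def Gam (k ε : ℝ) (z : Euc 2) : ℝ := 1 / 2 * Real.log (QQ k ε z)

section kern
variable {k ε : ℝ}
lemma QQ_pos (hk : 0 < k) (hε : 0 < ε) (z : Euc 2) : 0 < QQ k ε z := by
  unfold QQ; nlinarith [mul_nonneg hk.le (mul_self_nonneg (z 0)), mul_self_nonneg (z 1), pow_pos hε 2]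
lemma QQ_contDiff {n : WithTop ℕ∞} : ContDiff ℝ n (QQ k ε) := by
  have := coord_contDiff 0 (n := n)
  have := coord_contDiff 1 (n := n)
  unfold QQ; fun_prop
lemma QQ_cont : Continuous (QQ k ε) := (QQ_contDiff (n := 1)).continuous
lemma QQ_diff : Differentiable ℝ (QQ k ε) := (QQ_contDiff (n := 1)).differentiable (by norm_num)
lemma px_QQ : px (QQ k ε) = fun z => 2 * k * z 0 := by
  have := coord_diff 0
  have := coord_diff 1
  change px (fun z : Euc 2 => k * (z 0 * z 0) + z 1 * z 1 + ε ^ 2) = _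
  funext z
  rw [px_add, px_add, px_const_mul, px_mul, px_mul, px_c0, px_c1, px_const]
  · ring
  all_goals fun_prop
lemma py_QQ : py (QQ k ε) = fun z => 2 * z 1 := by
  have := coord_diff 0
  have := coord_diff 1
  change py (fun z : Euc 2 => k * (z 0 * z 0) + z 1 * z 1 + ε ^ 2) = _
  funext z
  rw [py_add, py_add, py_const_mul, py_mul, py_mul, py_c0, py_c1, py_const]
  · ring
  all_goals fun_prop
lemma Gam_contDiff (hk : 0 < k) (hε : 0 < ε) {n : WithTop ℕ∞} : ContDiff ℝ n (Gam k ε) := by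
  unfold Gam
  exact contDiff_const.mul (QQ_contDiff.log (fun z => (QQ_pos hk hε z).ne'))
lemma px_Gam (hk : 0 < k) (hε : 0 < ε) : px (Gam k ε) = fun z => k * z 0 * (QQ k ε z)⁻¹ := by
  have h1 : px (fun z => Real.log (QQ k ε z)) = fun z => (QQ k ε z)⁻¹ * px (QQ k ε) z :=
    px_comp (h := Real.log) (h' := fun x => x⁻¹) QQ_diff (fun y => Real.hasDerivAt_log (QQ_pos hk hε y).ne')
  have d : Differentiable ℝ (fun z => Real.log (QQ k ε z)) := QQ_diff.log (fun z => (QQ_pos hk hε z).ne')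
  change px (fun z => 1 / 2 * Real.log (QQ k ε z)) = _
  rw [px_const_mul _ d, h1, px_QQ]; funext z; ring
lemma py_Gam (hk : 0 < k) (hε : 0 < ε) : py (Gam k ε) = fun z => z 1 * (QQ k ε z)⁻¹ := by
  have h1 : py (fun z => Real.log (QQ k ε z)) = fun z => (QQ k ε z)⁻¹ * py (QQ k ε) z :=
    py_comp (h := Real.log) (h' := fun x => x⁻¹) QQ_diff (fun y => Real.hasDerivAt_log (QQ_pos hk hε y).ne')
  have d : Differentiable ℝ (fun z => Real.log (QQ k ε z)) := QQ_diff.log (fun z => (QQ_pos hk hε z).ne')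
  change py (fun z => 1 / 2 * Real.log (QQ k ε z)) = _
  rw [py_const_mul _ d, h1, py_QQ]; funext z; ring
lemma QQ_inv_diff (hk : 0 < k) (hε : 0 < ε) : Differentiable ℝ (fun z => (QQ k ε z)⁻¹) := QQ_diff.inv (fun z => (QQ_pos hk hε z).ne')
lemma pxx_Gam (hk : 0 < k) (hε : 0 < ε) : px (px (Gam k ε)) = fun z => k * (QQ k ε z)⁻¹ - 2 * (k * z 0) ^ 2 * ((QQ k ε z)⁻¹) ^ 2 := by
  have h1 : px (fun z => (QQ k ε z)⁻¹) = fun z => -((QQ k ε z) ^ 2)⁻¹ * px (QQ k ε) z :=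
    px_comp (h := fun x => x⁻¹) (h' := fun x => -(x ^ 2)⁻¹) QQ_diff (fun y => hasDerivAt_inv (QQ_pos hk hε y).ne')
  have d := QQ_inv_diff hk hε
  have d0 := coord_diff 0
  rw [px_Gam hk hε]
  funext z
  rw [px_mul (by fun_prop) d, px_const_mul _ d0, h1, px_QQ, px_c0]
  have := (QQ_pos hk hε z).ne'
  field_simp
  ring
lemma pyy_Gam (hk : 0 < k) (hε : 0 < ε) : py (py (Gam k ε)) = fun z => (QQ k ε z)⁻¹ - 2 * (z 1) ^ 2 * ((QQ k ε z)⁻¹) ^ 2 := by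
  have h1 : py (fun z => (QQ k ε z)⁻¹) = fun z => -((QQ k ε z) ^ 2)⁻¹ * py (QQ k ε) z :=
    py_comp (h := fun x => x⁻¹) (h' := fun x => -(x ^ 2)⁻¹) QQ_diff (fun y => hasDerivAt_inv (QQ_pos hk hε y).ne')
  have d := QQ_inv_diff hk hε
  have d0 := coord_diff 1
  rw [py_Gam hk hε]
  funext z
  rw [py_mul (by fun_prop) d, h1, py_QQ, py_c1]
  have := (QQ_pos hk hε z).ne'
  field_simp
  ring
/-- the regularized delta -/
lemma LL_Gam (hk : 0 < k) (hε : 0 < ε) (z : Euc 2) : px (px (Gam k ε)) z + k * py (py (Gam k ε)) z = 2 * k * ε ^ 2 * ((QQ k ε z)⁻¹) ^ 2 := by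
  rw [pxx_Gam hk hε, pyy_Gam hk hε]
  have := (QQ_pos hk hε z).ne'
  field_simp
  unfold QQ; ring
end kern

lemma px_shift (f : Euc 2 → ℝ) (y : Euc 2) : px (fun z => f (z - y)) = fun z => px f (z - y) := by
  funext z; unfold px; rw [fderiv_comp_sub]
lemma py_shift (f : Euc 2 → ℝ) (y : Euc 2) : py (fun z => f (z - y)) = fun z => py f (z - y) := by
  funext z; unfold py; rw [fderiv_comp_sub]

lemma eta_lim {g : Euc 2 → ℝ} (hg : Integrable g) :
    Tendsto (fun n : ℕ => ∫ y, eta (n + 1) y * g y) atTop (𝓝 (∫ y, g y)) := by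
  apply tendsto_integral_of_dominated_convergence (fun y => |g y|)
  · intro n
    exact ((eta_contDiff _).continuous.aestronglyMeasurable).mul hg.1
  · exact hg.abs
  · intro n
    filter_upwards with y
    rw [norm_mul, Real.norm_eq_abs, Real.norm_eq_abs, abs_of_nonneg (eta_nonneg _ _)]
    nlinarith [eta_le_one (n + 1 : ℝ) y, abs_nonneg (g y)]
  · filter_upwards with y
    apply tendsto_const_nhds.congr'
    obtain ⟨N, hN⟩ := exists_nat_gt ‖y‖
    filter_upwards [eventually_ge_atTop N] with n hn
    have : (N : ℝ) ≤ n := by exact_mod_cast hn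
    rw [eta_one (by positivity) (by linarith), one_mul]

lemma small_integral {g : Euc 2 → ℝ} {A T : ℝ} (hA : 0 ≤ A) (hT : 0 < T) (hg : ∀ y, |g y| ≤ A / T ^ 2) (h0 : ∀ y : Euc 2, 2 * T < ‖y‖ → g y = 0) :
    |∫ y, g y| ≤ A * (4 * (volume : Measure (Euc 2)).real (closedBall 0 1)) := by
  have e : ∫ y, g y = ∫ y in closedBall (0 : Euc 2) (2 * T), g y := by
    rw [setIntegral_eq_integral_of_forall_compl_eq_zero]
    intro y hy
    apply h0
    simpa using hy
  rw [e]
  have := norm_setIntegral_le_of_norm_le_const (μ := (volume : Measure (Euc 2))) (s := closedBall (0 : Euc 2) (2 * T)) (f := g) (C := A / T ^ 2)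
    (isCompact_closedBall _ _).measure_lt_top (fun y _ => hg y)
  rw [vol_ball_scale _ (by linarith)] at this
  refine this.trans (le_of_eq ?_)
  field_simp; ring

lemma bdd_of_small {f : Euc 2 → ℝ} (hf : Continuous f) {r B : ℝ} (h : ∀ y : Euc 2, r ≤ ‖y‖ → |f y| ≤ B) : ∃ A > (0:ℝ), ∀ y, |f y| ≤ A := by
  obtain ⟨A, hA⟩ := (isCompact_closedBall (0 : Euc 2) r).exists_bound_of_continuousOn hf.continuousOn
  refine ⟨max (max A B) 1, by positivity, fun y => ?_⟩
  by_cases hy : ‖y‖ ≤ r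
  · exact (hA y (by simpa using hy)).trans ((le_max_left _ _).trans (le_max_left _ _))
  · exact (h y (by linarith)).trans ((le_max_right _ _).trans (le_max_left _ _))

lemma TW.phi_bdd {c R0 : ℝ} {s φ : Euc 2 → ℝ} (h : TW c R0 s φ) : ∃ A > (0:ℝ), ∀ y, |φ y| ≤ A := by
  obtain ⟨r, hr⟩ := h.small 1 one_pos
  exact bdd_of_small h.hφ.continuous (fun y hy => (hr y hy).2.1)

lemma weak_id {c R0 : ℝ} {s φ : Euc 2 → ℝ} (h : TW c R0 s φ) {ψ : Euc 2 → ℝ} (ψ2 : ContDiff ℝ 2 ψ) (ψc : HasCompactSupport ψ) :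
    ∫ y, φ y * (px (px ψ) y + (1 - c ^ 2 / 2) * py (py ψ) y) = (∫ y, ψ y * fF c s φ y) + c * ∫ y, py ψ y * eF c s φ y := by
  set k := 1 - c ^ 2 / 2 with hk
  have hs1 : ContDiff ℝ 1 s := h.hs.of_le (by norm_num)
  have hφ1 : ContDiff ℝ 1 φ := h.hφ.of_le (by norm_num)
  have ψ1 : ContDiff ℝ 1 ψ := ψ2.of_le (by norm_num)
  have ds := hs1.differentiable (by norm_num)
  have dφ := hφ1.differentiable (by norm_num)
  have dψ := ψ1.differentiable (by norm_num)
  have k3 := px_contDiff h.hφ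
  have k4 := py_contDiff h.hφ
  have k5 := px_contDiff ψ2
  have k6 := py_contDiff ψ2
  have d3 := px_diff h.hφ
  have d4 := py_diff h.hφ
  have d5 := px_diff ψ2
  have d6 := py_diff ψ2
  have e1 : ContDiff ℝ 1 (eF c s φ) := by unfold eF; fun_prop
  have de := e1.differentiable (by norm_num)
  have pe : ∀ y, py (eF c s φ) y = py s y + c / 2 * py (py φ) y := by
    intro y
    change py (fun y => s y + c / 2 * py φ y) y = _
    rw [py_add ds (by fun_prop), py_const_mul _ d4]
  set P : Euc 2 → ℝ := fun y => φ y * px ψ y - px φ y * ψ y with hP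
  set Q : Euc 2 → ℝ := fun y => k * (φ y * py ψ y - py φ y * ψ y) - c * (ψ y * eF c s φ y) with hQ
  have P1 : ContDiff ℝ 1 P := by rw [hP]; fun_prop
  have Q1 : ContDiff ℝ 1 Q := by rw [hQ]; fun_prop
  have Pc : HasCompactSupport P := by
    have a1 : HasCompactSupport (fun y => φ y * px ψ y) := (px_compact ψc).mul_left
    have a2 : HasCompactSupport (fun y => px φ y * ψ y) := ψc.mul_left
    exact a1.sub a2
  have Qc : HasCompactSupport Q := by
    have a1 : HasCompactSupport (fun y => φ y * py ψ y) := (py_compact ψc).mul_left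
    have a2 : HasCompactSupport (fun y => py φ y * ψ y) := ψc.mul_left
    have a3 : HasCompactSupport (fun y => ψ y * eF c s φ y) := ψc.mul_right
    have a4 : HasCompactSupport (fun y => k * (φ y * py ψ y - py φ y * ψ y)) := (a1.sub a2).mul_left
    have a5 : HasCompactSupport (fun y => c * (ψ y * eF c s φ y)) := a3.mul_left
    exact a4.sub a5
  have pP : ∀ y, px P y = φ y * px (px ψ) y - px (px φ) y * ψ y := by
    intro y
    rw [hP, px_sub, px_mul dφ d5, px_mul d3 dψ]
    · ring
    all_goals fun_prop
  have pQ : ∀ y, py Q y = k * (φ y * py (py ψ) y - py (py φ) y * ψ y) - c * (py ψ y * eF c s φ y + ψ y * (py s y + c / 2 * py (py φ) y)) := by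
    intro y
    rw [hQ, py_sub, py_const_mul, py_const_mul, py_sub, py_mul dφ d6, py_mul d4 dψ, py_mul dψ de]
    · beta_reduce; rw [pe]; ring
    all_goals fun_prop
  have IP := integral_px P1 Pc
  have IQ := integral_py Q1 Qc
  have iP : Integrable (px P) := (px_cont P1).integrable_of_hasCompactSupport (px_compact Pc)
  have iQ : Integrable (py Q) := (py_cont Q1).integrable_of_hasCompactSupport (py_compact Qc)
  have j1 : Integrable (fun y => ψ y * fF c s φ y) := by
    have := h.cont_f
    exact (ψ1.continuous.mul this).integrable_of_hasCompactSupport ψc.mul_right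
  have j2 : Integrable (fun y => c * (py ψ y * eF c s φ y)) :=
    ((k6.continuous.mul e1.continuous).integrable_of_hasCompactSupport (py_compact ψc).mul_right).const_mul c
  have j3 : Integrable (fun y => px P y + py Q y) := iP.add iQ
  have j4 : Integrable (fun y => px P y + py Q y + ψ y * fF c s φ y) := j3.add j1
  rw [← integral_const_mul, ← integral_add j1 j2]
  have : ∫ y, φ y * (px (px ψ) y + k * py (py ψ) y) = ∫ y, ((px P y + py Q y) + (ψ y * fF c s φ y + c * (py ψ y * eF c s φ y))) := by
    congr 1; funext y; rw [pP, pQ]; unfold fF; rw [hk]; ring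
  have j5 : Integrable (fun y => ψ y * fF c s φ y + c * (py ψ y * eF c s φ y)) := j1.add j2
  rw [this, integral_add j3 j5, integral_add iP iQ, IP, IQ]; ring

lemma ratio_bound {k : ℝ} (hk : 0 ≤ k) (hk1 : k ≤ 1) {T B Ke ε x a b a1 b1 a2 b2 K p z : ℝ} (hT : 0 < T) (hB : 0 ≤ B) (hKe : 0 ≤ Ke) (hε : 0 ≤ ε) (hp : |p| ≤ ε)
    (ha : |a| ≤ Ke / T) (hb : |b| ≤ Ke / T) (ha1 : |a1| ≤ Ke / T ^ 2) (hb1 : |b1| ≤ Ke / T ^ 2)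
    (ha2 : |a2| ≤ B / T) (hb2 : |b2| ≤ B / T) (hK : |K| ≤ B) :
    |p * (2 * (a * a2 + k * (b * b2)) + K * (a1 + k * b1))| ≤ ε * (6 * Ke * B) / T ^ 2 := by
  have e1 : |a * a2| ≤ Ke * B / T ^ 2 := by
    rw [abs_mul]; calc _ ≤ Ke / T * (B / T) := mul_le_mul ha ha2 (abs_nonneg _) (by positivity)
      _ = _ := by field_simp
  have e2 : |k * (b * b2)| ≤ Ke * B / T ^ 2 := by
    rw [abs_mul, abs_mul, abs_of_nonneg hk]
    calc _ ≤ 1 * (Ke / T * (B / T)) := mul_le_mul hk1 (mul_le_mul hb hb2 (abs_nonneg _) (by positivity)) (by positivity) (by positivity)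
      _ = _ := by field_simp
  have e3 : |K * a1| ≤ Ke * B / T ^ 2 := by
    rw [abs_mul]; calc _ ≤ B * (Ke / T ^ 2) := mul_le_mul hK ha1 (abs_nonneg _) hB
      _ = _ := by ring
  have e4 : |K * (k * b1)| ≤ Ke * B / T ^ 2 := by
    rw [abs_mul, abs_mul, abs_of_nonneg hk]; calc _ ≤ B * (1 * (Ke / T ^ 2)) := mul_le_mul hK (mul_le_mul hk1 hb1 (abs_nonneg _) (by positivity)) (by positivity) hB
      _ = _ := by ring
  have e5 : |2 * (a * a2 + k * (b * b2)) + K * (a1 + k * b1)| ≤ 6 * (Ke * B / T ^ 2) := by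
    rw [abs_le] at *
    constructor <;> nlinarith
  rw [abs_mul]
  calc _ ≤ ε * (6 * (Ke * B / T ^ 2)) := mul_le_mul hp e5 (abs_nonneg _) hε
    _ = _ := by ring

set_option maxHeartbeats 800000 in
lemma repr_id {c R0 : ℝ} {s φ : Euc 2 → ℝ} (h : TW c R0 s φ) {K : Euc 2 → ℝ} (K2 : ContDiff ℝ 2 K) {B : ℝ} (hB : 0 < B)
    (b0 : ∀ z, |K z| ≤ B) (bx : ∀ z, (1 + ‖z‖) * |px K z| ≤ B) (bY : ∀ z, (1 + ‖z‖) * |py K z| ≤ B)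
    (hL : Integrable (fun z => px (px K) z + (1 - c ^ 2 / 2) * py (py K) z))
    (he : Integrable (eF c s φ)) (hf : Integrable (fF c s φ)) :
    ∫ y, φ y * (px (px K) y + (1 - c ^ 2 / 2) * py (py K) y) = (∫ y, K y * fF c s φ y) + c * ∫ y, py K y * eF c s φ y := by
  have hc := h.c_pos
  have hc2 := h.c_lt
  obtain ⟨A, hA, φb⟩ := h.phi_bdd
  obtain ⟨Ke, hKe, eb⟩ := eta_bounds
  have φc := h.hφ.continuous
  have K1 : ContDiff ℝ 1 K := K2.of_le (by norm_num)
  have dK := K1.differentiable (by norm_num)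
  have kx := px_contDiff K2
  have ky := py_contDiff K2
  have dx := px_diff K2
  have dy := py_diff K2
  set k := 1 - c ^ 2 / 2 with hk
  have hk0 : 0 ≤ k := by rw [hk]; linarith
  have hk1 : k ≤ 1 := by rw [hk]; nlinarith
  have bY' : ∀ z, |py K z| ≤ B := fun z => by nlinarith [bY z, abs_nonneg (py K z), norm_nonneg z, mul_nonneg (norm_nonneg z) (abs_nonneg (py K z))]
  have i1 : Integrable (fun y => φ y * (px (px K) y + k * py (py K) y)) :=
    hL.bdd_mul φc.aestronglyMeasurable (c := A) (by filter_upwards with y; exact φb y)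
  have i2 : Integrable (fun y => K y * fF c s φ y) :=
    hf.bdd_mul K1.continuous.aestronglyMeasurable (c := B) (by filter_upwards with y; exact b0 y)
  have i3 : Integrable (fun y => py K y * eF c s φ y) :=
    he.bdd_mul ky.continuous.aestronglyMeasurable (c := B) (by filter_upwards with y; exact bY' y)
  set E : ℕ → Euc 2 → ℝ := fun n y => φ y * (2 * (px (eta (n+1)) y * px K y + k * (py (eta (n+1)) y * py K y)) + K y * (px (px (eta (n+1))) y + k * py (py (eta (n+1))) y)) with hE
  set G : ℕ → Euc 2 → ℝ := fun n y => py (eta (n+1)) y * K y * eF c s φ y with hG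
  have ec : ∀ n : ℕ, ContDiff ℝ 2 (eta (n+1 : ℝ)) := fun n => contDiff_infty.1 (eta_contDiff _) 2
  have G0 : Tendsto (fun n => ∫ y, G n y) atTop (𝓝 0) := by
    have I0 : 0 ≤ ∫ y, |eF c s φ y| := integral_nonneg (fun y => abs_nonneg _)
    have bd : ∀ n : ℕ, ‖∫ y, G n y‖ ≤ (Ke * B * ∫ y, |eF c s φ y|) / ((n:ℝ)+1) := by
      intro n
      have : (Ke * B * ∫ y, |eF c s φ y|) / ((n:ℝ)+1) = ∫ y, Ke * B / ((n:ℝ)+1) * |eF c s φ y| := by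
        rw [integral_const_mul]; ring
      rw [this]
      apply norm_integral_le_of_norm_le (he.abs.const_mul _)
      filter_upwards with y
      rw [hG, Real.norm_eq_abs, abs_mul, abs_mul]
      apply mul_le_mul_of_nonneg_right _ (abs_nonneg _)
      calc _ ≤ Ke / ((n:ℝ)+1) * B := mul_le_mul (eb _ (by positivity) y).2.1 (b0 y) (abs_nonneg _) (by positivity)
        _ = _ := by ring
    apply squeeze_zero_norm bd
    exact tendsto_const_div_atTop_nhds_zero_nat (Ke * B * ∫ y, |eF c s φ y|) |>.comp (tendsto_add_atTop_nat 1) |>.congr (fun n => by simp)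
  have E0 : Tendsto (fun n => ∫ y, E n y) atTop (𝓝 0) := by
    rw [Metric.tendsto_atTop]
    intro ε hε
    set V := (volume : Measure (Euc 2)).real (closedBall 0 1) with hV
    have V0 : 0 ≤ V := measureReal_nonneg
    set M := 6 * Ke * B * (4 * V) + 1 with hM
    have M0 : 0 < M := by positivity
    obtain ⟨r, hr⟩ := h.small (ε / (2 * M)) (by positivity)
    obtain ⟨N, hN⟩ := exists_nat_gt r
    refine ⟨N, fun n hn => ?_⟩
    have hn' : (N : ℝ) ≤ n := by exact_mod_cast hn
    rw [dist_zero_right, Real.norm_eq_abs]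
    have T0 : 0 < (n:ℝ)+1 := by positivity
    have := small_integral (g := E n) (A := ε / (2 * M) * (6 * Ke * B)) (T := n+1) (by positivity) (by positivity) ?_ ?_
    · have e : ε / (2 * M) * (6 * Ke * B) * (4 * V) = ε / 2 * ((M - 1) / M) := by rw [hM]; field_simp; ring
      rw [e] at this
      have : (M - 1) / M ≤ 1 := by rw [div_le_one M0]; linarith
      nlinarith
    · intro y
      by_cases hy : ‖y‖ < n + 1
      · have z1 : px (px (eta (n+1 : ℝ))) y = 0 := by
          apply px_zero_of_eventually
          have : ∀ᶠ z : Euc 2 in 𝓝 y, ‖z‖ < n + 1 := (isOpen_lt continuous_norm continuous_const).mem_nhds hy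
          filter_upwards [this] with z hz
          exact px_eta_zero T0 (Or.inl hz)
        have z2 : py (py (eta (n+1 : ℝ))) y = 0 := by
          apply py_zero_of_eventually
          have : ∀ᶠ z : Euc 2 in 𝓝 y, ‖z‖ < n + 1 := (isOpen_lt continuous_norm continuous_const).mem_nhds hy
          filter_upwards [this] with z hz
          exact py_eta_zero T0 (Or.inl hz)
        have : E n y = 0 := by
          simp only [hE]; rw [px_eta_zero T0 (Or.inl hy), py_eta_zero T0 (Or.inl hy), z1, z2]; ring
        rw [this, abs_zero]; positivity
      · push Not at hy
        obtain ⟨q1, q2, q3, q4⟩ := eb _ T0 y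
        have l1 : |px K y| ≤ B / (n+1) := by
          rw [le_div_iff₀ T0]; nlinarith [bx y, abs_nonneg (px K y)]
        have l2 : |py K y| ≤ B / (n+1) := by
          rw [le_div_iff₀ T0]; nlinarith [bY y, abs_nonneg (py K y)]
        exact ratio_bound hk0 hk1 (x := 0) (z := 0) T0 hB.le (by linarith) (by positivity) (hr y (by linarith)).2.1 q1 q2 q3 q4 l1 l2 (b0 y)
    · intro y hy
      have z1 : px (px (eta (n+1 : ℝ))) y = 0 := by
        apply px_zero_of_eventually
        have : ∀ᶠ z : Euc 2 in 𝓝 y, 2 * ((n:ℝ)+1) < ‖z‖ := (isOpen_lt continuous_const continuous_norm).mem_nhds hy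
        filter_upwards [this] with z hz
        exact px_eta_zero T0 (Or.inr hz)
      have z2 : py (py (eta (n+1 : ℝ))) y = 0 := by
        apply py_zero_of_eventually
        have : ∀ᶠ z : Euc 2 in 𝓝 y, 2 * ((n:ℝ)+1) < ‖z‖ := (isOpen_lt continuous_const continuous_norm).mem_nhds hy
        filter_upwards [this] with z hz
        exact py_eta_zero T0 (Or.inr hz)
      simp only [hE]; rw [px_eta_zero T0 (Or.inr hy), py_eta_zero T0 (Or.inr hy), z1, z2]; ring
  have key : ∀ n : ℕ, (∫ y, eta (n+1) y * (φ y * (px (px K) y + k * py (py K) y))) + ∫ y, E n y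
      = (∫ y, eta (n+1) y * (K y * fF c s φ y)) + c * ((∫ y, eta (n+1) y * (py K y * eF c s φ y)) + ∫ y, G n y) := by
    intro n
    have T0 : 0 < (n:ℝ)+1 := by positivity
    have η2 := ec n
    have ηc : HasCompactSupport (eta (n+1 : ℝ)) := eta_compact T0
    set η := eta (n+1 : ℝ) with hη
    have dη : Differentiable ℝ η := η2.differentiable (by norm_num)
    have d1 := px_diff η2
    have d2 := py_diff η2
    have W := weak_id h (ψ := fun y => η y * K y) (η2.mul K2) ηc.mul_right
    have p1 : px (fun y => η y * K y) = fun y => px η y * K y + η y * px K y := by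
      funext y; rw [px_mul dη dK]
    have p2 : py (fun y => η y * K y) = fun y => py η y * K y + η y * py K y := by
      funext y; rw [py_mul dη dK]
    have p3 : ∀ y, px (px (fun y => η y * K y)) y = px (px η) y * K y + 2 * (px η y * px K y) + η y * px (px K) y := by
      intro y; rw [p1, px_add (by fun_prop) (by fun_prop), px_mul d1 dK, px_mul dη dx]; ring
    have p4 : ∀ y, py (py (fun y => η y * K y)) y = py (py η) y * K y + 2 * (py η y * py K y) + η y * py (py K) y := by
      intro y; rw [p2, py_add (by fun_prop) (by fun_prop), py_mul d2 dK, py_mul dη dy]; ring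
    have c1 := px_cont (px_contDiff η2)
    have c2 := py_cont (py_contDiff η2)
    have cx := (px_contDiff η2).continuous
    have cy := (py_contDiff η2).continuous
    have e1 := h.cont_e
    have ckx := kx.continuous
    have cky := ky.continuous
    have cK := K1.continuous
    have cη := dη.continuous
    have iE : Integrable (E n) := by
      apply Continuous.integrable_of_hasCompactSupport
      · simp only [hE]; rw [← hη]; fun_prop
      · apply HasCompactSupport.mul_left (f := φ)
        apply HasCompactSupport.add
        · apply HasCompactSupport.mul_left (f := fun _ => (2:ℝ))
          apply HasCompactSupport.add
          · exact (px_compact ηc).mul_right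
          · exact HasCompactSupport.mul_left (f := fun _ => k) (HasCompactSupport.mul_right (py_compact ηc))
        · apply HasCompactSupport.mul_left (f := K)
          exact (px_compact (px_compact ηc)).add (HasCompactSupport.mul_left (f := fun _ => k) (py_compact (py_compact ηc)))
    have iG : Integrable (G n) := by
      apply Continuous.integrable_of_hasCompactSupport
      · simp only [hG]; rw [← hη]; fun_prop
      · exact HasCompactSupport.mul_right (HasCompactSupport.mul_right (py_compact ηc))
    have i1' : Integrable (fun y => η y * (φ y * (px (px K) y + k * py (py K) y))) :=
      i1.bdd_mul cη.aestronglyMeasurable (c := 1) (by filter_upwards with y; rw [Real.norm_eq_abs, abs_of_nonneg (eta_nonneg _ _)]; exact eta_le_one _ _)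
    have i3' : Integrable (fun y => η y * (py K y * eF c s φ y)) :=
      i3.bdd_mul cη.aestronglyMeasurable (c := 1) (by filter_upwards with y; rw [Real.norm_eq_abs, abs_of_nonneg (eta_nonneg _ _)]; exact eta_le_one _ _)
    rw [← integral_add i1' iE, ← integral_add i3' iG]
    convert W using 2
    · funext y; rw [p3, p4]; simp only [hE]; rw [← hη, ← hk]; ring
    · congr 1; funext y; ring
    · congr 1; congr 1; funext y; rw [p2]; simp only [hG]; rw [← hη]; ring
  have L1 := (eta_lim i1).add E0
  have L2 := (eta_lim i2).add (((eta_lim i3).add G0).const_mul c)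
  have := tendsto_nhds_unique (L1.congr key) L2
  simpa using this

lemma abs_c0_le (w : Euc 2) : |w 0| ≤ ‖w‖ := by
  apply abs_le_of_sq_le_sq _ (norm_nonneg _)
  nlinarith [norm_sq_eq w, sq_nonneg (w 1)]
lemma abs_c1_le (w : Euc 2) : |w 1| ≤ ‖w‖ := by
  apply abs_le_of_sq_le_sq _ (norm_nonneg _)
  nlinarith [norm_sq_eq w, sq_nonneg (w 0)]

section kern2
variable {k ε : ℝ}
lemma QQ_lower (hk1 : k ≤ 1) (w : Euc 2) : k * ‖w‖ ^ 2 + ε ^ 2 ≤ QQ k ε w := by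
  rw [norm_sq_eq]; unfold QQ; nlinarith [sq_nonneg (w 1)]
lemma QQ_upper (hk1 : k ≤ 1) (w : Euc 2) : QQ k ε w ≤ ‖w‖ ^ 2 + ε ^ 2 := by
  rw [norm_sq_eq]; unfold QQ; nlinarith [sq_nonneg (w 0)]
lemma QQ_lower' (hk : 0 < k) (hk1 : k ≤ 1) (hε : 0 < ε) (hε1 : ε ≤ 1) (w : Euc 2) : k * ε ^ 2 * (1 + ‖w‖ ^ 2) ≤ QQ k ε w := by
  refine le_trans ?_ (QQ_lower hk1 w)
  have : ε ^ 2 ≤ 1 := by nlinarith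
  have := mul_nonneg hk.le (sq_nonneg ‖w‖)
  nlinarith [pow_pos hε 2]

lemma grad_pre (hk : 0 < k) (hk1 : k ≤ 1) (hε : 0 < ε) (hε1 : ε ≤ 1) (w : Euc 2) {a : ℝ} (ha : |a| ≤ ‖w‖) :
    (1 + ‖w‖) * |a * (QQ k ε w)⁻¹| ≤ 2 / (k * ε ^ 2) := by
  have Q0 := QQ_pos hk hε w
  have := QQ_lower' hk hk1 hε hε1 w
  have p : 0 < k * ε ^ 2 := by positivity
  rw [abs_mul, abs_inv, abs_of_pos Q0, le_div_iff₀ p]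
  have e : (1 + ‖w‖) * (|a| * (QQ k ε w)⁻¹) * (k * ε ^ 2) = ((1 + ‖w‖) * |a| * (k * ε ^ 2)) / QQ k ε w := by field_simp
  rw [e, div_le_iff₀ Q0]
  have n := norm_nonneg w
  have : (1 + ‖w‖) * |a| ≤ 2 * (1 + ‖w‖ ^ 2) := by nlinarith
  nlinarith
lemma px_Gam_bound (hk : 0 < k) (hk1 : k ≤ 1) (hε : 0 < ε) (hε1 : ε ≤ 1) (w : Euc 2) :
    (1 + ‖w‖) * |px (Gam k ε) w| ≤ 2 / (k * ε ^ 2) := by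
  rw [px_Gam hk hε]
  apply grad_pre hk hk1 hε hε1
  rw [abs_mul, abs_of_pos hk]
  nlinarith [abs_c0_le w, abs_nonneg (w 0)]
lemma py_Gam_bound (hk : 0 < k) (hk1 : k ≤ 1) (hε : 0 < ε) (hε1 : ε ≤ 1) (w : Euc 2) :
    (1 + ‖w‖) * |py (Gam k ε) w| ≤ 2 / (k * ε ^ 2) := by
  rw [py_Gam hk hε]
  exact grad_pre hk hk1 hε hε1 _ (abs_c1_le w)

/-- the mollifier -/
def PP (k ε : ℝ) (w : Euc 2) : ℝ := 2 * k * ε ^ 2 * ((QQ k ε w)⁻¹) ^ 2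

lemma PP_nonneg (hk : 0 < k) (w : Euc 2) : 0 ≤ PP k ε w := by unfold PP; positivity
lemma PP_cont (hk : 0 < k) (hε : 0 < ε) : Continuous (PP k ε) := by
  have : Continuous (fun w => (QQ k ε w)⁻¹) := QQ_cont.inv₀ (fun w => (QQ_pos hk hε w).ne')
  unfold PP; fun_prop
lemma PP_le (hk : 0 < k) (hk1 : k ≤ 1) (hε : 0 < ε) (hε1 : ε ≤ 1) (w : Euc 2) :
    PP k ε w ≤ 8 / (k * ε ^ 2) * (1 + ‖w‖) ^ (-4 : ℝ) := by
  have Q0 := QQ_pos hk hε w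
  have l := QQ_lower' hk hk1 hε hε1 w
  have n := norm_nonneg w
  have l2 : k * ε ^ 2 / 2 * (1 + ‖w‖) ^ 2 ≤ QQ k ε w := by
    have : (1 + ‖w‖) ^ 2 ≤ 2 * (1 + ‖w‖ ^ 2) := by nlinarith [sq_nonneg (1 - ‖w‖)]
    have p : 0 < k * ε ^ 2 := by positivity
    nlinarith
  have i : (QQ k ε w)⁻¹ ≤ (k * ε ^ 2 / 2 * (1 + ‖w‖) ^ 2)⁻¹ := inv_anti₀ (by positivity) l2
  have i2 : ((QQ k ε w)⁻¹) ^ 2 ≤ ((k * ε ^ 2 / 2 * (1 + ‖w‖) ^ 2)⁻¹) ^ 2 := pow_le_pow_left₀ (by positivity) i 2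
  have e : (1 + ‖w‖) ^ (-4 : ℝ) = ((1 + ‖w‖) ^ 4)⁻¹ := by
    rw [Real.rpow_neg (by positivity)]; congr 1; exact_mod_cast Real.rpow_natCast (1 + ‖w‖) 4
  rw [e]; unfold PP
  calc _ ≤ 2 * k * ε ^ 2 * ((k * ε ^ 2 / 2 * (1 + ‖w‖) ^ 2)⁻¹) ^ 2 := mul_le_mul_of_nonneg_left i2 (by positivity)
    _ = _ := by field_simp; norm_num
lemma PP_int (hk : 0 < k) (hk1 : k ≤ 1) (hε : 0 < ε) (hε1 : ε ≤ 1) : Integrable (PP k ε) := by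
  have : Integrable (fun w : Euc 2 => 8 / (k * ε ^ 2) * (1 + ‖w‖) ^ (-4 : ℝ)) :=
    (integrable_one_add_norm (by simp; norm_num)).const_mul _
  refine this.mono' (PP_cont hk hε).aestronglyMeasurable ?_
  filter_upwards with w
  rw [Real.norm_eq_abs, abs_of_nonneg (PP_nonneg hk w)]; exact PP_le hk hk1 hε hε1 w
lemma PP_int' (hk : 0 < k) (hk1 : k ≤ 1) (hε : 0 < ε) (hε1 : ε ≤ 1) : Integrable (fun w => ‖w‖ * PP k ε w) := by
  have : Integrable (fun w : Euc 2 => 8 / (k * ε ^ 2) * (1 + ‖w‖) ^ (-3 : ℝ)) :=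
    (integrable_one_add_norm (by simp; norm_num)).const_mul _
  refine this.mono' (continuous_norm.mul (PP_cont hk hε)).aestronglyMeasurable ?_
  filter_upwards with w
  have n := norm_nonneg w
  have e : (1 + ‖w‖) ^ (-3 : ℝ) = (1 + ‖w‖) ^ (1 : ℝ) * (1 + ‖w‖) ^ (-4 : ℝ) := by
    rw [← Real.rpow_add (by positivity)]; norm_num
  rw [Real.norm_eq_abs, abs_of_nonneg (mul_nonneg n (PP_nonneg hk w)), e, Real.rpow_one]
  calc _ ≤ (1 + ‖w‖) * (8 / (k * ε ^ 2) * (1 + ‖w‖) ^ (-4 : ℝ)) := mul_le_mul (by linarith) (PP_le hk hk1 hε hε1 w) (PP_nonneg hk w) (by positivity)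
    _ = _ := by ring
lemma QQ_scale (w : Euc 2) : QQ k ε (ε • w) = ε ^ 2 * QQ k 1 w := by
  unfold QQ; simp; ring
lemma PP_scale (hε : 0 < ε) (w : Euc 2) : ε ^ 2 * PP k ε (ε • w) = PP k 1 w := by
  unfold PP; rw [QQ_scale]; field_simp
lemma PP_mass_pos (hk : 0 < k) (hk1 : k ≤ 1) : 0 < ∫ w, PP k 1 w := by
  rw [integral_pos_iff_support_of_nonneg (fun w => PP_nonneg hk w) (PP_int hk hk1 one_pos le_rfl)]
  have : Function.support (PP k 1) = Set.univ := by
    ext w; simp only [Function.mem_support, Set.mem_univ, iff_true]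
    have := QQ_pos hk one_pos w
    unfold PP; positivity
  rw [this]; simp

lemma moll_change (hε : 0 < ε) (φ : Euc 2 → ℝ) (y : Euc 2) :
    ∫ z, φ z * PP k ε (z - y) = ∫ w, φ (y + ε • w) * PP k 1 w := by
  have e1 : ∫ z, φ z * PP k ε (z - y) = ∫ w, φ (y + w) * PP k ε w := by
    have := integral_add_left_eq_self (μ := (volume : Measure (Euc 2))) (fun z => φ z * PP k ε (z - y)) y
    rw [← this]; congr 1; funext w; rw [add_sub_cancel_left]
  have e2 := Measure.integral_comp_smul (μ := (volume : Measure (Euc 2))) (fun w => φ (y + w) * PP k ε w) ε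
  have e3 : |(ε ^ Module.finrank ℝ (Euc 2))⁻¹| = (ε ^ 2)⁻¹ := by
    rw [abs_of_pos (by positivity)]; simp
  rw [e3, smul_eq_mul] at e2
  have : ∫ w, φ (y + ε • w) * PP k 1 w = ε ^ 2 * ∫ w, φ (y + ε • w) * PP k ε (ε • w) := by
    rw [← integral_const_mul]; congr 1; funext w; rw [← PP_scale hε]; ring
  rw [e1, this, e2]; field_simp

lemma moll_approx (hk : 0 < k) (hk1 : k ≤ 1) (hε : 0 < ε) {φ : Euc 2 → ℝ} (hφ : Continuous φ) {L : ℝ} (hL : ∀ a b, |φ a - φ b| ≤ L * ‖a - b‖) {A : ℝ} (hA : ∀ a, |φ a| ≤ A) (y : Euc 2) :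
    |(∫ z, φ z * PP k ε (z - y)) - φ y * ∫ w, PP k 1 w| ≤ ε * (L * ∫ w, ‖w‖ * PP k 1 w) := by
  have P1 := PP_int hk hk1 one_pos le_rfl
  rw [moll_change hε]
  have i1 : Integrable (fun w => φ (y + ε • w) * PP k 1 w) :=
    P1.bdd_mul (by apply Continuous.aestronglyMeasurable; fun_prop) (c := A) (by filter_upwards with w; exact hA _)
  have i2 : Integrable (fun w => φ y * PP k 1 w) := P1.const_mul _
  rw [← integral_const_mul, ← integral_sub i1 i2, ← integral_const_mul, ← integral_const_mul]
  rw [← Real.norm_eq_abs]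
  apply norm_integral_le_of_norm_le
  · exact ((PP_int' hk hk1 one_pos le_rfl).const_mul _).const_mul _
  · filter_upwards with w
    rw [← sub_mul, Real.norm_eq_abs, abs_mul, abs_of_nonneg (PP_nonneg hk w)]
    have := hL (y + ε • w) y
    rw [add_sub_cancel_left, norm_smul, Real.norm_eq_abs, abs_of_pos hε] at this
    nlinarith [PP_nonneg (ε := 1) hk w]
end kern2

section kern3
variable {k : ℝ}

lemma log_diff_le {a b : ℝ} (ha : 0 < a) (hb : 0 < b) : Real.log a - Real.log b ≤ (a - b) / b := by
  rw [← Real.log_div ha.ne' hb.ne']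
  have := Real.log_le_sub_one_of_pos (div_pos ha hb)
  rw [sub_div, div_self hb.ne']; linarith

lemma log_diff_sqrt {a b t : ℝ} (ha : 0 < a) (hb : 0 < b) (ht : 0 ≤ t) (h : a ≤ t ^ 2 * b) : Real.log a - Real.log b ≤ 2 * t := by
  rw [← Real.log_div ha.ne' hb.ne']
  have h1 : a / b ≤ t ^ 2 := by rw [div_le_iff₀ hb]; exact h
  have t0 : 0 < t := by
    rcases ht.lt_or_eq with h' | h'
    · exact h'
    · rw [← h'] at h1; have := div_pos ha hb; norm_num at h1; linarith
  calc Real.log (a / b) ≤ Real.log (t ^ 2) := Real.log_le_log (div_pos ha hb) h1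
    _ = 2 * Real.log t := by rw [Real.log_pow]; norm_num
    _ ≤ _ := by have := Real.log_le_sub_one_of_pos t0; linarith

lemma one_le_rpow_one {x δ : ℝ} (hx : 1 ≤ x) (hδ : 0 < δ) : x ≤ x ^ (1 + δ) := by
  calc x = x ^ (1:ℝ) := (Real.rpow_one x).symm
    _ ≤ _ := Real.rpow_le_rpow_of_exponent_le hx (by linarith)

lemma four_rpow {R x δ : ℝ} (hR : 0 < R) (hδ : 0 < δ) (hδ1 : δ ≤ 1) (h : R ≤ 2 * x) : R * R ^ δ ≤ 4 * x ^ (1 + δ) := by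
  have x0 : 0 < x := by linarith
  calc R * R ^ δ = R ^ (1 + δ) := by rw [Real.rpow_add hR, Real.rpow_one]
    _ ≤ (2 * x) ^ (1 + δ) := Real.rpow_le_rpow hR.le h (by linarith)
    _ = 2 ^ (1 + δ) * x ^ (1 + δ) := Real.mul_rpow (by norm_num) x0.le
    _ ≤ 4 * x ^ (1 + δ) := by
      apply mul_le_mul_of_nonneg_right _ (by positivity)
      calc (2:ℝ) ^ (1 + δ) ≤ 2 ^ (2:ℝ) := Real.rpow_le_rpow_of_exponent_le (by norm_num) (by linarith)
        _ = 4 := by norm_num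

lemma log_R_bound {R δ : ℝ} (hR : 1 ≤ R) (hδ : 0 < δ) : Real.log (2 * R ^ 4) ≤ (1 + 4 / δ) * R ^ δ := by
  have R0 : 0 < R := by linarith
  rw [Real.log_mul (by norm_num) (by positivity), Real.log_pow]
  have h1 := Real.log_le_rpow_div R0.le hδ
  have h2 : Real.log 2 ≤ 1 := by have := Real.log_le_sub_one_of_pos (show (0:ℝ) < 2 by norm_num); linarith
  have h3 : 1 ≤ R ^ δ := Real.one_le_rpow hR hδ.le
  push_cast
  calc Real.log 2 + 4 * Real.log R ≤ R ^ δ + 4 * (R ^ δ / δ) := by linarith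
    _ = _ := by ring

set_option maxHeartbeats 1000000 in
lemma Gam_diff (hk : 0 < k) (hk1 : k ≤ 1) {δ : ℝ} (hδ : 0 < δ) (hδ1 : δ ≤ 1) :
    ∃ C > (0:ℝ), ∀ y z : Euc 2, 1 ≤ ‖y‖ → |Gam k (1 / ‖y‖) (z - y) - Gam k 1 y| ≤ C / ‖y‖ * (1 + ‖z‖) ^ (1 + δ) := by
  refine ⟨20 / k + 8 * (1 + 4 / δ), by positivity, fun y z hR => ?_⟩
  set R := ‖y‖ with hRd
  have R0 : 0 < R := by linarith
  have hε : 0 < 1 / R := by positivity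
  have hε1 : (1 / R) ^ 2 ≤ 1 := by
    have : 1 / R ≤ 1 := by rw [div_le_one R0]; exact hR
    nlinarith
  set a := QQ k (1 / R) (z - y) with had
  set b := QQ k 1 y with hbd
  have a0 : 0 < a := QQ_pos hk hε _
  have b0 : 0 < b := QQ_pos hk one_pos _
  set Z := 1 + ‖z‖ with hZ
  have hz := norm_nonneg z
  have Z1 : 1 ≤ Z := by linarith
  have ZZ := one_le_rpow_one Z1 hδ
  have bl : k * R ^ 2 ≤ b := by have := QQ_lower (ε := 1) hk1 y; rw [← hbd, ← hRd] at this; linarith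
  have bu : b ≤ 2 * R ^ 2 := by have := QQ_upper (ε := 1) hk1 y; rw [← hbd, ← hRd] at this; nlinarith
  have au : a ≤ ‖z - y‖ ^ 2 + 1 := by have := QQ_upper (ε := 1 / R) hk1 (z - y); rw [← had] at this; linarith
  have al : k * ‖z - y‖ ^ 2 ≤ a := by have := QQ_lower (ε := 1 / R) hk1 (z - y); rw [← had] at this; nlinarith
  have al2 : (1 / R) ^ 2 ≤ a := by have := QQ_lower (ε := 1 / R) hk1 (z - y); rw [← had] at this; linarith [mul_nonneg hk.le (sq_nonneg ‖z - y‖)]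
  have tri : ‖z - y‖ ≤ ‖z‖ + R := norm_sub_le z y
  have tri2 : R ≤ ‖z‖ + ‖z - y‖ := by
    have := norm_sub_le z (z - y); rw [sub_sub_cancel] at this; exact this
  -- the exact difference
  have ex : a - b = k * (z 0 * z 0 - 2 * (z 0 * y 0)) + (z 1 * z 1 - 2 * (z 1 * y 1)) + ((1 / R) ^ 2 - 1) := by
    rw [had, hbd]; unfold QQ; simp only [PiLp.sub_apply]; ring
  have p0 : |z 0 * y 0| ≤ ‖z‖ * R := by rw [abs_mul]; exact mul_le_mul (abs_c0_le z) (abs_c0_le y) (abs_nonneg _) hz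
  have p1 : |z 1 * y 1| ≤ ‖z‖ * R := by rw [abs_mul]; exact mul_le_mul (abs_c1_le z) (abs_c1_le y) (abs_nonneg _) hz
  have p0' : |k * (z 0 * y 0)| ≤ ‖z‖ * R := by rw [abs_mul, abs_of_pos hk]; nlinarith [abs_nonneg (z 0 * y 0)]
  have nz := norm_sq_eq z
  rw [abs_le] at p0' p1
  have up : a - b ≤ ‖z‖ ^ 2 + 4 * (‖z‖ * R) := by rw [ex]; nlinarith [mul_self_nonneg (z 0)]
  have dn : b - a ≤ 4 * (‖z‖ * R) + 1 := by
    have : b - a = -(a - b) := by ring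
    rw [this, ex]; linarith [mul_nonneg hk.le (mul_self_nonneg (z 0)), mul_self_nonneg (z 1), sq_nonneg (1/R)]
  have d0 : 0 < 4 / δ := by positivity
  have mono : (40 / k) / R * Z ≤ 2 * ((20 / k + 8 * (1 + 4 / δ)) / R * Z ^ (1 + δ)) := by
    calc _ ≤ (40 / k + 16 * (1 + 4 / δ)) / R * Z ^ (1 + δ) := by
          apply mul_le_mul _ ZZ (by positivity) (by positivity)
          exact div_le_div_of_nonneg_right (le_add_of_nonneg_right (by positivity)) R0.le
      _ = _ := by ring
  have goal1 : Real.log a - Real.log b ≤ (40 / k) / R * Z := by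
    by_cases hc : ‖z‖ ≤ R / 2
    · refine (log_diff_le a0 b0).trans ?_
      rw [div_le_iff₀ b0]
      have : 5 * (‖z‖ * R) ≤ (40 / k) / R * Z * (k * R ^ 2) := by
        have : (40 / k) / R * Z * (k * R ^ 2) = 40 * (Z * R) := by field_simp
        rw [this, hZ]; nlinarith [mul_nonneg hz R0.le]
      have : (40 / k) / R * Z * (k * R ^ 2) ≤ (40 / k) / R * Z * b := by gcongr
      have : ‖z‖ ^ 2 ≤ ‖z‖ * R := by rw [sq]; exact mul_le_mul_of_nonneg_left (by linarith) hz
      linarith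
    · push Not at hc
      have := log_diff_sqrt (t := 4 * Z / (k * R)) a0 b0 (by positivity) ?_
      · refine this.trans ?_
        rw [show 2 * (4 * Z / (k * R)) = (8 / k) / R * Z by field_simp; norm_num]
        gcongr; norm_num
      · have h1 : a ≤ 16 * Z ^ 2 := by nlinarith [norm_nonneg (z - y)]
        have h2 : (4 * Z / (k * R)) ^ 2 * (k * R ^ 2) = 16 * Z ^ 2 / k := by field_simp; norm_num
        have h3 : 16 * Z ^ 2 ≤ 16 * Z ^ 2 / k := by rw [le_div_iff₀ hk]; nlinarith [sq_nonneg Z]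
        have : (4 * Z / (k * R)) ^ 2 * (k * R ^ 2) ≤ (4 * Z / (k * R)) ^ 2 * b := by gcongr
        linarith
  have goal2 : Real.log b - Real.log a ≤ 2 * ((20 / k + 8 * (1 + 4 / δ)) / R * Z ^ (1 + δ)) := by
    by_cases hc : ‖z‖ ≤ R / 2
    · have : Real.log b - Real.log a ≤ (40 / k) / R * Z := by
        refine (log_diff_le b0 a0).trans ?_
        rw [div_le_iff₀ a0]
        have hw : R / 2 ≤ ‖z - y‖ := by linarith
        have a4 : k * R ^ 2 / 4 ≤ a := by
          have : (R / 2) ^ 2 ≤ ‖z - y‖ ^ 2 := pow_le_pow_left₀ (by positivity) hw 2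
          nlinarith
        have : (40 / k) / R * Z * (k * R ^ 2 / 4) = 10 * (Z * R) := by field_simp; norm_num
        have : (40 / k) / R * Z * (k * R ^ 2 / 4) ≤ (40 / k) / R * Z * a := by gcongr
        have : Z * R = R + ‖z‖ * R := by rw [hZ]; ring
        have := mul_nonneg hz R0.le
        linarith
      calc _ ≤ (40 / k) / R * Z := this
        _ ≤ _ := mono
    · push Not at hc
      have h1 : Real.log b - Real.log a ≤ Real.log (2 * R ^ 4) := by
        rw [← Real.log_div b0.ne' a0.ne']
        apply Real.log_le_log (div_pos b0 a0)
        rw [div_le_iff₀ a0]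
        calc b ≤ 2 * R ^ 2 := bu
          _ = 2 * R ^ 4 * (1 / R) ^ 2 := by field_simp
          _ ≤ _ := by gcongr
      have h2 := log_R_bound hR hδ
      have h3 := four_rpow (x := Z) R0 hδ hδ1 (by linarith)
      have h4 : R ^ δ ≤ 4 / R * Z ^ (1 + δ) := by
        rw [div_mul_eq_mul_div, le_div_iff₀ R0]; linarith
      calc _ ≤ (1 + 4 / δ) * (4 / R * Z ^ (1 + δ)) := (h1.trans h2).trans (mul_le_mul_of_nonneg_left h4 (by positivity))
        _ = (4 * (1 + 4 / δ)) / R * Z ^ (1 + δ) := by ring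
        _ ≤ (40 / k + 16 * (1 + 4 / δ)) / R * Z ^ (1 + δ) := by
          apply mul_le_mul_of_nonneg_right _ (by positivity)
          apply div_le_div_of_nonneg_right _ R0.le
          have : 0 < 40 / k := by positivity
          linarith
        _ = _ := by ring
  have goal1' : Real.log a - Real.log b ≤ 2 * ((20 / k + 8 * (1 + 4 / δ)) / R * Z ^ (1 + δ)) := by
    calc _ ≤ (40 / k) / R * Z := goal1
      _ ≤ _ := mono
  unfold Gam
  rw [← had, ← hbd, abs_le]
  constructor <;> linarith

/-- dominating profile for the near field -/
def HH (δ : ℝ) (w : Euc 2) : ℝ := Set.indicator (ball (0 : Euc 2) 1) (fun w => ‖w‖ ^ (-(2 - δ))) w + 8 * (1 + ‖w‖) ^ (-(2 + δ))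

lemma HH_int {δ : ℝ} (hδ : 0 < δ) (hδ1 : δ ≤ 1) : Integrable (HH δ) := by
  unfold HH
  apply Integrable.add
  · rw [integrable_indicator_iff measurableSet_ball]
    apply integrableOn_ball_of_norm_le_rpow (C := 1) (α := 2 - δ)
    · simp; linarith
    · filter_upwards with w; rw [one_mul, Real.norm_eq_abs, abs_of_nonneg (by positivity)]
    · exact (measurable_norm.pow_const _).aestronglyMeasurable
    · simp
  · exact (integrable_one_add_norm (by simp; linarith)).const_mul _
lemma HH_nonneg (δ : ℝ) (w : Euc 2) : 0 ≤ HH δ w := by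
  unfold HH
  have : 0 ≤ Set.indicator (ball (0 : Euc 2) 1) (fun w => ‖w‖ ^ (-(2 - δ))) w := Set.indicator_nonneg (fun w _ => by positivity) w
  positivity

lemma near_bound {δ R : ℝ} (hδ : 0 < δ) (hδ1 : δ ≤ 1) (hR : 1 ≤ R) {w : Euc 2} (hw : w ≠ 0) (hwR : ‖w‖ ≤ R) :
    (R ^ δ)⁻¹ * (‖w‖ ^ 2 + (1 / R) ^ 2)⁻¹ ≤ HH δ w := by
  have n : 0 < ‖w‖ := norm_pos_iff.2 hw
  have R0 : 0 < R := by linarith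
  by_cases h1 : ‖w‖ < 1
  · have e : HH δ w = ‖w‖ ^ (-(2 - δ)) + 8 * (1 + ‖w‖) ^ (-(2 + δ)) := by
      unfold HH; rw [Set.indicator_of_mem (by simpa using h1)]
    rw [e]
    have p : 0 ≤ 8 * (1 + ‖w‖) ^ (-(2 + δ)) := by positivity
    suffices (R ^ δ)⁻¹ * (‖w‖ ^ 2 + (1 / R) ^ 2)⁻¹ ≤ ‖w‖ ^ (-(2 - δ)) by linarith
    set x := ‖w‖ ^ 2 + (1 / R) ^ 2 with hx
    have x0 : 0 < x := by positivity
    have a1 : (R ^ δ)⁻¹ ≤ x ^ (δ / 2) := by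
      calc (R ^ δ)⁻¹ = ((1 / R) ^ 2) ^ (δ / 2) := by
            rw [← Real.rpow_natCast (1 / R) 2, ← Real.rpow_mul (by positivity), one_div, Real.inv_rpow R0.le]; congr 2; push_cast; ring
        _ ≤ _ := Real.rpow_le_rpow (by positivity) (by rw [hx]; nlinarith [sq_nonneg ‖w‖]) (by linarith)
    calc (R ^ δ)⁻¹ * x⁻¹ ≤ x ^ (δ / 2) * x⁻¹ := by gcongr
      _ = x ^ (-(1 - δ / 2)) := by rw [← Real.rpow_neg_one x, ← Real.rpow_add x0]; congr 1; ring
      _ ≤ (‖w‖ ^ 2) ^ (-(1 - δ / 2)) := Real.rpow_le_rpow_of_nonpos (by positivity) (by rw [hx]; nlinarith [sq_nonneg (1/R)]) (by linarith)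
      _ = ‖w‖ ^ (-(2 - δ)) := by
        rw [← Real.rpow_natCast ‖w‖ 2, ← Real.rpow_mul n.le]; congr 1; push_cast; ring
  · push Not at h1
    have i0 : 0 ≤ Set.indicator (ball (0 : Euc 2) 1) (fun w => ‖w‖ ^ (-(2 - δ))) w := Set.indicator_nonneg (fun w _ => by positivity) w
    suffices (R ^ δ)⁻¹ * (‖w‖ ^ 2 + (1 / R) ^ 2)⁻¹ ≤ 8 * (1 + ‖w‖) ^ (-(2 + δ)) by unfold HH; linarith
    have a1 : (R ^ δ)⁻¹ ≤ (‖w‖ ^ δ)⁻¹ := inv_anti₀ (by positivity) (Real.rpow_le_rpow n.le hwR hδ.le)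
    have a2 : (‖w‖ ^ 2 + (1 / R) ^ 2)⁻¹ ≤ (‖w‖ ^ 2)⁻¹ := inv_anti₀ (by positivity) (by nlinarith [sq_nonneg (1/R)])
    calc _ ≤ (‖w‖ ^ δ)⁻¹ * (‖w‖ ^ 2)⁻¹ := by gcongr
      _ = ‖w‖ ^ (-(2 + δ)) := by
        rw [← mul_inv, Real.rpow_neg n.le, add_comm, Real.rpow_add n]; norm_cast
      _ ≤ ((1 + ‖w‖) / 2) ^ (-(2 + δ)) := Real.rpow_le_rpow_of_nonpos (by positivity) (by linarith) (by linarith)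
      _ = 2 ^ (2 + δ) * (1 + ‖w‖) ^ (-(2 + δ)) := by
        rw [Real.div_rpow (by positivity) (by norm_num), Real.rpow_neg (by norm_num : (0:ℝ) ≤ 2)]; field_simp
      _ ≤ 8 * (1 + ‖w‖) ^ (-(2 + δ)) := by
        apply mul_le_mul_of_nonneg_right _ (by positivity)
        calc (2:ℝ) ^ (2 + δ) ≤ 2 ^ (3:ℝ) := Real.rpow_le_rpow_of_exponent_le (by norm_num) (by linarith)
          _ = 8 := by norm_num

set_option maxHeartbeats 1000000 in
lemma kern_e (hk : 0 < k) (hk1 : k ≤ 1) {δ : ℝ} (hδ : 0 < δ) (hδ1 : δ ≤ 1) :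
    ∃ C > (0:ℝ), ∀ y z : Euc 2, ∀ e : ℝ, 1 ≤ ‖y‖ → |py (Gam k (1 / ‖y‖)) (z - y) * e| ≤ C / ‖y‖ * (|e| + HH δ (z - y) + (1 + ‖z‖) ^ (2 + δ) * e ^ 2) := by
  refine ⟨2 / k + 1 / k ^ 2 + 8, by positivity, fun y z e hR => ?_⟩
  set R := ‖y‖ with hRd
  have R0 : 0 < R := by linarith
  have hε : 0 < 1 / R := by positivity
  set w := z - y with hw
  set Z := 1 + ‖z‖ with hZ
  have hz := norm_nonneg z
  have tri2 : R ≤ ‖z‖ + ‖w‖ := by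
    have := norm_sub_le z (z - y); rw [sub_sub_cancel] at this; exact this
  have H0 := HH_nonneg δ w
  have Z0 : 0 < Z := by positivity
  have T0 : 0 ≤ Z ^ (2 + δ) * e ^ 2 := by positivity
  have k1 : 0 < 2 / k := by positivity
  have k2 : 0 < 1 / k ^ 2 := by positivity
  rw [py_Gam hk hε]
  set q := QQ k (1 / R) w with hq
  have q0 : 0 < q := QQ_pos hk hε w
  have ql : k * ‖w‖ ^ 2 + (1 / R) ^ 2 ≤ q := QQ_lower hk1 w
  have w1 := abs_c1_le w
  rw [abs_mul, abs_mul, abs_inv, abs_of_pos q0]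
  by_cases h0 : w = 0
  · have : w 1 = 0 := by rw [h0]; rfl
    rw [this]; simp only [abs_zero, zero_mul]; positivity
  have n : 0 < ‖w‖ := norm_pos_iff.2 h0
  by_cases hc : R / 2 ≤ ‖w‖
  · have : |w 1| * q⁻¹ ≤ (2 / k) / R := by
      rw [← div_eq_mul_inv, div_le_div_iff₀ q0 R0]
      have e : 2 / k * (k * ‖w‖ ^ 2) = 2 * ‖w‖ ^ 2 := by field_simp
      have : 2 / k * (k * ‖w‖ ^ 2) ≤ 2 / k * q := by gcongr; linarith [sq_nonneg (1/R)]
      nlinarith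
    calc |w 1| * q⁻¹ * |e| ≤ (2 / k) / R * |e| := by gcongr
      _ ≤ (2 / k + 1 / k ^ 2 + 8) / R * (|e| + HH δ w + Z ^ (2 + δ) * e ^ 2) := by
        gcongr
        · linarith
        · linarith
  · push Not at hc
    set N := |w 1| * q⁻¹ with hN
    have N2 : N ^ 2 ≤ 1 / k ^ 2 * (‖w‖ ^ 2 + (1 / R) ^ 2)⁻¹ := by
      have x0 : 0 < ‖w‖ ^ 2 + (1 / R) ^ 2 := by positivity
      rw [hN, mul_pow, sq_abs, inv_pow, ← div_eq_mul_inv, ← one_div (‖w‖ ^ 2 + (1 / R) ^ 2), div_mul_div_comm, mul_one, div_le_div_iff₀ (by positivity) (by positivity)]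
      have qk : k * (‖w‖ ^ 2 + (1 / R) ^ 2) ≤ q := by (first | linarith [sq_nonneg (1/R)] | nlinarith [sq_nonneg (1/R)])
      have h1 : w 1 ^ 2 ≤ ‖w‖ ^ 2 + (1 / R) ^ 2 := by rw [norm_sq_eq]; linarith [sq_nonneg (w 0), sq_nonneg (1/R)]
      calc w 1 ^ 2 * (k ^ 2 * (‖w‖ ^ 2 + (1 / R) ^ 2)) ≤ (‖w‖ ^ 2 + (1 / R) ^ 2) * (k ^ 2 * (‖w‖ ^ 2 + (1 / R) ^ 2)) := by gcongr
        _ = (k * (‖w‖ ^ 2 + (1 / R) ^ 2)) ^ 2 := by ring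
        _ ≤ 1 * q ^ 2 := by rw [one_mul]; exact pow_le_pow_left₀ (by positivity) qk 2
    have nb := near_bound hδ hδ1 hR h0 (by linarith)
    have Rδ : 0 < R ^ δ := by positivity
    have l1 : (R ^ δ)⁻¹ * N ^ 2 ≤ 1 / k ^ 2 * HH δ w := by
      calc _ ≤ (R ^ δ)⁻¹ * (1 / k ^ 2 * (‖w‖ ^ 2 + (1 / R) ^ 2)⁻¹) := by gcongr
        _ = 1 / k ^ 2 * ((R ^ δ)⁻¹ * (‖w‖ ^ 2 + (1 / R) ^ 2)⁻¹) := by ring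
        _ ≤ _ := by gcongr
    have f4 := four_rpow (x := Z) R0 hδ hδ1 (by linarith)
    have l2 : R ^ 2 * R ^ δ ≤ 8 * Z ^ (2 + δ) := by
      have : Z ^ (2 + δ) = Z * Z ^ (1 + δ) := by
        rw [show 2 + δ = 1 + (1 + δ) by ring, Real.rpow_add Z0 1, Real.rpow_one]
      rw [this]
      calc R ^ 2 * R ^ δ = R * (R * R ^ δ) := by ring
        _ ≤ (2 * Z) * (4 * Z ^ (1 + δ)) := by gcongr; linarith
        _ = _ := by ring
    -- AM-GM
    have am : N * |e| * R ≤ (R ^ δ)⁻¹ * N ^ 2 + R ^ 2 * R ^ δ * e ^ 2 := by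
      set g := (R ^ δ)⁻¹ with hg
      have g0 : 0 < g := by positivity
      have : R ^ δ = g⁻¹ := by rw [hg, inv_inv]
      rw [this, ← sq_abs e]
      have e1 : g * N ^ 2 + R ^ 2 * g⁻¹ * |e| ^ 2 - N * |e| * R = g⁻¹ * ((g * N) ^ 2 + (R * |e|) ^ 2 - (g * N) * (R * |e|)) := by
        field_simp
      have : 0 ≤ (g * N) ^ 2 + (R * |e|) ^ 2 - (g * N) * (R * |e|) := by
        linarith [sq_nonneg (g * N - R * |e|), sq_nonneg (g * N), sq_nonneg (R * |e|)]
      have : 0 ≤ g⁻¹ * ((g * N) ^ 2 + (R * |e|) ^ 2 - (g * N) * (R * |e|)) := by positivity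
      linarith
    have l3 : R ^ 2 * R ^ δ * e ^ 2 ≤ 8 * (Z ^ (2 + δ) * e ^ 2) := by
      calc _ ≤ 8 * Z ^ (2 + δ) * e ^ 2 := by gcongr
        _ = _ := by ring
    rw [div_mul_eq_mul_div, le_div_iff₀ R0]
    have a0 := abs_nonneg e
    calc _ ≤ 1 / k ^ 2 * HH δ w + 8 * (Z ^ (2 + δ) * e ^ 2) := by linarith
      _ ≤ _ := by linarith [mul_nonneg k1.le a0, mul_nonneg k1.le H0, mul_nonneg k1.le T0, mul_nonneg k2.le a0, mul_nonneg k2.le T0]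
end kern3

lemma one_add_norm_tri (z y : Euc 2) : 1 + ‖z‖ ≤ (1 + ‖y‖) * (1 + ‖z - y‖) := by
  have : ‖z‖ ≤ ‖y‖ + ‖z - y‖ := by
    calc ‖z‖ = ‖y + (z - y)‖ := by rw [add_sub_cancel]
      _ ≤ _ := norm_add_le _ _
  nlinarith [mul_nonneg (norm_nonneg y) (norm_nonneg (z - y))]

lemma Gam_bdd {k ε : ℝ} (hk : 0 < k) (hk1 : k ≤ 1) (hε : 0 < ε) (hε1 : ε ≤ 1) (y : Euc 2) :
    ∃ B, ∀ z : Euc 2, |Gam k ε (z - y) - Gam k 1 z| ≤ B := by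
  set C := (3 + 2 * ‖y‖ ^ 2) / (k * ε ^ 2) with hC
  have hC0 : 0 < C := by positivity
  refine ⟨1 / 2 * C, fun z => ?_⟩
  have a0 := QQ_pos hk hε (z - y)
  have b0 := QQ_pos hk one_pos z
  have al := QQ_lower' hk hk1 hε hε1 (z - y)
  have bl := QQ_lower' hk hk1 one_pos le_rfl z
  have au := QQ_upper (ε := ε) hk1 (z - y)
  have bu := QQ_upper (ε := 1) hk1 z
  set a := QQ k ε (z - y)
  set b := QQ k 1 z
  have ε2 : ε ^ 2 ≤ 1 := by nlinarith
  have p : 0 < k * ε ^ 2 := by positivity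
  have t1 : ‖z‖ ^ 2 ≤ 2 * ‖y‖ ^ 2 + 2 * ‖z - y‖ ^ 2 := by
    have : ‖z‖ ≤ ‖y‖ + ‖z - y‖ := by
      calc ‖z‖ = ‖y + (z - y)‖ := by rw [add_sub_cancel]
        _ ≤ _ := norm_add_le _ _
    nlinarith [norm_nonneg z, norm_nonneg y, norm_nonneg (z - y), sq_nonneg (‖y‖ - ‖z - y‖)]
  have t2 : ‖z - y‖ ^ 2 ≤ 2 * ‖y‖ ^ 2 + 2 * ‖z‖ ^ 2 := by
    have := norm_sub_le z y
    nlinarith [norm_nonneg z, norm_nonneg y, norm_nonneg (z - y), sq_nonneg (‖y‖ - ‖z‖)]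
  have hab : b ≤ C * a := by
    calc b ≤ (3 + 2 * ‖y‖ ^ 2) * (1 + ‖z - y‖ ^ 2) := by nlinarith [mul_nonneg (sq_nonneg ‖y‖) (sq_nonneg ‖z - y‖), sq_nonneg ‖y‖, sq_nonneg ‖z - y‖]
      _ = C * (k * ε ^ 2 * (1 + ‖z - y‖ ^ 2)) := by rw [hC]; field_simp
      _ ≤ _ := by gcongr
  have hba : a ≤ C * b := by
    calc a ≤ (3 + 2 * ‖y‖ ^ 2) * (1 + ‖z‖ ^ 2) := by nlinarith [mul_nonneg (sq_nonneg ‖y‖) (sq_nonneg ‖z‖), sq_nonneg ‖y‖, sq_nonneg ‖z‖]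
      _ = C * (k * ε ^ 2 * (1 + ‖z‖ ^ 2)) := by rw [hC]; field_simp
      _ ≤ C * b := by
        gcongr
        refine le_trans ?_ bl
        have : 0 ≤ k * (1 + ‖z‖ ^ 2) := by positivity
        nlinarith
  have l1 := log_diff_le a0 b0
  have l2 := log_diff_le b0 a0
  have m1 : (a - b) / b ≤ C := by rw [div_le_iff₀ b0]; linarith
  have m2 : (b - a) / a ≤ C := by rw [div_le_iff₀ a0]; linarith
  unfold Gam
  change |1 / 2 * Real.log a - 1 / 2 * Real.log b| ≤ _
  rw [abs_le]; constructor <;> linarith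

lemma Gam1_growth {k : ℝ} (hk : 0 < k) (hk1 : k ≤ 1) (z : Euc 2) : |Gam k 1 z| ≤ 1 + ‖z‖ := by
  have b0 := QQ_pos hk one_pos z
  have bu := QQ_upper (ε := 1) hk1 z
  have bl := QQ_lower (ε := 1) hk1 z
  have n := norm_nonneg z
  have h1 : 1 ≤ QQ k 1 z := by nlinarith [mul_nonneg hk.le (sq_nonneg ‖z‖)]
  have h2 := Real.log_nonneg h1
  have h3 := log_diff_sqrt (a := QQ k 1 z) (b := 1) (t := 1 + ‖z‖) b0 one_pos (by positivity) (by nlinarith)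
  rw [Real.log_one] at h3
  unfold Gam; rw [abs_le]; constructor <;> linarith

lemma int_eF {c R0 : ℝ} {s φ : Euc 2 → ℝ} (h : TW c R0 s φ) {δ : ℝ} (hδ : 0 < δ) (i : Integrable (fun y => (1+‖y‖)^(2+δ) * eF c s φ y^2)) : Integrable (eF c s φ) := by
  have i2 : Integrable (fun y : Euc 2 => (1 + ‖y‖) ^ (-(2 + δ))) := integrable_one_add_norm (by simp; linarith)
  refine (i2.add i).mono' h.cont_e.aestronglyMeasurable ?_
  filter_upwards with y
  have p : 0 < (1 + ‖y‖) ^ (2 + δ) := by positivity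
  rw [Pi.add_apply, Real.rpow_neg (by positivity), Real.norm_eq_abs]
  set W := (1 + ‖y‖) ^ (2 + δ)
  set e := eF c s φ y
  rw [← sq_abs e, ← sub_nonneg]
  have : W⁻¹ + W * |e| ^ 2 - |e| = W⁻¹ * (1 + (W * |e|) ^ 2 - W * |e|) := by field_simp
  rw [this]
  have : 0 ≤ 1 + (W * |e|) ^ 2 - W * |e| := by nlinarith [sq_nonneg (W * |e| - 1), sq_nonneg (W * |e|)]
  positivity

lemma int_fF {c R0 : ℝ} {s φ : Euc 2 → ℝ} (h : TW c R0 s φ) {δ : ℝ} (hδ : 0 < δ) (i : Integrable (fun y => (1+‖y‖)^(1+δ) * |fF c s φ y|)) : Integrable (fF c s φ) := by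
  refine i.mono' h.cont_f.aestronglyMeasurable ?_
  filter_upwards with y
  have : 1 ≤ (1 + ‖y‖) ^ (1 + δ) := Real.one_le_rpow (by linarith [norm_nonneg y]) (by linarith)
  rw [Real.norm_eq_abs]; nlinarith [abs_nonneg (fF c s φ y)]

lemma lip_of_bdd {f : Euc 2 → ℝ} (hf : Differentiable ℝ f) {A B : ℝ} (h1 : ∀ y, |px f y| ≤ A) (h2 : ∀ y, |py f y| ≤ B) (a b : Euc 2) : |f a - f b| ≤ (A + B) * ‖a - b‖ := by
  have := convex_univ.norm_image_sub_le_of_norm_fderiv_le (𝕜 := ℝ) (f := f) (C := A + B) (x := b) (y := a) (fun x _ => hf x)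
    (fun x _ => (norm_fderiv_le _ _).trans (add_le_add (h1 x) (h2 x))) (Set.mem_univ _) (Set.mem_univ _)
  exact this

lemma TW.phi_lip {c R0 : ℝ} {s φ : Euc 2 → ℝ} (h : TW c R0 s φ) : ∃ L > (0:ℝ), ∀ a b, |φ a - φ b| ≤ L * ‖a - b‖ := by
  obtain ⟨r, hr⟩ := h.small 1 one_pos
  obtain ⟨A, hA, h1⟩ := bdd_of_small (px_contDiff h.hφ).continuous (fun y hy => (hr y hy).2.2.2.2.1)
  obtain ⟨B, hB, h2⟩ := bdd_of_small (py_contDiff h.hφ).continuous (fun y hy => (hr y hy).2.2.2.2.2)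
  exact ⟨A + B, by positivity, lip_of_bdd (h.hφ.differentiable (by norm_num)) h1 h2⟩

lemma TW.s_lip {c R0 : ℝ} {s φ : Euc 2 → ℝ} (h : TW c R0 s φ) : ∃ L > (0:ℝ), ∀ a b, |s a - s b| ≤ L * ‖a - b‖ := by
  obtain ⟨r, hr⟩ := h.small 1 one_pos
  obtain ⟨A, hA, h1⟩ := bdd_of_small (px_contDiff h.hs).continuous (fun y hy => (hr y hy).2.2.1)
  obtain ⟨B, hB, h2⟩ := bdd_of_small (py_contDiff h.hs).continuous (fun y hy => (hr y hy).2.2.2.1)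
  exact ⟨A + B, by positivity, lip_of_bdd (h.hs.differentiable (by norm_num)) h1 h2⟩

set_option maxHeartbeats 800000 in
lemma repr_y {c R0 : ℝ} {s φ : Euc 2 → ℝ} (h : TW c R0 s φ) {k : ℝ} (hk : k = 1 - c ^ 2 / 2) (he : Integrable (eF c s φ)) (hf : Integrable (fF c s φ)) (y : Euc 2) {ε : ℝ} (hε : 0 < ε) (hε1 : ε ≤ 1) :
    (∫ z, φ z * PP k ε (z - y)) - ∫ z, φ z * PP k 1 z = (∫ z, (Gam k ε (z - y) - Gam k 1 z) * fF c s φ z) + c * ∫ z, (py (Gam k ε) (z - y) - py (Gam k 1) z) * eF c s φ z := by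
  have hk0 : 0 < k := by have := h.c_lt; rw [hk]; linarith
  have hk1 : k ≤ 1 := by rw [hk]; nlinarith
  obtain ⟨A, hA, φb⟩ := h.phi_bdd
  have g1 : ContDiff ℝ 2 (Gam k ε) := Gam_contDiff hk0 hε
  have g2 : ContDiff ℝ 2 (Gam k 1) := Gam_contDiff hk0 one_pos
  have g1s : ContDiff ℝ 2 (fun z => Gam k ε (z - y)) := g1.comp (contDiff_id.sub contDiff_const)
  have dg1 := g1s.differentiable (by norm_num)
  have dg2 := g2.differentiable (by norm_num)
  have x1 : px (fun z => Gam k ε (z - y) - Gam k 1 z) = fun z => px (Gam k ε) (z - y) - px (Gam k 1) z := by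
    funext z; rw [px_sub dg1 dg2, px_shift]
  have y1 : py (fun z => Gam k ε (z - y) - Gam k 1 z) = fun z => py (Gam k ε) (z - y) - py (Gam k 1) z := by
    funext z; rw [py_sub dg1 dg2, py_shift]
  have dd1 : Differentiable ℝ (fun z => px (Gam k ε) (z - y)) := (px_diff g1).comp (differentiable_id.sub_const y)
  have dd2 : Differentiable ℝ (fun z => py (Gam k ε) (z - y)) := (py_diff g1).comp (differentiable_id.sub_const y)
  have LL : ∀ z, px (px (fun z => Gam k ε (z - y) - Gam k 1 z)) z + (1 - c ^ 2 / 2) * py (py (fun z => Gam k ε (z - y) - Gam k 1 z)) z = PP k ε (z - y) - PP k 1 z := by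
    intro z
    have l1 := LL_Gam hk0 hε (z - y)
    have l2 := LL_Gam hk0 one_pos z
    rw [x1, y1, px_sub dd1 (px_diff g2), py_sub dd2 (py_diff g2), px_shift, py_shift, ← hk]
    unfold PP; linarith
  obtain ⟨B0, hB0⟩ := Gam_bdd hk0 hk1 hε hε1 y
  have ip1 : Integrable (fun z => PP k ε (z - y)) := (PP_int hk0 hk1 hε hε1).comp_sub_right y
  have ip2 := PP_int hk0 hk1 one_pos le_rfl
  have kk : 0 < k * ε ^ 2 := by positivity
  have kk1 : k * ε ^ 2 ≤ k * 1 ^ 2 := by gcongr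
  have b21 : 2 / (k * 1 ^ 2) ≤ 2 / (k * ε ^ 2) := by gcongr
  have sh : ∀ z, ∀ g : Euc 2 → ℝ, (1 + ‖z - y‖) * |g (z - y)| ≤ 2 / (k * ε ^ 2) → (1 + ‖z‖) * |g (z - y)| ≤ (1 + ‖y‖) * (2 / (k * ε ^ 2)) := by
    intro z g hg
    have := one_add_norm_tri z y
    calc _ ≤ (1 + ‖y‖) * (1 + ‖z - y‖) * |g (z - y)| := by gcongr
      _ = (1 + ‖y‖) * ((1 + ‖z - y‖) * |g (z - y)|) := by ring
      _ ≤ _ := by gcongr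
  have R := repr_id h (K := fun z => Gam k ε (z - y) - Gam k 1 z) (g1s.sub g2) (B := |B0| + (2 + ‖y‖) * (2 / (k * ε ^ 2))) (by positivity)
    (fun z => (hB0 z).trans ((le_abs_self _).trans (le_add_of_nonneg_right (by positivity)))) ?_ ?_ ?_ he hf
  · simp only [LL] at R
    rw [y1] at R
    rw [← R, ← integral_sub]
    · congr 1; funext z; ring
    · exact ip1.bdd_mul h.hφ.continuous.aestronglyMeasurable (c := A) (by filter_upwards with z; exact φb z)
    · exact ip2.bdd_mul h.hφ.continuous.aestronglyMeasurable (c := A) (by filter_upwards with z; exact φb z)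
  · intro z
    rw [x1]
    have a1 := sh z _ (px_Gam_bound hk0 hk1 hε hε1 (z - y))
    have a2 := (px_Gam_bound hk0 hk1 one_pos le_rfl z).trans b21
    have := abs_sub (px (Gam k ε) (z - y)) (px (Gam k 1) z)
    have n : 0 ≤ 1 + ‖z‖ := by positivity
    calc _ ≤ (1 + ‖z‖) * (|px (Gam k ε) (z - y)| + |px (Gam k 1) z|) := by gcongr
      _ ≤ _ := by rw [mul_add]; have := abs_nonneg B0; linarith
  · intro z
    rw [y1]
    have a1 := sh z _ (py_Gam_bound hk0 hk1 hε hε1 (z - y))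
    have a2 := (py_Gam_bound hk0 hk1 one_pos le_rfl z).trans b21
    have := abs_sub (py (Gam k ε) (z - y)) (py (Gam k 1) z)
    have n : 0 ≤ 1 + ‖z‖ := by positivity
    calc _ ≤ (1 + ‖z‖) * (|py (Gam k ε) (z - y)| + |py (Gam k 1) z|) := by gcongr
      _ ≤ _ := by rw [mul_add]; have := abs_nonneg B0; linarith
  · simp only [LL]; exact ip1.sub ip2

set_option maxHeartbeats 800000 in
lemma phi_asym {c R0 : ℝ} {s φ : Euc 2 → ℝ} (h : TW c R0 s φ) {k : ℝ} (hk : k = 1 - c ^ 2 / 2) :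
    ∃ M > (0:ℝ), ∃ c0 q C : ℝ, 0 < C ∧ ∀ y, 1 ≤ ‖y‖ → |M * φ y - (c0 + q * Gam k 1 y)| ≤ C / ‖y‖ := by
  have hk0 : 0 < k := by have := h.c_lt; rw [hk]; linarith
  have hk1 : k ≤ 1 := by rw [hk]; nlinarith
  obtain ⟨δ, hδ, hδ1, ie, jf⟩ := weighted h
  have he := int_eF h hδ ie
  have hf := int_fF h hδ jf
  obtain ⟨L, hL, lip⟩ := h.phi_lip
  obtain ⟨A, hA, φb⟩ := h.phi_bdd
  obtain ⟨C1, hC1, b1⟩ := Gam_diff hk0 hk1 hδ hδ1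
  obtain ⟨C2, hC2, b2⟩ := kern_e hk0 hk1 hδ hδ1
  have cf := h.cont_f
  have ce := h.cont_e
  have g2 : Continuous (Gam k 1) := (Gam_contDiff hk0 one_pos (n := 1)).continuous
  set F := ∫ z, (1+‖z‖)^(1+δ) * |fF c s φ z| with hF
  have F0 : 0 ≤ F := integral_nonneg (fun z => by positivity)
  have ieH : ∀ y, Integrable (fun z => |eF c s φ z| + HH δ (z - y) + (1+‖z‖)^(2+δ) * eF c s φ z^2) := fun y =>
    (he.abs.add ((HH_int hδ hδ1).comp_sub_right y)).add ie
  set G := (∫ z, |eF c s φ z|) + (∫ z, HH δ z) + ∫ z, (1+‖z‖)^(2+δ) * eF c s φ z^2 with hG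
  have G0 : 0 ≤ G := by
    have := integral_nonneg (μ := (volume : Measure (Euc 2))) (f := HH δ) (fun z => HH_nonneg δ z)
    have : 0 ≤ ∫ z, |eF c s φ z| := integral_nonneg (fun z => abs_nonneg _)
    have : 0 ≤ ∫ z, (1+‖z‖)^(2+δ) * eF c s φ z^2 := integral_nonneg (fun z => by positivity)
    rw [hG]; positivity
  have eG : ∀ y, ∫ z, (|eF c s φ z| + HH δ (z - y) + (1+‖z‖)^(2+δ) * eF c s φ z^2) = G := by
    intro y
    have j1 : Integrable (fun z => |eF c s φ z|) := he.abs
    have j2 : Integrable (fun z => HH δ (z - y)) := (HH_int hδ hδ1).comp_sub_right y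
    have j3 : Integrable (fun z => |eF c s φ z| + HH δ (z - y)) := j1.add j2
    rw [integral_add j3 ie, integral_add j1 j2, integral_sub_right_eq_self (μ := (volume : Measure (Euc 2))) (HH δ) y]
  have W0 : 0 ≤ ∫ w, ‖w‖ * PP k 1 w := integral_nonneg (fun w => mul_nonneg (norm_nonneg _) (PP_nonneg hk0 w))
  have iG1 : Integrable (fun z => Gam k 1 z * fF c s φ z) := by
    refine jf.mono' (g2.mul cf).aestronglyMeasurable ?_
    filter_upwards with z
    rw [Real.norm_eq_abs, abs_mul]
    apply mul_le_mul_of_nonneg_right _ (abs_nonneg _)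
    exact (Gam1_growth hk0 hk1 z).trans (one_le_rpow_one (by linarith [norm_nonneg z]) hδ)
  have iP1 : Integrable (fun z => py (Gam k 1) z * eF c s φ z) := by
    refine he.bdd_mul (c := 2 / (k * 1 ^ 2)) (py_cont (Gam_contDiff hk0 one_pos)).aestronglyMeasurable ?_
    filter_upwards with z
    have := py_Gam_bound hk0 hk1 one_pos le_rfl z
    rw [Real.norm_eq_abs]; nlinarith [norm_nonneg z, mul_nonneg (norm_nonneg z) (abs_nonneg (py (Gam k 1) z))]
  refine ⟨∫ w, PP k 1 w, PP_mass_pos hk0 hk1, (∫ z, φ z * PP k 1 z) - (∫ z, Gam k 1 z * fF c s φ z) - c * ∫ z, py (Gam k 1) z * eF c s φ z, ∫ z, fF c s φ z,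
    L * (∫ w, ‖w‖ * PP k 1 w) + C1 * F + c * (C2 * G) + 1, by have := h.c_pos; positivity, fun y hy => ?_⟩
  have R0 : 0 < ‖y‖ := by linarith
  have hε : 0 < 1 / ‖y‖ := by positivity
  have hε1 : 1 / ‖y‖ ≤ 1 := by rw [div_le_one R0]; exact hy
  set ε := 1 / ‖y‖ with hεd
  have rep := repr_y h hk he hf y hε hε1
  have ap := moll_approx hk0 hk1 hε h.hφ.continuous lip φb y
  have gε : Continuous (fun z => Gam k ε (z - y)) := (Gam_contDiff hk0 hε (n := 1)).continuous.comp (continuous_id.sub continuous_const)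
  have gεy : Continuous (fun z => py (Gam k ε) (z - y)) := (py_cont (Gam_contDiff hk0 hε)).comp (continuous_id.sub continuous_const)
  have i1 : Integrable (fun z => (Gam k ε (z - y) - Gam k 1 y) * fF c s φ z) := by
    refine (jf.const_mul (C1 / ‖y‖)).mono' ((gε.sub continuous_const).mul cf).aestronglyMeasurable ?_
    filter_upwards with z
    rw [Real.norm_eq_abs, abs_mul]
    calc _ ≤ C1 / ‖y‖ * (1 + ‖z‖) ^ (1 + δ) * |fF c s φ z| := by gcongr; exact b1 y z hy
      _ = _ := by ring
  have e1 : |∫ z, (Gam k ε (z - y) - Gam k 1 y) * fF c s φ z| ≤ C1 / ‖y‖ * F := by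
    rw [hF, ← integral_const_mul, ← Real.norm_eq_abs]
    apply norm_integral_le_of_norm_le (jf.const_mul _)
    filter_upwards with z
    rw [Real.norm_eq_abs, abs_mul]
    calc _ ≤ C1 / ‖y‖ * (1 + ‖z‖) ^ (1 + δ) * |fF c s φ z| := by gcongr; exact b1 y z hy
      _ = _ := by ring
  have i2 : Integrable (fun z => py (Gam k ε) (z - y) * eF c s φ z) := by
    refine ((ieH y).const_mul (C2 / ‖y‖)).mono' (gεy.mul ce).aestronglyMeasurable ?_
    filter_upwards with z
    exact b2 y z _ hy
  have e2 : |∫ z, py (Gam k ε) (z - y) * eF c s φ z| ≤ C2 / ‖y‖ * G := by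
    rw [← eG y, ← integral_const_mul, ← Real.norm_eq_abs]
    apply norm_integral_le_of_norm_le ((ieH y).const_mul _)
    filter_upwards with z
    exact b2 y z _ hy
  have s1 : ∫ z, (Gam k ε (z - y) - Gam k 1 z) * fF c s φ z = (∫ z, (Gam k ε (z - y) - Gam k 1 y) * fF c s φ z) + Gam k 1 y * (∫ z, fF c s φ z) - ∫ z, Gam k 1 z * fF c s φ z := by
    have j : Integrable (fun z => Gam k 1 y * fF c s φ z) := hf.const_mul _
    have j2 : Integrable (fun z => (Gam k ε (z - y) - Gam k 1 y) * fF c s φ z + Gam k 1 y * fF c s φ z) := i1.add j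
    rw [← integral_const_mul, ← integral_add i1 j, ← integral_sub j2 iG1]
    congr 1; funext z; ring
  have s2 : ∫ z, (py (Gam k ε) (z - y) - py (Gam k 1) z) * eF c s φ z = (∫ z, py (Gam k ε) (z - y) * eF c s φ z) - ∫ z, py (Gam k 1) z * eF c s φ z := by
    rw [← integral_sub i2 iP1]; congr 1; funext z; ring
  rw [s1, s2] at rep
  have hc := h.c_pos
  have e3 : |c * ∫ z, py (Gam k ε) (z - y) * eF c s φ z| ≤ c * (C2 / ‖y‖ * G) := by
    rw [abs_mul, abs_of_pos hc]; gcongr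
  have fin : (L * (∫ w, ‖w‖ * PP k 1 w) + C1 * F + c * (C2 * G) + 1) / ‖y‖ = ε * (L * ∫ w, ‖w‖ * PP k 1 w) + C1 / ‖y‖ * F + c * (C2 / ‖y‖ * G) + ε := by
    rw [hεd]; ring
  rw [fin]
  rw [abs_le] at *
  constructor <;> nlinarith

lemma phi_decay {c R0 : ℝ} {s φ : Euc 2 → ℝ} (h : TW c R0 s φ) : ∃ C > (0:ℝ), ∀ y, 1 ≤ ‖y‖ → |φ y| ≤ C / ‖y‖ := by
  set k := 1 - c ^ 2 / 2 with hk
  have hk0 : 0 < k := by have := h.c_lt; rw [hk]; linarith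
  obtain ⟨M, hM, c0, q, C, hC, hy⟩ := phi_asym h hk
  obtain ⟨r, hr⟩ := h.small 1 one_pos
  have nt : ∀ t : ℝ, ‖t • basisVec (d := 2) 0‖ = |t| := by
    intro t; rw [norm_smul, norm_basisVec, mul_one, Real.norm_eq_abs]
  have q0 : q = 0 := by
    by_contra hq
    have hq' : 0 < |q| := abs_pos.2 hq
    have bd : ∀ t : ℝ, max r 1 ≤ t → |q| * Gam k 1 (t • basisVec 0) ≤ M + |c0| + C := by
      intro t ht
      have t1 : 1 ≤ t := (le_max_right _ _).trans ht
      have n : ‖t • basisVec (d := 2) 0‖ = t := by rw [nt, abs_of_pos (by linarith)]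
      have h1 := hy (t • basisVec 0) (by rw [n]; exact t1)
      have h2 := (hr (t • basisVec 0) (by rw [n]; exact (le_max_left _ _).trans ht)).2.1
      rw [n] at h1
      have h3 : C / t ≤ C := div_le_self hC.le t1
      have h4 : |q * Gam k 1 (t • basisVec 0)| ≤ M + |c0| + C := by
        have a := abs_le.1 (h1.trans h3)
        have b := abs_le.1 h2
        have d := le_abs_self c0
        have d' := neg_abs_le c0
        rw [abs_le]; constructor <;> nlinarith
      rw [abs_mul] at h4
      exact (mul_le_mul_of_nonneg_left (le_abs_self _) hq'.le).trans h4
    have tl : Tendsto (fun t : ℝ => |q| * Gam k 1 (t • basisVec 0)) atTop atTop := by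
      have e : (fun t : ℝ => |q| * Gam k 1 (t • basisVec 0)) = fun t => |q| * (1 / 2 * Real.log (k * (t * t) + 1)) := by
        funext t; unfold Gam QQ; simp [basisVec]
      rw [e]
      apply Tendsto.const_mul_atTop hq'
      apply Tendsto.const_mul_atTop (by norm_num)
      apply Real.tendsto_log_atTop.comp
      apply tendsto_atTop_add_const_right
      exact Tendsto.const_mul_atTop hk0 (tendsto_id.atTop_mul_atTop₀ tendsto_id)
    obtain ⟨t, ht1, ht2⟩ := ((tl.eventually_gt_atTop (M + |c0| + C)).and (eventually_ge_atTop (max r 1))).exists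
    linarith [bd t ht2]
  have c00 : c0 = 0 := by
    rw [← abs_nonpos_iff]
    apply le_of_forall_pos_le_add
    intro ε hε
    obtain ⟨r', hr'⟩ := h.small (ε / (2 * M)) (by positivity)
    set t := max (max r' 1) (2 * C / ε) with ht
    have t1 : 1 ≤ t := (le_max_right _ _).trans (le_max_left _ _)
    have n : ‖t • basisVec (d := 2) 0‖ = t := by rw [nt, abs_of_pos (by linarith)]
    have h1 := hy (t • basisVec 0) (by rw [n]; exact t1)
    have h2 := (hr' (t • basisVec 0) (by rw [n]; exact (le_max_left _ _).trans (le_max_left _ _))).2.1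
    rw [n, q0] at h1
    have h3 : C / t ≤ ε / 2 := by
      have : 2 * C / ε ≤ t := le_max_right _ _
      rw [div_le_iff₀ hε] at this
      rw [div_le_div_iff₀ (by linarith) (by norm_num)]; linarith
    have h4 : M * |φ (t • basisVec 0)| ≤ ε / 2 := by
      calc _ ≤ M * (ε / (2 * M)) := by gcongr
        _ = _ := by field_simp
    have h5 : |M * φ (t • basisVec 0)| ≤ ε / 2 := by rw [abs_mul, abs_of_pos hM]; exact h4
    rw [abs_le] at *
    constructor <;> linarith
  refine ⟨C / M, by positivity, fun y h1 => ?_⟩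
  have := hy y h1
  rw [c00, q0] at this
  simp only [zero_mul, add_zero, sub_zero, abs_mul, abs_of_pos hM] at this
  rw [div_right_comm, le_div_iff₀ hM]; linarith

lemma EE_decay {c R0 : ℝ} {s φ : Euc 2 → ℝ} (h : TW c R0 s φ) : ∃ C > (0:ℝ), ∃ T1 ≥ (1:ℝ), ∀ T ≥ T1, EE s φ T ≤ C / T ^ 2 := by
  obtain ⟨C1, hC1, R1, hR1, ε, hε, cac⟩ := caccioppoli h
  obtain ⟨C2, hC2, ph⟩ := phi_decay h
  set V := (volume : Measure (Euc 2)).real (closedBall 0 1) with hV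
  have V0 : 0 ≤ V := measureReal_nonneg
  have E0 := EE_nonneg s φ 0
  have r0 := h.R0_ge
  have cs := h.hs.continuous
  have cφ := h.hφ.continuous
  refine ⟨4 * C1 * (EE s φ 0 + 4 * C2 ^ 2 * V + 1), by positivity, 2 * R1, by linarith, fun T hT => ?_⟩
  set R := T / 2 with hR
  have hRR1 : R1 ≤ R := by rw [hR]; linarith
  have Rp : 1 ≤ R := by linarith
  have R0' : 0 < R := by linarith
  have c1 := cac R hRR1 0 (by simpa using hε.le)
  have i1 : IntegrableOn (fun y => s y ^ 2) (annS R (2*R)) := (cs.pow 2).continuousOn.integrableOn_compact (annS_compact _ _)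
  have i2 : IntegrableOn (fun y => (φ y - 0) ^ 2) (annS R (2*R)) := ((cφ.sub continuous_const).pow 2).continuousOn.integrableOn_compact (annS_compact _ _)
  have e1 : ∫ y in annS R (2*R), (s y ^ 2 + (φ y - 0) ^ 2) = (∫ y in annS R (2*R), s y ^ 2) + ∫ y in annS R (2*R), (φ y - 0) ^ 2 := integral_add i1 i2
  have e2 : ∫ y in annS R (2*R), s y ^ 2 ≤ EE s φ 0 := (h.s_int _ _).trans ((h.ann_le_EE _ _).trans (EE_anti h.int R0'.le))
  have fin : (volume : Measure (Euc 2)) (annS R (2*R)) < ⊤ := (annS_compact _ _).measure_lt_top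
  have e3 : ∫ y in annS R (2*R), (φ y - 0) ^ 2 ≤ 4 * C2 ^ 2 * V := by
    have b := norm_setIntegral_le_of_norm_le_const (μ := (volume : Measure (Euc 2))) (s := annS R (2*R)) (f := fun y => (φ y - 0) ^ 2) (C := (C2 / R) ^ 2) fin ?_
    · have m : (volume : Measure (Euc 2)).real (annS R (2*R)) ≤ (2 * R) ^ 2 * V := by
        rw [hV, ← vol_ball_scale _ (by linarith)]
        apply measureReal_mono
        · intro y hy; simpa using hy.2
        · exact (isCompact_closedBall _ _).measure_lt_top.ne
      calc _ ≤ _ := le_abs_self _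
        _ ≤ (C2 / R) ^ 2 * (volume : Measure (Euc 2)).real (annS R (2*R)) := b
        _ ≤ (C2 / R) ^ 2 * ((2 * R) ^ 2 * V) := by gcongr
        _ = _ := by field_simp; ring
    · intro y hy
      have hy1 : R ≤ ‖y‖ := hy.1
      have := ph y (Rp.trans hy1)
      rw [sub_zero, norm_pow, Real.norm_eq_abs]
      apply pow_le_pow_left₀ (abs_nonneg _)
      exact this.trans (by gcongr)
  rw [e1] at c1
  have : 2 * R = T := by rw [hR]; ring
  rw [this] at c1 e2 e3
  calc EE s φ T ≤ _ := c1
    _ ≤ C1 / R ^ 2 * (EE s φ 0 + 4 * C2 ^ 2 * V + 1) := by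
        apply mul_le_mul_of_nonneg_left _ (by positivity)
        linarith
    _ = _ := by rw [hR]; field_simp; norm_num

lemma green {w ψ : Euc 2 → ℝ} (w2 : ContDiff ℝ 2 w) (wc : HasCompactSupport w) (ψ2 : ContDiff ℝ 2 ψ) :
    ∫ z, w z * (px (px ψ) z + py (py ψ) z) = ∫ z, ψ z * (px (px w) z + py (py w) z) := by
  have dw := w2.differentiable (by norm_num)
  have dψ := ψ2.differentiable (by norm_num)
  have k1 := px_contDiff w2
  have k2 := py_contDiff w2
  have k3 := px_contDiff ψ2
  have k4 := py_contDiff ψ2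
  have d1 := px_diff w2
  have d2 := py_diff w2
  have d3 := px_diff ψ2
  have d4 := py_diff ψ2
  have w1 : ContDiff ℝ 1 w := w2.of_le (by norm_num)
  have ψ1 : ContDiff ℝ 1 ψ := ψ2.of_le (by norm_num)
  set P : Euc 2 → ℝ := fun z => w z * px ψ z - px w z * ψ z with hP
  set Q : Euc 2 → ℝ := fun z => w z * py ψ z - py w z * ψ z with hQ
  have P1 : ContDiff ℝ 1 P := by rw [hP]; fun_prop
  have Q1 : ContDiff ℝ 1 Q := by rw [hQ]; fun_prop
  have Pc : HasCompactSupport P := by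
    have a1 : HasCompactSupport (fun y => w y * px ψ y) := wc.mul_right
    have a2 : HasCompactSupport (fun y => px w y * ψ y) := (px_compact wc).mul_right
    exact a1.sub a2
  have Qc : HasCompactSupport Q := by
    have a1 : HasCompactSupport (fun y => w y * py ψ y) := wc.mul_right
    have a2 : HasCompactSupport (fun y => py w y * ψ y) := (py_compact wc).mul_right
    exact a1.sub a2
  have pP : ∀ y, px P y = w y * px (px ψ) y - px (px w) y * ψ y := by
    intro y
    rw [hP, px_sub, px_mul dw d3, px_mul d1 dψ]
    · ring
    all_goals fun_prop
  have pQ : ∀ y, py Q y = w y * py (py ψ) y - py (py w) y * ψ y := by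
    intro y
    rw [hQ, py_sub, py_mul dw d4, py_mul d2 dψ]
    · ring
    all_goals fun_prop
  have IP := integral_px P1 Pc
  have IQ := integral_py Q1 Qc
  have iP : Integrable (px P) := (px_cont P1).integrable_of_hasCompactSupport (px_compact Pc)
  have iQ : Integrable (py Q) := (py_cont Q1).integrable_of_hasCompactSupport (py_compact Qc)
  have iPQ : Integrable (fun z => px P z + py Q z) := iP.add iQ
  have c1 := px_cont k1
  have c2 := py_cont k2
  have cψ := ψ1.continuous
  have iR : Integrable (fun z => ψ z * (px (px w) z + py (py w) z)) := by
    apply Continuous.integrable_of_hasCompactSupport (by fun_prop)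
    exact HasCompactSupport.mul_left (f := ψ) ((px_compact (px_compact wc)).add (py_compact (py_compact wc)))
  have : ∫ z, w z * (px (px ψ) z + py (py ψ) z) = ∫ z, ((px P z + py Q z) + ψ z * (px (px w) z + py (py w) z)) := by
    congr 1; funext z; rw [pP, pQ]; ring
  rw [this, integral_add iPQ iR, integral_add iP iQ, IP, IQ]; ring

/-- dominating profile for the squared kernel -/
def JJ (u : Euc 2) : ℝ := Set.indicator (ball (0 : Euc 2) 3) (fun u => 8 + 8 * ‖u‖ ^ (-(1:ℝ))) u
lemma JJ_int : Integrable JJ := by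
  unfold JJ
  rw [integrable_indicator_iff measurableSet_ball]
  apply IntegrableOn.add
  · exact integrableOn_const (measure_ball_lt_top).ne
  · apply Integrable.const_mul
    apply integrableOn_ball_of_norm_le_rpow (C := 1) (α := 1)
    · simp
    · filter_upwards with w; rw [one_mul, Real.norm_eq_abs, abs_of_nonneg (by positivity)]
    · exact (measurable_norm.pow_const _).aestronglyMeasurable
    · simp
lemma JJ_nonneg (u : Euc 2) : 0 ≤ JJ u := Set.indicator_nonneg (fun w _ => by positivity) u
lemma Gam_sq {ε : ℝ} (hε : 0 < ε) (hε1 : ε ≤ 1) {u : Euc 2} (hu : u ≠ 0) (hu2 : ‖u‖ ≤ 2) : Gam 1 ε u ^ 2 ≤ JJ u := by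
  have n : 0 < ‖u‖ := norm_pos_iff.2 hu
  unfold JJ
  rw [Set.indicator_of_mem (by rw [mem_ball_zero_iff]; linarith)]
  have l := QQ_lower (k := 1) (ε := ε) le_rfl u
  have up := QQ_upper (k := 1) (ε := ε) le_rfl u
  have q0 := QQ_pos one_pos hε u
  have h1 : Real.log (QQ 1 ε u) ≤ 4 := by
    have := Real.log_le_sub_one_of_pos q0
    nlinarith
  set t := ‖u‖ ^ (-(1/2:ℝ)) with ht
  have t0 : 0 < t := by positivity
  have h2 : -(4 * t) ≤ Real.log (QQ 1 ε u) := by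
    have a : Real.log (‖u‖ ^ 2) ≤ Real.log (QQ 1 ε u) := Real.log_le_log (by positivity) (by nlinarith [sq_nonneg ε])
    rw [Real.log_pow] at a
    have b : Real.log t = -(1/2) * Real.log ‖u‖ := by rw [ht, Real.log_rpow n]
    have d := Real.log_le_sub_one_of_pos t0
    push_cast at a
    linarith
  have h3 : t ^ 2 = ‖u‖ ^ (-(1:ℝ)) := by
    rw [ht, ← Real.rpow_natCast, ← Real.rpow_mul n.le]; norm_num
  rw [← h3]
  unfold Gam
  have : |1 / 2 * Real.log (QQ 1 ε u)| ≤ 2 + 2 * t := by rw [abs_le]; constructor <;> linarith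
  have := sq_le_sq' (abs_le.1 this).1 (abs_le.1 this).2
  nlinarith [sq_nonneg (1 - t)]

lemma lap_s_bound {c s a b p q L : ℝ} (hc : 0 < c) (hc2 : c ^ 2 < 2) (hs : |s| ≤ 1 / 2) (ha : |a| ≤ 1) (hb : |b| ≤ 1) (hp : |p| ≤ 1) (hq : |q| ≤ 1)
    (e : L + a ^ 2 + b ^ 2 - p ^ 2 - q ^ 2 - c * q + 1 - Real.exp (2 * s) = 0) : |L| ≤ 4 * |s| + |a| + |b| + |p| + 3 * |q| := by
  have hc' : c ≤ 2 := by nlinarith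
  have ex := exp_bound_two (x := 2 * s) (by rw [abs_mul, abs_two]; linarith)
  have s2 : (2 * s) ^ 2 ≤ 2 * |s| := by rw [mul_pow, ← sq_abs s]; nlinarith [abs_nonneg s]
  have sqb : ∀ x : ℝ, |x| ≤ 1 → x ^ 2 ≤ |x| := fun x hx => by rw [← sq_abs]; nlinarith [abs_nonneg x]
  have a2 := sqb a ha
  have b2 := sqb b hb
  have p2 := sqb p hp
  have q2 := sqb q hq
  have cq : |c * q| ≤ 2 * |q| := by rw [abs_mul, abs_of_pos hc]; nlinarith [abs_nonneg q]
  have := abs_le.1 cq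
  have := abs_le.1 ex
  have := le_abs_self s
  have := neg_abs_le s
  have := abs_nonneg s
  have := abs_nonneg a
  have := abs_nonneg b
  have := abs_nonneg p
  have := abs_nonneg q
  have := sq_nonneg a
  have := sq_nonneg b
  have := sq_nonneg p
  have := sq_nonneg q
  rw [abs_le]; constructor <;> linarith

lemma sq_five (a b c d e : ℝ) : (a + b + c + d + e) ^ 2 ≤ 5 * (a ^ 2 + b ^ 2 + c ^ 2 + d ^ 2 + e ^ 2) := by
  nlinarith [sq_nonneg (a - b), sq_nonneg (a - c), sq_nonneg (a - d), sq_nonneg (a - e), sq_nonneg (b - c), sq_nonneg (b - d), sq_nonneg (b - e), sq_nonneg (c - d), sq_nonneg (c - e), sq_nonneg (d - e)]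

lemma cut_alg {K η ηx ηy ηL s a b p q L : ℝ} (hK : 1 ≤ K) (h0 : |η| ≤ 1) (h1 : |ηx| ≤ K) (h2 : |ηy| ≤ K) (h3 : |ηL| ≤ 2 * K)
    (hL : |L| ≤ 4 * |s| + |a| + |b| + |p| + 3 * |q|) :
    (η * L + 2 * (ηx * a + ηy * b) + s * ηL) ^ 2 ≤ 180 * K ^ 2 * (s ^ 2 + a ^ 2 + b ^ 2 + p ^ 2 + q ^ 2) := by
  have b1 : |η * L| ≤ 4 * |s| + |a| + |b| + |p| + 3 * |q| := by
    rw [abs_mul]; nlinarith [abs_nonneg L, abs_nonneg η]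
  have b2 : |ηx * a| ≤ K * |a| := by rw [abs_mul]; gcongr
  have b3 : |ηy * b| ≤ K * |b| := by rw [abs_mul]; gcongr
  have b4 : |s * ηL| ≤ 2 * K * |s| := by rw [abs_mul, mul_comm]; gcongr
  have s0 := mul_nonneg (by linarith : (0:ℝ) ≤ K - 1) (abs_nonneg s)
  have a0 := mul_nonneg (by linarith : (0:ℝ) ≤ K - 1) (abs_nonneg a)
  have b0 := mul_nonneg (by linarith : (0:ℝ) ≤ K - 1) (abs_nonneg b)
  have p0 := mul_nonneg (by linarith : (0:ℝ) ≤ K - 1) (abs_nonneg p)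
  have q0 := mul_nonneg (by linarith : (0:ℝ) ≤ K - 1) (abs_nonneg q)
  have n1 := abs_nonneg s
  have n2 := abs_nonneg a
  have n3 := abs_nonneg b
  have n4 := abs_nonneg p
  have n5 := abs_nonneg q
  have tot : |η * L + 2 * (ηx * a + ηy * b) + s * ηL| ≤ 6 * K * (|s| + |a| + |b| + |p| + |q|) := by
    rw [abs_le] at b1 b2 b3 b4 ⊢
    constructor <;> linarith
  have := sq_le_sq' (abs_le.1 tot).1 (abs_le.1 tot).2
  have sf := sq_five |s| |a| |b| |p| |q|
  simp only [sq_abs] at sf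
  calc _ ≤ (6 * K * (|s| + |a| + |b| + |p| + |q|)) ^ 2 := this
    _ = 36 * K ^ 2 * (|s| + |a| + |b| + |p| + |q|) ^ 2 := by ring
    _ ≤ 36 * K ^ 2 * (5 * (s ^ 2 + a ^ 2 + b ^ 2 + p ^ 2 + q ^ 2)) := by gcongr
    _ = _ := by ring

set_option maxHeartbeats 800000 in
lemma s_decay {c R0 : ℝ} {s φ : Euc 2 → ℝ} (h : TW c R0 s φ) : ∃ C > (0:ℝ), ∃ R2 ≥ (1:ℝ), ∀ y, R2 ≤ ‖y‖ → |s y| ≤ C / ‖y‖ := by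
  obtain ⟨C1, hC1, T1, hT1, ed⟩ := EE_decay h
  obtain ⟨K, hK, eb⟩ := eta_bounds
  obtain ⟨L, hL, lip⟩ := h.s_lip
  obtain ⟨r, hr⟩ := h.small (1/2) (by norm_num)
  obtain ⟨A, hA, sb⟩ := bdd_of_small h.hs.continuous (fun y hy => (hr y hy).1)
  have hM := PP_mass_pos (k := 1) one_pos le_rfl
  set M := ∫ w, PP 1 1 w with hMd
  set I := ∫ w, ‖w‖ * PP 1 1 w with hId
  have I0 : 0 ≤ I := integral_nonneg (fun w => mul_nonneg (norm_nonneg _) (PP_nonneg one_pos w))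
  set J := ∫ u, JJ u with hJd
  have J0 : 0 ≤ J := integral_nonneg JJ_nonneg
  have r0 := h.R0_ge
  have hc := h.c_pos
  have s2 := h.hs
  have ds := s2.differentiable (by norm_num)
  have η2 : ContDiff ℝ 2 (eta 1) := contDiff_infty.1 (eta_contDiff 1) 2
  refine ⟨((L + 2 * K * A) * I + J + 720 * K ^ 2 * C1 + 1) / M, by positivity, 2 * T1 + 2 * |r| + 2 * R0 + 4, by have := abs_nonneg r; linarith, fun y hy => ?_⟩
  have ar := le_abs_self r
  have ar0 := abs_nonneg r
  set R := ‖y‖ with hR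
  have Rp : 0 < R := by linarith
  have hε : 0 < 1 / R := by positivity
  have hε1 : 1 / R ≤ 1 := by rw [div_le_one Rp]; linarith
  set ε := 1 / R with hεd
  set η : Euc 2 → ℝ := fun z => eta 1 (z - y) with hη
  have η2' : ContDiff ℝ 2 η := η2.comp (contDiff_id.sub contDiff_const)
  have dη := η2'.differentiable (by norm_num)
  set w : Euc 2 → ℝ := fun z => η z * s z with hw
  have w2 : ContDiff ℝ 2 w := η2'.mul s2
  have ηc : HasCompactSupport η := by
    apply HasCompactSupport.intro (isCompact_closedBall y 2)
    intro z hz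
    rw [mem_closedBall, dist_eq_norm] at hz
    exact eta_zero one_pos (by linarith)
  have wc : HasCompactSupport w := ηc.mul_right
  set ψ : Euc 2 → ℝ := fun z => Gam 1 ε (z - y) with hψ
  have g1 : ContDiff ℝ 2 (Gam 1 ε) := Gam_contDiff one_pos hε
  have ψ2 : ContDiff ℝ 2 ψ := g1.comp (contDiff_id.sub contDiff_const)
  have gr := green w2 wc ψ2
  have Lψ : ∀ z, px (px ψ) z + py (py ψ) z = PP 1 ε (z - y) := by
    intro z
    have := LL_Gam one_pos hε (z - y)
    rw [hψ, px_shift, px_shift, py_shift, py_shift]; unfold PP; linarith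
  simp only [Lψ] at gr
  -- derivatives of the cutoff
  have hx : px η = fun z => px (eta 1) (z - y) := px_shift _ _
  have hy' : py η = fun z => py (eta 1) (z - y) := py_shift _ _
  have hxx : px (px η) = fun z => px (px (eta 1)) (z - y) := by rw [hx, px_shift]
  have hyy : py (py η) = fun z => py (py (eta 1)) (z - y) := by rw [hy', py_shift]
  have bx : ∀ z, |px η z| ≤ K := fun z => by rw [hx]; have := (eb 1 one_pos (z - y)).1; rwa [div_one] at this
  have bY : ∀ z, |py η z| ≤ K := fun z => by rw [hy']; have := (eb 1 one_pos (z - y)).2.1; rwa [div_one] at this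
  have bxx : ∀ z, |px (px η) z| ≤ K := fun z => by rw [hxx]; have := (eb 1 one_pos (z - y)).2.2.1; rwa [one_pow, div_one] at this
  have byy : ∀ z, |py (py η) z| ≤ K := fun z => by rw [hyy]; have := (eb 1 one_pos (z - y)).2.2.2; rwa [one_pow, div_one] at this
  have η0 : ∀ z, |η z| ≤ 1 := fun z => by rw [hη, abs_of_nonneg (eta_nonneg _ _)]; exact eta_le_one _ _
  have ηlip := lip_of_bdd dη bx bY
  have wlip : ∀ a b, |w a - w b| ≤ (L + 2 * K * A) * ‖a - b‖ := by
    intro a b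
    have e : w a - w b = η a * (s a - s b) + (η a - η b) * s b := by rw [hw]; ring
    rw [e]
    refine (abs_add_le _ _).trans ?_
    rw [abs_mul, abs_mul]
    have n := norm_nonneg (a - b)
    calc _ ≤ 1 * (L * ‖a - b‖) + ((K + K) * ‖a - b‖) * A := by
          gcongr
          · exact η0 a
          · exact lip a b
          · exact ηlip a b
          · exact sb b
      _ = _ := by ring
  have wb : ∀ a, |w a| ≤ A := fun a => by
    rw [hw, abs_mul]; nlinarith [η0 a, sb a, abs_nonneg (η a), abs_nonneg (s a)]
  have ap := moll_approx (k := 1) one_pos le_rfl hε w2.continuous wlip wb y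
  have wy : w y = s y := by rw [hw, hη]; simp only [sub_self]; rw [eta_one one_pos (by simp), one_mul]
  rw [wy, ← hMd, ← hId, gr] at ap
  -- laplacian of w
  have p1 : px w = fun z => px η z * s z + η z * px s z := by funext z; rw [hw, px_mul dη ds]
  have p2 : py w = fun z => py η z * s z + η z * py s z := by funext z; rw [hw, py_mul dη ds]
  have d1 := px_diff η2'
  have d2 := py_diff η2'
  have d3 := px_diff s2
  have d4 := py_diff s2
  have Lw : ∀ z, px (px w) z + py (py w) z = η z * (px (px s) z + py (py s) z) + 2 * (px η z * px s z + py η z * py s z) + s z * (px (px η) z + py (py η) z) := by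
    intro z
    rw [p1, p2, px_add (by fun_prop) (by fun_prop), py_add (by fun_prop) (by fun_prop), px_mul d1 ds, px_mul dη d3, py_mul d2 ds, py_mul dη d4]; ring
  set Λ : Euc 2 → ℝ := fun z => px (px w) z + py (py w) z with hΛ
  have Λ0 : ∀ z, 2 < ‖z - y‖ → Λ z = 0 := by
    intro z hz
    have nb : ∀ᶠ x in 𝓝 z, 2 < ‖x - y‖ := (isOpen_lt continuous_const (by fun_prop)).mem_nhds hz
    have wz : w =ᶠ[𝓝 z] fun _ => 0 := by
      filter_upwards [nb] with x hx
      change eta 1 (x - y) * s x = 0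
      rw [eta_zero one_pos (by linarith), zero_mul]
    have e1 : px w =ᶠ[𝓝 z] fun _ => 0 := by
      filter_upwards [wz.eventually_nhds] with x hx
      exact px_zero_of_eventually hx
    have e2 : py w =ᶠ[𝓝 z] fun _ => 0 := by
      filter_upwards [wz.eventually_nhds] with x hx
      exact py_zero_of_eventually hx
    rw [hΛ]; simp only
    rw [px_zero_of_eventually e1, py_zero_of_eventually e2, add_zero]
  have Λb : ∀ z, Λ z ^ 2 ≤ Set.indicator (extS (R - 2)) (fun z => 180 * K ^ 2 * XX s φ z) z := by
    intro z
    by_cases hz : 2 < ‖z - y‖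
    · rw [Λ0 z hz]
      have : 0 ≤ Set.indicator (extS (R - 2)) (fun z => 180 * K ^ 2 * XX s φ z) z :=
        Set.indicator_nonneg (fun z _ => by have := XX_nonneg s φ z; positivity) z
      simpa using this
    · push Not at hz
      have hz2 : R - 2 ≤ ‖z‖ := by
        have := norm_sub_norm_le y z
        rw [norm_sub_rev] at this; linarith
      rw [Set.indicator_of_mem (show z ∈ extS (R - 2) from hz2)]
      obtain ⟨q1, q2, q3, q4, q5, q6⟩ := hr z (by linarith)
      have hL := lap_s_bound hc h.c_lt q1 (by linarith) (by linarith) (by linarith) (by linarith) (h.eq1 z (by linarith))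
      rw [hΛ]; simp only; rw [Lw]
      exact cut_alg hK (η0 z) (bx z) (bY z) ((abs_add_le _ _).trans (by linarith [bxx z, byy z])) hL
  have Λc : Continuous Λ := (px_cont (px_contDiff w2)).add (py_cont (py_contDiff w2))
  have Λs : HasCompactSupport Λ := (px_compact (px_compact wc)).add (py_compact (py_compact wc))
  have iΛ : Integrable (fun z => Λ z ^ 2) := by
    apply Continuous.integrable_of_hasCompactSupport (by fun_prop)
    have : (fun z => Λ z ^ 2) = fun z => Λ z * Λ z := by funext z; ring
    rw [this]; exact Λs.mul_right
  have iX : Integrable (Set.indicator (extS (R - 2)) (fun z => 180 * K ^ 2 * XX s φ z)) :=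
    (h.int.const_mul _).indicator (extS_meas _)
  have IΛ : ∫ z, Λ z ^ 2 ≤ 720 * K ^ 2 * C1 / R ^ 2 := by
    calc _ ≤ ∫ z, Set.indicator (extS (R - 2)) (fun z => 180 * K ^ 2 * XX s φ z) z := integral_mono iΛ iX Λb
      _ = 180 * K ^ 2 * EE s φ (R - 2) := by
        rw [integral_indicator (extS_meas _), integral_const_mul]; rfl
      _ ≤ 180 * K ^ 2 * (C1 / (R - 2) ^ 2) := by gcongr; exact ed _ (by linarith)
      _ ≤ 180 * K ^ 2 * (C1 / (R / 2) ^ 2) := by gcongr; linarith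
      _ = _ := by field_simp; norm_num
  have ne : ∀ᵐ z : Euc 2, z ≠ y := by
    have : (volume : Measure (Euc 2)) {y} = 0 := measure_singleton y
    exact compl_mem_ae_iff.2 this
  have iJ : Integrable (fun z => JJ (z - y)) := JJ_int.comp_sub_right y
  have main : |∫ z, ψ z * Λ z| ≤ ε * J + R * ∫ z, Λ z ^ 2 := by
    have j1 : Integrable (fun z => ε * JJ (z - y)) := iJ.const_mul _
    have j2 : Integrable (fun z => R * Λ z ^ 2) := iΛ.const_mul _
    have e : ε * J + R * ∫ z, Λ z ^ 2 = ∫ z, (ε * JJ (z - y) + R * Λ z ^ 2) := by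
      rw [integral_add j1 j2, integral_const_mul, integral_const_mul, integral_sub_right_eq_self (μ := (volume : Measure (Euc 2))) JJ y]
    rw [e, ← Real.norm_eq_abs]
    apply norm_integral_le_of_norm_le (j1.add j2)
    filter_upwards [ne] with z hz
    by_cases hz2 : 2 < ‖z - y‖
    · rw [Λ0 z hz2, mul_zero, norm_zero]
      have := JJ_nonneg (z - y)
      simp; positivity
    · push Not at hz2
      have gs := Gam_sq hε hε1 (sub_ne_zero.2 hz) hz2
      change ψ z ^ 2 ≤ _ at gs
      rw [Real.norm_eq_abs]
      have am : |ψ z * Λ z| ≤ ε * ψ z ^ 2 + R * Λ z ^ 2 := by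
        rw [abs_mul, ← sq_abs (ψ z), ← sq_abs (Λ z), ← sub_nonneg]
        have : ε * |ψ z| ^ 2 + R * |Λ z| ^ 2 - |ψ z| * |Λ z| = ε * (|ψ z| ^ 2 + (R * |Λ z|) ^ 2 - |ψ z| * (R * |Λ z|)) := by
          rw [hεd]; field_simp
        rw [this]
        apply mul_nonneg hε.le
        nlinarith [sq_nonneg (|ψ z| - R * |Λ z|), sq_nonneg (|ψ z|), sq_nonneg (R * |Λ z|)]
      calc _ ≤ _ := am
        _ ≤ ε * JJ (z - y) + R * Λ z ^ 2 := by
          have := mul_le_mul_of_nonneg_left gs hε.le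
          linarith
  have R3 : R * ∫ z, Λ z ^ 2 ≤ 720 * K ^ 2 * C1 / R := by
    calc _ ≤ R * (720 * K ^ 2 * C1 / R ^ 2) := by gcongr
      _ = _ := by field_simp
  have fin : |s y * M| ≤ ((L + 2 * K * A) * I + J + 720 * K ^ 2 * C1 + 1) / R := by
    have e : ((L + 2 * K * A) * I + J + 720 * K ^ 2 * C1 + 1) / R = ε * ((L + 2 * K * A) * I) + ε * J + 720 * K ^ 2 * C1 / R + ε := by
      rw [hεd]; ring
    rw [e]
    rw [abs_le] at ap main ⊢
    constructor <;> linarith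
  rw [abs_mul, abs_of_pos hM] at fin
  rw [div_right_comm, le_div_iff₀ hM]; exact fin

lemma shiftx (G : Euc 2 → ℝ) (hG : Differentiable ℝ G) (p v : Euc 2) (t : ℝ) :
    HasDerivAt (fun t : ℝ => G (p + t • v)) (fderiv ℝ G (p + t • v) v) t := by
  have h1 : HasDerivAt (fun t : ℝ => p + t • v) v t := by
    simpa using ((hasDerivAt_id t).smul_const v).const_add p
  exact (hG (p + t • v)).hasFDerivAt.comp_hasDerivAt t h1

lemma second_test (G : Euc 2 → ℝ) (hG : ContDiff ℝ 2 G) (p v : Euc 2) (hp : IsLocalMax G p) :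
    fderiv ℝ (fun y => fderiv ℝ G y v) p v ≤ 0 := by
  by_contra hcon
  push Not at hcon
  have hd : Differentiable ℝ (fun y => fderiv ℝ G y v) :=
    ((hG.fderiv_right (m := 1) (by norm_num)).clm_apply contDiff_const).differentiable (by norm_num)
  set h : ℝ → ℝ := fun t => G (p + t • v) with hh
  have d1 : deriv h = fun t => fderiv ℝ G (p + t • v) v := by
    funext t; exact (shiftx G (hG.differentiable (by norm_num)) p v t).deriv
  have d2 : deriv (deriv h) 0 = fderiv ℝ (fun y => fderiv ℝ G y v) p v := by
    rw [d1, (shiftx (fun y => fderiv ℝ G y v) hd p v 0).deriv]; simp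
  have ct : Tendsto (fun t : ℝ => p + t • v) (𝓝 0) (𝓝 p) := by
    have : Continuous (fun t : ℝ => p + t • v) := by fun_prop
    simpa using this.tendsto 0
  have lm : IsLocalMax h 0 := by
    have := ct.eventually hp
    filter_upwards [this] with t ht
    simpa [hh] using ht
  have d0 : deriv h 0 = 0 := lm.deriv_eq_zero
  have lmin : IsLocalMin h 0 := isLocalMin_of_deriv_deriv_pos (by rw [d2]; exact hcon) d0
    (by rw [hh]; exact (shiftx G (hG.differentiable (by norm_num)) p v 0).continuousAt)
  have ev : h =ᶠ[𝓝 0] fun _ => h 0 := by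
    filter_upwards [lm, lmin] with t a b using le_antisymm a b
  have : deriv (deriv h) 0 = 0 := by
    rw [ev.deriv.deriv_eq]; simp
  rw [d2] at this; linarith

/-- comparison on a half square, for functions vanishing on `x=0` -/
lemma box_cmp {g : Euc 2 → ℝ} (hg : ContDiff ℝ 2 g) {d M N : ℝ} (hd : 0 < d) (hM : 0 ≤ M) (hN : 0 ≤ N)
    (h0 : ∀ z : Euc 2, z 0 = 0 → g z = 0)
    (hb : ∀ z : Euc 2, |z 0| ≤ d → |z 1| ≤ d → g z ≤ M)
    (hl : ∀ z : Euc 2, |z 0| ≤ d → |z 1| ≤ d → -N ≤ px (px g) z + py (py g) z) :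
    px g 0 ≤ 2 * M / d + (N + 1) * d / 2 := by
  set m : ℝ := M / d ^ 2 with hm
  have m0 : 0 ≤ m := by positivity
  have mM : m * d ^ 2 = M := by rw [hm]; field_simp
  set B : Euc 2 → ℝ := fun z => m * (z 1 * z 1 + z 0 * (2 * d - z 0)) + (N + 1) / 2 * (z 0 * (d - z 0)) with hB
  have B2 : ContDiff ℝ 2 B := by
    have := coord_contDiff (n := 2) 0
    have := coord_contDiff (n := 2) 1
    rw [hB]; fun_prop
  have c0 := coord_diff 0
  have c1 := coord_diff 1
  have pB : px B = fun z => m * (2 * d - 2 * z 0) + (N + 1) / 2 * (d - 2 * z 0) := by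
    rw [hB, px_add, px_const_mul, px_const_mul, px_add, px_mul, px_mul, px_mul, px_sub, px_sub, px_const, px_const, px_c0, px_c1]
    · funext z; ring
    all_goals fun_prop
  have ppB : px (px B) = fun z => - 2 * m - (N + 1) := by
    rw [pB, px_add, px_const_mul, px_const_mul, px_sub, px_sub, px_const, px_const, px_const_mul, px_c0]
    · funext z; ring
    all_goals fun_prop
  have qB : py B = fun z => 2 * m * z 1 := by
    rw [hB, py_add, py_const_mul, py_const_mul, py_add, py_mul, py_mul, py_mul, py_sub, py_sub, py_const, py_const, py_c0, py_c1]
    · funext z; ring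
    all_goals fun_prop
  have qqB : py (py B) = fun z => 2 * m := by
    rw [qB, py_const_mul, py_c1]
    · funext z; ring
    all_goals fun_prop
  set G : Euc 2 → ℝ := fun z => g z - B z with hG
  have G2 : ContDiff ℝ 2 G := hg.sub B2
  set Q : Set (Euc 2) := {z | 0 ≤ z 0 ∧ z 0 ≤ d ∧ |z 1| ≤ d} with hQ
  have Qc : IsCompact Q := by
    apply Metric.isCompact_of_isClosed_isBounded
    · exact (isClosed_le continuous_const (coord_cont 0)).inter ((isClosed_le (coord_cont 0) continuous_const).inter (isClosed_le (coord_cont 1).abs continuous_const))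
    · refine (Metric.isBounded_closedBall (x := (0 : Euc 2)) (r := 2 * d)).subset ?_
      rintro z ⟨a, b, e⟩
      rw [mem_closedBall, dist_zero_right]
      apply le_of_sq_le_sq _ (by positivity)
      rw [norm_sq_eq, ← sq_abs (z 1)]
      have := abs_nonneg (z 1)
      nlinarith
  have Qn : (0 : Euc 2) ∈ Q := by simp [hQ, hd.le]
  obtain ⟨p, hpQ, hp⟩ := Qc.exists_isMaxOn ⟨0, Qn⟩ G2.continuous.continuousOn
  have key : G p ≤ 0 := by
    obtain ⟨a1, a2, a3⟩ := hpQ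
    have a0 : |p 0| ≤ d := by rw [abs_of_nonneg a1]; exact a2
    have gM := hb p a0 a3
    rcases a1.eq_or_lt with e | a1'
    · have := h0 p e.symm
      simp only [hG, hB, this, ← e]
      have : 0 ≤ m * (p 1 * p 1) := mul_nonneg m0 (mul_self_nonneg _)
      linarith
    rcases a2.eq_or_lt with e | a2'
    · simp only [hG, hB, e]
      have : 0 ≤ m * (p 1 * p 1) := mul_nonneg m0 (mul_self_nonneg _)
      nlinarith
    have t1 : 0 ≤ (N + 1) / 2 * (p 0 * (d - p 0)) := by
      have : 0 ≤ d - p 0 := by linarith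
      positivity
    rcases a3.eq_or_lt with e | a3'
    · have e2 : p 1 * p 1 = d ^ 2 := by rw [← e, sq_abs]; ring
      have : 0 ≤ m * (p 0 * (2 * d - p 0)) := by
        have : 0 ≤ 2 * d - p 0 := by linarith
        positivity
      simp only [hG, hB, e2]
      nlinarith
    exfalso
    have lm : IsLocalMax G p := by
      apply hp.isLocalMax
      have o : IsOpen {z : Euc 2 | 0 < z 0 ∧ z 0 < d ∧ |z 1| < d} := by
        have := coord_cont 0
        have := coord_cont 1
        exact (isOpen_lt continuous_const (coord_cont 0)).inter ((isOpen_lt (coord_cont 0) continuous_const).inter (isOpen_lt (coord_cont 1).abs continuous_const))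
      filter_upwards [o.mem_nhds (show p ∈ _ from ⟨a1', a2', a3'⟩)] with z hz
      exact ⟨hz.1.le, hz.2.1.le, hz.2.2.le⟩
    have s1 : px (px G) p ≤ 0 := second_test G G2 p (basisVec 0) lm
    have s2 : py (py G) p ≤ 0 := second_test G G2 p (basisVec 1) lm
    have dg := hg.differentiable (by norm_num)
    have dB := B2.differentiable (by norm_num)
    rw [hG, px_sub dg dB, px_sub (px_diff hg) (px_diff B2), ppB] at s1
    rw [hG, py_sub dg dB, py_sub (py_diff hg) (py_diff B2), qqB] at s2
    have := hl p a0 a3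
    simp only at s1 s2
    linarith
  have main : px G 0 ≤ 0 := by
    have hder := shiftx G (G2.differentiable (by norm_num)) 0 (basisVec 0) 0
    have e0 : fderiv ℝ G (0 + (0:ℝ) • basisVec 0) (basisVec 0) = px G 0 := by simp [px]
    rw [e0] at hder
    have hs := hder.hasDerivWithinAt (s := Set.Ioi 0)
    rw [hasDerivWithinAt_iff_tendsto_slope' (by simp)] at hs
    refine le_of_tendsto hs ?_
    have : Set.Ioo (0:ℝ) d ∈ 𝓝[>] (0:ℝ) := Ioo_mem_nhdsGT hd
    filter_upwards [this] with t ht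
    have hz : (t • (basisVec 0 : Euc 2)) ∈ Q := by
      simp only [hQ]
      refine ⟨?_, ?_, ?_⟩ <;> simp [basisVec, ht.1.le, ht.2.le, hd.le]
    have G0 : G 0 = 0 := by have := h0 0 (by simp); simp [hG, hB, this]
    have : G (t • basisVec 0) ≤ 0 := (hp hz).trans key
    simp only [slope, vsub_eq_sub, smul_eq_mul, zero_add, zero_smul, G0, sub_zero]
    exact mul_nonpos_of_nonneg_of_nonpos (inv_nonneg.2 ht.1.le) this
  have dg := hg.differentiable (by norm_num)
  have dB := B2.differentiable (by norm_num)
  rw [hG, px_sub dg dB, pB] at main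
  simp at main
  have : 2 * M / d = m * (2 * d) := by rw [hm]; field_simp
  rw [this]; linarith

lemma fderiv_aff {f : Euc 2 → ℝ} (hf : Differentiable ℝ f) (A : Euc 2 →L[ℝ] Euc 2) (y z v : Euc 2) :
    fderiv ℝ (fun z => f (y + A z)) z v = fderiv ℝ f (y + A z) (A v) := by
  have h1 : HasFDerivAt (fun z => y + A z) A z := A.hasFDerivAt.const_add y
  have := (hf (y + A z)).hasFDerivAt.comp z h1
  rw [show (fun z => f (y + A z)) = f ∘ (fun z => y + A z) from rfl, this.fderiv]; rfl

/-- reflection in the first coordinate -/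
def RR : Euc 2 →L[ℝ] Euc 2 :=
  ContinuousLinearMap.id ℝ (Euc 2) - ((2 : ℝ) • (EuclideanSpace.proj 0 : Euc 2 →L[ℝ] ℝ)).smulRight (basisVec 0)

/-- coordinate swap -/
def SS : Euc 2 →L[ℝ] Euc 2 :=
  (EuclideanSpace.proj 1 : Euc 2 →L[ℝ] ℝ).smulRight (basisVec 0) + (EuclideanSpace.proj 0 : Euc 2 →L[ℝ] ℝ).smulRight (basisVec 1)

lemma RR0 (z : Euc 2) : (RR z) 0 = - z 0 := by simp [RR, basisVec]; ring
lemma RR1 (z : Euc 2) : (RR z) 1 = z 1 := by simp [RR, basisVec]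
lemma SS0 (z : Euc 2) : (SS z) 0 = z 1 := by simp [SS, basisVec]
lemma SS1 (z : Euc 2) : (SS z) 1 = z 0 := by simp [SS, basisVec]
lemma RR_b0 : RR (basisVec 0) = - basisVec 0 := by
  ext i; fin_cases i <;> simp [RR, basisVec]; norm_num
lemma RR_b1 : RR (basisVec 1) = basisVec 1 := by
  ext i; fin_cases i <;> simp [RR, basisVec]
lemma SS_b0 : SS (basisVec 0) = basisVec 1 := by
  ext i; fin_cases i <;> simp [SS, basisVec]
lemma SS_b1 : SS (basisVec 1) = basisVec 0 := by
  ext i; fin_cases i <;> simp [SS, basisVec]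

lemma px_RR {f : Euc 2 → ℝ} (hf : Differentiable ℝ f) (y : Euc 2) :
    px (fun z => f (y + RR z)) = fun z => - px f (y + RR z) := by
  funext z; unfold px; rw [fderiv_aff hf, RR_b0, map_neg]
lemma py_RR {f : Euc 2 → ℝ} (hf : Differentiable ℝ f) (y : Euc 2) :
    py (fun z => f (y + RR z)) = fun z => py f (y + RR z) := by
  funext z; unfold py; rw [fderiv_aff hf, RR_b1]
lemma px_SS {f : Euc 2 → ℝ} (hf : Differentiable ℝ f) (y : Euc 2) :
    px (fun z => f (y + SS z)) = fun z => py f (y + SS z) := by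
  funext z; unfold px py; rw [fderiv_aff hf, SS_b0]
lemma py_SS {f : Euc 2 → ℝ} (hf : Differentiable ℝ f) (y : Euc 2) :
    py (fun z => f (y + SS z)) = fun z => px f (y + SS z) := by
  funext z; unfold px py; rw [fderiv_aff hf, SS_b1]
lemma px_tr {f : Euc 2 → ℝ} (hf : Differentiable ℝ f) (y : Euc 2) :
    px (fun z => f (y + z)) = fun z => px f (y + z) := by
  funext z; exact fderiv_aff hf (ContinuousLinearMap.id ℝ _) y z _
lemma py_tr {f : Euc 2 → ℝ} (hf : Differentiable ℝ f) (y : Euc 2) :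
    py (fun z => f (y + z)) = fun z => py f (y + z) := by
  funext z; exact fderiv_aff hf (ContinuousLinearMap.id ℝ _) y z _

lemma px_est1 {f : Euc 2 → ℝ} (hf : ContDiff ℝ 2 f) (y : Euc 2) {d M N : ℝ} (hd : 0 < d) (hM : 0 ≤ M) (hN : 0 ≤ N)
    (hb : ∀ z : Euc 2, ‖z‖ ≤ 2 * d → |f (y + z)| ≤ M)
    (hl : ∀ z : Euc 2, ‖z‖ ≤ 2 * d → |px (px f) (y + z) + py (py f) (y + z)| ≤ N) :
    px f y ≤ 2 * M / d + (N + 1) * d / 2 := by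
  have nrm : ∀ z : Euc 2, |z 0| ≤ d → |z 1| ≤ d → ‖z‖ ≤ 2 * d := by
    intro z a b
    apply le_of_sq_le_sq _ (by positivity)
    rw [norm_sq_eq, ← sq_abs (z 0), ← sq_abs (z 1)]
    have := abs_nonneg (z 0)
    have := abs_nonneg (z 1)
    nlinarith
  have df := hf.differentiable (by norm_num)
  have dpx := px_diff hf
  have dpy := py_diff hf
  have r1 : Differentiable ℝ (fun z => f (y + z)) := by fun_prop
  have r2 : Differentiable ℝ (fun z => f (y + RR z)) := by fun_prop
  have r3 : Differentiable ℝ (fun z => px f (y + z)) := by fun_prop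
  have r4 : Differentiable ℝ (fun z => px f (y + RR z)) := by fun_prop
  have r5 : Differentiable ℝ (fun z => py f (y + z)) := by fun_prop
  have r6 : Differentiable ℝ (fun z => py f (y + RR z)) := by fun_prop
  have gx : px (fun z => 1 / 2 * f (y + z) - 1 / 2 * f (y + RR z)) = fun z => 1 / 2 * px f (y + z) + 1 / 2 * px f (y + RR z) := by
    rw [px_sub (by fun_prop) (by fun_prop), px_const_mul _ r1, px_const_mul _ r2, px_tr df, px_RR df]
    funext z; ring
  have gy : py (fun z => 1 / 2 * f (y + z) - 1 / 2 * f (y + RR z)) = fun z => 1 / 2 * py f (y + z) - 1 / 2 * py f (y + RR z) := by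
    rw [py_sub (by fun_prop) (by fun_prop), py_const_mul _ r1, py_const_mul _ r2, py_tr df, py_RR df]
  have := box_cmp (g := fun z => 1 / 2 * f (y + z) - 1 / 2 * f (y + RR z)) (by fun_prop) hd hM hN ?_ ?_ ?_
  · rw [gx] at this
    simp at this
    linarith
  · intro z hz
    have : RR z = z := by
      ext i; fin_cases i
      · simpa [hz] using RR0 z
      · exact RR1 z
    rw [this]; ring
  · intro z a b
    have h1 := abs_le.1 (hb z (nrm z a b))
    have h2 := abs_le.1 (hb (RR z) (nrm _ (by rwa [RR0, abs_neg]) (by rwa [RR1])))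
    linarith
  · intro z a b
    have h1 := abs_le.1 (hl z (nrm z a b))
    have h2 := abs_le.1 (hl (RR z) (nrm _ (by rwa [RR0, abs_neg]) (by rwa [RR1])))
    rw [gx, gy, px_add (by fun_prop) (by fun_prop), py_sub (by fun_prop) (by fun_prop), px_const_mul _ r3, px_const_mul _ r4,
      py_const_mul _ r5, py_const_mul _ r6, px_tr dpx, px_RR dpx, py_tr dpy, py_RR dpy]
    simp only
    linarith

lemma px_est {f : Euc 2 → ℝ} (hf : ContDiff ℝ 2 f) (y : Euc 2) {d M N : ℝ} (hd : 0 < d) (hM : 0 ≤ M) (hN : 0 ≤ N)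
    (hb : ∀ z : Euc 2, ‖z‖ ≤ 2 * d → |f (y + z)| ≤ M)
    (hl : ∀ z : Euc 2, ‖z‖ ≤ 2 * d → |px (px f) (y + z) + py (py f) (y + z)| ≤ N) :
    |px f y| ≤ 2 * M / d + (N + 1) * d / 2 := by
  rw [abs_le]
  constructor
  · have df := hf.differentiable (by norm_num)
    have e1 : px (fun z => (-1) * f z) = fun z => (-1) * px f z := px_const_mul _ df
    have e2 : py (fun z => (-1) * f z) = fun z => (-1) * py f z := py_const_mul _ df
    have := px_est1 (f := fun z => (-1) * f z) (by fun_prop) y hd hM hN (fun z hz => by simpa using hb z hz)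
      (fun z hz => by
        rw [e1, e2, px_const_mul _ (px_diff hf), py_const_mul _ (py_diff hf), ← mul_add, abs_mul]
        simpa using hl z hz)
    rw [e1] at this
    linarith
  · exact px_est1 hf y hd hM hN hb hl

lemma SS_norm (z : Euc 2) : ‖SS z‖ = ‖z‖ := by
  have : ‖SS z‖ ^ 2 = ‖z‖ ^ 2 := by rw [norm_sq_eq, norm_sq_eq, SS0, SS1]; ring
  exact (pow_left_inj₀ (norm_nonneg _) (norm_nonneg _) (by norm_num)).1 this

lemma py_est {f : Euc 2 → ℝ} (hf : ContDiff ℝ 2 f) (y : Euc 2) {d M N : ℝ} (hd : 0 < d) (hM : 0 ≤ M) (hN : 0 ≤ N)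
    (hb : ∀ z : Euc 2, ‖z‖ ≤ 2 * d → |f (y + z)| ≤ M)
    (hl : ∀ z : Euc 2, ‖z‖ ≤ 2 * d → |px (px f) (y + z) + py (py f) (y + z)| ≤ N) :
    |py f y| ≤ 2 * M / d + (N + 1) * d / 2 := by
  have df := hf.differentiable (by norm_num)
  have e1 := px_SS df y
  have e2 := py_SS df y
  have := px_est (f := fun z => f (y + SS z)) (by fun_prop) 0 hd hM hN
    (fun z hz => by simpa using hb (SS z) (by rwa [SS_norm]))
    (fun z hz => by
      rw [e1, e2, px_SS (py_diff hf), py_SS (px_diff hf)]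
      have := hl (SS z) (by rwa [SS_norm])
      rw [add_comm] at this
      simpa using this)
  rw [e1] at this
  simpa using this

lemma re_fd {F : Euc 2 → ℂ} (h : Differentiable ℝ F) (y w : Euc 2) :
    fderiv ℝ (fun y => (F y).re) y w = (fderiv ℝ F y w).re := by
  have := (Complex.reCLM.hasFDerivAt (x := F y)).comp y (h y).hasFDerivAt
  rw [show (fun y => (F y).re) = Complex.reCLM ∘ F from rfl, this.fderiv]; rfl
lemma im_fd {F : Euc 2 → ℂ} (h : Differentiable ℝ F) (y w : Euc 2) :
    fderiv ℝ (fun y => (F y).im) y w = (fderiv ℝ F y w).im := by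
  have := (Complex.imCLM.hasFDerivAt (x := F y)).comp y (h y).hasFDerivAt
  rw [show (fun y => (F y).im) = Complex.imCLM ∘ F from rfl, this.fderiv]; rfl

lemma fd_diff {U : Euc 2 → ℂ} (hU : ContDiff ℝ 2 U) (w : Euc 2) : Differentiable ℝ (fun y => fderiv ℝ U y w) :=
  ((hU.fderiv_right (m := 1) (by norm_num)).clm_apply contDiff_const).differentiable (by norm_num)

lemma lap_re {U : Euc 2 → ℂ} (hU : ContDiff ℝ 2 U) (y : Euc 2) :
    (lap U y).re = px (px (fun y => (U y).re)) y + py (py (fun y => (U y).re)) y := by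
  have d := hU.differentiable (by norm_num)
  unfold lap px py
  simp only [re_fd d, re_fd (fd_diff hU _), Fin.sum_univ_two, Complex.add_re]
lemma lap_im {U : Euc 2 → ℂ} (hU : ContDiff ℝ 2 U) (y : Euc 2) :
    (lap U y).im = px (px (fun y => (U y).im)) y + py (py (fun y => (U y).im)) y := by
  have d := hU.differentiable (by norm_num)
  unfold lap px py
  simp only [im_fd d, im_fd (fd_diff hU _), Fin.sum_univ_two, Complex.add_im]

/-- real form of the equation -/
structure TWR (c : ℝ) (u v : Euc 2 → ℝ) : Prop where
  hu : ContDiff ℝ 2 u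
  hv : ContDiff ℝ 2 v
  eqA : ∀ y, px (px u) y + py (py u) y - c * py v y + u y * (1 - (u y ^ 2 + v y ^ 2)) = 0
  eqB : ∀ y, px (px v) y + py (py v) y + c * py u y + v y * (1 - (u y ^ 2 + v y ^ 2)) = 0

lemma TWR_of {c : ℝ} {U : Euc 2 → ℂ} (h : IsTravelingWave c U) :
    TWR c (fun y => (U y).re) (fun y => (U y).im) := by
  obtain ⟨h2, he⟩ := h
  have d := h2.differentiable (by norm_num)
  have nn : ∀ y, ((‖U y‖ : ℂ)) ^ 2 = (((U y).re ^ 2 + (U y).im ^ 2 : ℝ) : ℂ) := by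
    intro y
    rw [← Complex.ofReal_pow, Complex.sq_norm, Complex.normSq_apply]
    congr 1; ring
  refine ⟨Complex.reCLM.contDiff.comp h2, Complex.imCLM.contDiff.comp h2, fun y => ?_, fun y => ?_⟩
  · have e := congrArg Complex.re (he y)
    rw [nn, ← Complex.ofReal_one, ← Complex.ofReal_sub] at e
    simp only [Complex.add_re, lap_re h2, Complex.mul_re, Complex.I_re, Complex.I_im, Complex.ofReal_re, Complex.ofReal_im, Complex.mul_im, Complex.zero_re] at e
    have : py (fun y => (U y).im) y = (fderiv ℝ U y e2).im := im_fd d y _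
    rw [this]
    linarith
  · have e := congrArg Complex.im (he y)
    rw [nn, ← Complex.ofReal_one, ← Complex.ofReal_sub] at e
    simp only [Complex.add_im, lap_im h2, Complex.mul_re, Complex.I_re, Complex.I_im, Complex.ofReal_re, Complex.ofReal_im, Complex.mul_im, Complex.zero_im] at e
    have : py (fun y => (U y).re) y = (fderiv ℝ U y e2).re := re_fd d y _
    rw [this]
    linarith

/-- gauge transform: cosine and sine of `c y₂/2` -/
lemma gauge_lap {c : ℝ} {u v : Euc 2 → ℝ} (h : TWR c u v) (y : Euc 2) :
    px (px (fun y => Real.cos (c / 2 * y 1) * u y - Real.sin (c / 2 * y 1) * v y)) y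
      + py (py (fun y => Real.cos (c / 2 * y 1) * u y - Real.sin (c / 2 * y 1) * v y)) y
      = -(1 - (u y ^ 2 + v y ^ 2) + c ^ 2 / 4) * (Real.cos (c / 2 * y 1) * u y - Real.sin (c / 2 * y 1) * v y) := by
  have du := h.hu.differentiable (by norm_num)
  have dv := h.hv.differentiable (by norm_num)
  have d1 := px_diff h.hu
  have d2 := py_diff h.hu
  have d3 := px_diff h.hv
  have d4 := py_diff h.hv
  have c1 := coord_diff 1
  set C : Euc 2 → ℝ := fun y => Real.cos (c / 2 * y 1) with hC
  set S : Euc 2 → ℝ := fun y => Real.sin (c / 2 * y 1) with hS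
  have dC : Differentiable ℝ C := by rw [hC]; fun_prop
  have dS : Differentiable ℝ S := by rw [hS]; fun_prop
  have dl : Differentiable ℝ (fun y : Euc 2 => c / 2 * y 1) := by fun_prop
  have xl : px (fun y : Euc 2 => c / 2 * y 1) = fun _ => 0 := by rw [px_const_mul _ c1, px_c1]; simp
  have yl : py (fun y : Euc 2 => c / 2 * y 1) = fun _ => c / 2 := by rw [py_const_mul _ c1, py_c1]; simp
  have xC : px C = fun _ => 0 := by
    rw [hC, px_comp dl (h := Real.cos) (h' := fun t => - Real.sin t) (fun y => Real.hasDerivAt_cos _), xl]; simp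
  have xS : px S = fun _ => 0 := by
    rw [hS, px_comp dl (h := Real.sin) (h' := fun t => Real.cos t) (fun y => Real.hasDerivAt_sin _), xl]; simp
  have yC : py C = fun y => - (c / 2) * S y := by
    rw [hC, py_comp dl (h := Real.cos) (h' := fun t => - Real.sin t) (fun y => Real.hasDerivAt_cos _), yl]
    funext y; simp only [hS]; ring
  have yS : py S = fun y => (c / 2) * C y := by
    rw [hS, py_comp dl (h := Real.sin) (h' := fun t => Real.cos t) (fun y => Real.hasDerivAt_sin _), yl]
    funext y; simp only [hC]; ring
  have ex : px (fun y => C y * u y - S y * v y) = fun y => C y * px u y - S y * px v y := by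
    rw [px_sub (by fun_prop) (by fun_prop), px_mul dC du, px_mul dS dv, xC, xS]
    funext y; ring
  have ey : py (fun y => C y * u y - S y * v y) = fun y => C y * (py u y - c / 2 * v y) - S y * (py v y + c / 2 * u y) := by
    rw [py_sub (by fun_prop) (by fun_prop), py_mul dC du, py_mul dS dv, yC, yS]
    funext y; ring
  have e1 : px (px (fun y => C y * u y - S y * v y)) y = C y * px (px u) y - S y * px (px v) y := by
    rw [ex, px_sub (by fun_prop) (by fun_prop), px_mul dC d1, px_mul dS d3, xC, xS]
    ring
  have e2 : py (py (fun y => C y * u y - S y * v y)) y = C y * (py (py u) y - c * py v y - c ^ 2 / 4 * u y)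
      - S y * (py (py v) y + c * py u y - c ^ 2 / 4 * v y) := by
    rw [ey, py_sub (by fun_prop) (by fun_prop), py_mul dC (by fun_prop), py_mul dS (by fun_prop), py_sub (by fun_prop) (by fun_prop),
      py_add (by fun_prop) (by fun_prop), py_const_mul _ du, py_const_mul _ dv, yC, yS]
    ring
  rw [e1, e2]
  have hA := h.eqA y
  have hB := h.eqB y
  linear_combination C y * hA - S y * hB

lemma TWR.rot {c : ℝ} {u v : Euc 2 → ℝ} (h : TWR c u v) : TWR c (fun y => v y) (fun y => (-1) * u y) := by
  have du := h.hu.differentiable (by norm_num)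
  refine ⟨h.hv, contDiff_const.mul h.hu, fun y => ?_, fun y => ?_⟩
  · rw [py_const_mul _ du]
    have := h.eqB y
    simp only [neg_mul, one_mul, neg_sq] at this ⊢
    linear_combination this
  · rw [py_const_mul _ du, px_const_mul _ du, px_const_mul _ (px_diff h.hu), py_const_mul _ (py_diff h.hu)]
    have := h.eqA y
    simp only
    linear_combination (-1) * this

/-- bounded solutions have bounded gradient -/
lemma grad_bdd {c : ℝ} {u v : Euc 2 → ℝ} (h : TWR c u v) {K : ℝ} (hK : 0 < K) (bu : ∀ y, |u y| ≤ K) (bv : ∀ y, |v y| ≤ K) :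
    ∃ A > (0:ℝ), ∀ y, |py u y| ≤ A ∧ |py v y| ≤ A := by
  have du := h.hu.differentiable (by norm_num)
  have dv := h.hv.differentiable (by norm_num)
  have gau : ∀ u v : Euc 2 → ℝ, TWR c u v → (∀ y, |u y| ≤ K) → (∀ y, |v y| ≤ K) → ∀ y,
      |py (fun y => Real.cos (c / 2 * y 1) * u y - Real.sin (c / 2 * y 1) * v y) y|
        ≤ 2 * (2 * K) / 1 + ((1 + 2 * K ^ 2 + c ^ 2 / 4) * (2 * K) + 1) * 1 / 2 := by
    intro u v h bu bv y
    have hu := h.hu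
    have hv := h.hv
    have := coord_contDiff (n := 2) 1
    have bb : ∀ y : Euc 2, |Real.cos (c / 2 * y 1) * u y - Real.sin (c / 2 * y 1) * v y| ≤ 2 * K := by
      intro y
      have a1 : |Real.cos (c / 2 * y 1) * u y| ≤ K := by
        rw [abs_mul]
        calc _ ≤ 1 * K := mul_le_mul (Real.abs_cos_le_one _) (bu y) (abs_nonneg _) (by norm_num)
          _ = K := one_mul _
      have a2 : |Real.sin (c / 2 * y 1) * v y| ≤ K := by
        rw [abs_mul]
        calc _ ≤ 1 * K := mul_le_mul (Real.abs_sin_le_one _) (bv y) (abs_nonneg _) (by norm_num)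
          _ = K := one_mul _
      have := abs_sub (Real.cos (c / 2 * y 1) * u y) (Real.sin (c / 2 * y 1) * v y)
      linarith
    apply py_est (by fun_prop) y one_pos (by positivity) (by positivity)
    · intro z _; exact bb _
    · intro z _
      rw [gauge_lap h, abs_mul, abs_neg]
      apply mul_le_mul _ (bb _) (abs_nonneg _) (by positivity)
      have q1 : u (y + z) ^ 2 ≤ K ^ 2 := by rw [← sq_abs]; exact pow_le_pow_left₀ (abs_nonneg _) (bu _) 2
      have q2 : v (y + z) ^ 2 ≤ K ^ 2 := by rw [← sq_abs]; exact pow_le_pow_left₀ (abs_nonneg _) (bv _) 2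
      rw [abs_le]
      constructor <;> nlinarith [sq_nonneg (u (y + z)), sq_nonneg (v (y + z)), sq_nonneg c]
  set A := 2 * (2 * K) / 1 + ((1 + 2 * K ^ 2 + c ^ 2 / 4) * (2 * K) + 1) * 1 / 2 with hA
  have A0 : 0 < A := by positivity
  have c1 := coord_diff 1
  set C : Euc 2 → ℝ := fun y => Real.cos (c / 2 * y 1) with hC
  set S : Euc 2 → ℝ := fun y => Real.sin (c / 2 * y 1) with hS
  have dC : Differentiable ℝ C := by rw [hC]; fun_prop
  have dS : Differentiable ℝ S := by rw [hS]; fun_prop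
  have dl : Differentiable ℝ (fun y : Euc 2 => c / 2 * y 1) := by fun_prop
  have yl : py (fun y : Euc 2 => c / 2 * y 1) = fun _ => c / 2 := by rw [py_const_mul _ c1, py_c1]; simp
  have yC : py C = fun y => - (c / 2) * S y := by
    rw [hC, py_comp dl (h := Real.cos) (h' := fun t => - Real.sin t) (fun y => Real.hasDerivAt_cos _), yl]
    funext y; simp only [hS]; ring
  have yS : py S = fun y => (c / 2) * C y := by
    rw [hS, py_comp dl (h := Real.sin) (h' := fun t => Real.cos t) (fun y => Real.hasDerivAt_sin _), yl]
    funext y; simp only [hC]; ring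
  have g1 := gau u v h bu bv
  have g2 := gau (fun y => v y) (fun y => (-1) * u y) h.rot bv (fun y => by simpa using bu y)
  have ey1 : py (fun y => C y * u y - S y * v y) = fun y => C y * (py u y - c / 2 * v y) - S y * (py v y + c / 2 * u y) := by
    rw [py_sub (by fun_prop) (by fun_prop), py_mul dC du, py_mul dS dv, yC, yS]
    funext y; ring
  have ey2 : py (fun y => C y * v y - S y * ((-1) * u y)) = fun y => C y * (py v y + c / 2 * u y) + S y * (py u y - c / 2 * v y) := by
    rw [py_sub (by fun_prop) (by fun_prop), py_mul dC dv, py_mul dS (by fun_prop), py_const_mul _ du, yC, yS]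
    funext y; ring
  refine ⟨2 * A + |c| / 2 * K, by positivity, fun y => ?_⟩
  have k1 := g1 y
  have k2 := g2 y
  change |py (fun y => C y * u y - S y * v y) y| ≤ A at k1
  change |py (fun y => C y * v y - S y * ((-1) * u y)) y| ≤ A at k2
  rw [ey1] at k1
  rw [ey2] at k2
  simp only at k1 k2
  set a := C y * (py u y - c / 2 * v y) - S y * (py v y + c / 2 * u y) with ha
  set b := C y * (py v y + c / 2 * u y) + S y * (py u y - c / 2 * v y) with hb
  have cs : C y ^ 2 + S y ^ 2 = 1 := by simp [hC, hS]
  have aC : |C y| ≤ 1 := Real.abs_cos_le_one _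
  have aS : |S y| ≤ 1 := Real.abs_sin_le_one _
  have m : ∀ p q r : ℝ, |p| ≤ 1 → |q| ≤ r → |p * q| ≤ r := by
    intro p q r hp hq
    rw [abs_mul]; nlinarith [abs_nonneg p, abs_nonneg q]
  have w1 : |c / 2 * v y| ≤ |c| / 2 * K := by
    rw [abs_mul, abs_div, abs_two]; exact mul_le_mul_of_nonneg_left (bv y) (by positivity)
  have w2 : |c / 2 * u y| ≤ |c| / 2 * K := by
    rw [abs_mul, abs_div, abs_two]; exact mul_le_mul_of_nonneg_left (bu y) (by positivity)
  have eu : py u y = C y * a + S y * b + c / 2 * v y := by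
    rw [ha, hb]; linear_combination (-(py u y - c / 2 * v y)) * cs
  have ev : py v y = C y * b - S y * a - c / 2 * u y := by
    rw [ha, hb]; linear_combination (-(py v y + c / 2 * u y)) * cs
  have m1 := abs_le.1 (m _ _ _ aC k1)
  have m2 := abs_le.1 (m _ _ _ aS k2)
  have m3 := abs_le.1 (m _ _ _ aC k2)
  have m4 := abs_le.1 (m _ _ _ aS k1)
  have w1' := abs_le.1 w1
  have w2' := abs_le.1 w2
  constructor
  · rw [eu, abs_le]; constructor <;> linarith
  · rw [ev, abs_le]; constructor <;> linarith

/-- gradient tends to zero -/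
lemma grad_small {f : Euc 2 → ℝ} (hf : ContDiff ℝ 2 f) {N : ℝ} (hN : 0 ≤ N)
    (hl : ∀ y, |px (px f) y + py (py f) y| ≤ N) (h0 : ∀ ε > (0:ℝ), ∃ R, ∀ y, R ≤ ‖y‖ → |f y| ≤ ε) :
    ∀ ε > (0:ℝ), ∃ R, ∀ y, R ≤ ‖y‖ → |px f y| ≤ ε ∧ |py f y| ≤ ε := by
  intro ε hε
  set δ : ℝ := ε / (N + 4) with hδ
  have δ0 : 0 < δ := by positivity
  obtain ⟨R, hR⟩ := h0 (δ ^ 2) (by positivity)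
  refine ⟨R + 2 * δ, fun y hy => ?_⟩
  have b : ∀ z : Euc 2, ‖z‖ ≤ 2 * δ → |f (y + z)| ≤ δ ^ 2 := by
    intro z hz
    apply hR
    have : ‖y‖ ≤ ‖y + z‖ + ‖z‖ := by
      have := norm_sub_le (y + z) z
      simpa using this
    linarith
  have e : 2 * δ ^ 2 / δ + (N + 1) * δ / 2 ≤ ε := by
    have : 2 * δ ^ 2 / δ = 2 * δ := by field_simp
    have e2 : (N + 4) * δ = ε := by rw [hδ]; field_simp
    rw [this]; nlinarith
  exact ⟨(px_est hf y δ0 (by positivity) hN b (fun z _ => hl _)).trans e,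
    (py_est hf y δ0 (by positivity) hN b (fun z _ => hl _)).trans e⟩

lemma px_congr {f g : Euc 2 → ℝ} {r : ℝ} (h : ∀ y, r < ‖y‖ → f y = g y) : ∀ y, r < ‖y‖ → px f y = px g y := by
  intro y hy
  have : f =ᶠ[𝓝 y] g := by
    filter_upwards [(isOpen_lt continuous_const continuous_norm).mem_nhds hy] with z hz using h z hz
  unfold px; rw [this.fderiv_eq]
lemma py_congr {f g : Euc 2 → ℝ} {r : ℝ} (h : ∀ y, r < ‖y‖ → f y = g y) : ∀ y, r < ‖y‖ → py f y = py g y := by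
  intro y hy
  have : f =ᶠ[𝓝 y] g := by
    filter_upwards [(isOpen_lt continuous_const continuous_norm).mem_nhds hy] with z hz using h z hz
  unfold py; rw [this.fderiv_eq]

lemma polar {c r : ℝ} {u v s φ : Euc 2 → ℝ} (h : TWR c u v) (hs : ContDiff ℝ 2 s) (hφ : ContDiff ℝ 2 φ)
    (eu : ∀ y, r < ‖y‖ → u y = Real.exp (s y) * Real.cos (φ y))
    (ev : ∀ y, r < ‖y‖ → v y = Real.exp (s y) * Real.sin (φ y)) (y : Euc 2) (hy : r < ‖y‖) :
    (px (px s) y + py (py s) y + px s y ^ 2 + py s y ^ 2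
      - px φ y ^ 2 - py φ y ^ 2 - c * py φ y + 1 - Real.exp (2 * s y) = 0) ∧
    (px (px φ) y + py (py φ) y + 2 * (px s y * px φ y + py s y * py φ y) + c * py s y = 0) ∧
    (px u y ^ 2 + px v y ^ 2 = (px s y ^ 2 + px φ y ^ 2) * Real.exp (2 * s y)) ∧
    (py u y ^ 2 + py v y ^ 2 = (py s y ^ 2 + py φ y ^ 2) * Real.exp (2 * s y)) := by
  have ds := hs.differentiable (by norm_num)
  have dφ := hφ.differentiable (by norm_num)
  have s1 := px_diff hs
  have s2 := py_diff hs
  have p1 := px_diff hφ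
  have p2 := py_diff hφ
  set a : Euc 2 → ℝ := fun y => Real.exp (s y) * Real.cos (φ y) with ha
  set b : Euc 2 → ℝ := fun y => Real.exp (s y) * Real.sin (φ y) with hb
  have dE : Differentiable ℝ (fun y => Real.exp (s y)) := by fun_prop
  have dC : Differentiable ℝ (fun y => Real.cos (φ y)) := by fun_prop
  have dS : Differentiable ℝ (fun y => Real.sin (φ y)) := by fun_prop
  have da : Differentiable ℝ a := by rw [ha]; fun_prop
  have db : Differentiable ℝ b := by rw [hb]; fun_prop
  have ax : px a = fun y => px s y * a y - px φ y * b y := by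
    rw [ha, px_mul dE dC, px_comp ds (h := Real.exp) (h' := Real.exp) (fun y => Real.hasDerivAt_exp _),
      px_comp dφ (h := Real.cos) (h' := fun t => - Real.sin t) (fun y => Real.hasDerivAt_cos _)]
    funext y; simp only [hb]; ring
  have bx : px b = fun y => px s y * b y + px φ y * a y := by
    rw [hb, px_mul dE dS, px_comp ds (h := Real.exp) (h' := Real.exp) (fun y => Real.hasDerivAt_exp _),
      px_comp dφ (h := Real.sin) (h' := fun t => Real.cos t) (fun y => Real.hasDerivAt_sin _)]
    funext y; simp only [ha]; ring
  have ay : py a = fun y => py s y * a y - py φ y * b y := by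
    rw [ha, py_mul dE dC, py_comp ds (h := Real.exp) (h' := Real.exp) (fun y => Real.hasDerivAt_exp _),
      py_comp dφ (h := Real.cos) (h' := fun t => - Real.sin t) (fun y => Real.hasDerivAt_cos _)]
    funext y; simp only [hb]; ring
  have bby : py b = fun y => py s y * b y + py φ y * a y := by
    rw [hb, py_mul dE dS, py_comp ds (h := Real.exp) (h' := Real.exp) (fun y => Real.hasDerivAt_exp _),
      py_comp dφ (h := Real.sin) (h' := fun t => Real.cos t) (fun y => Real.hasDerivAt_sin _)]
    funext y; simp only [ha]; ring
  have axx : px (px a) = fun y => px (px s) y * a y + px s y * (px s y * a y - px φ y * b y) - (px (px φ) y * b y + px φ y * (px s y * b y + px φ y * a y)) := by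
    conv_lhs => rw [ax]
    rw [px_sub (by fun_prop) (by fun_prop), px_mul s1 da, px_mul p1 db, ax, bx]
  have bxx : px (px b) = fun y => px (px s) y * b y + px s y * (px s y * b y + px φ y * a y) + (px (px φ) y * a y + px φ y * (px s y * a y - px φ y * b y)) := by
    conv_lhs => rw [bx]
    rw [px_add (by fun_prop) (by fun_prop), px_mul s1 db, px_mul p1 da, ax, bx]
  have ayy : py (py a) = fun y => py (py s) y * a y + py s y * (py s y * a y - py φ y * b y) - (py (py φ) y * b y + py φ y * (py s y * b y + py φ y * a y)) := by
    conv_lhs => rw [ay]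
    rw [py_sub (by fun_prop) (by fun_prop), py_mul s2 da, py_mul p2 db, ay, bby]
  have byy : py (py b) = fun y => py (py s) y * b y + py s y * (py s y * b y + py φ y * a y) + (py (py φ) y * a y + py φ y * (py s y * a y - py φ y * b y)) := by
    conv_lhs => rw [bby]
    rw [py_add (by fun_prop) (by fun_prop), py_mul s2 db, py_mul p2 da, ay, bby]
  have hA := h.eqA y
  have hB := h.eqB y
  rw [px_congr (px_congr eu) y hy, py_congr (py_congr eu) y hy, py_congr ev y hy, eu y hy, ev y hy, axx, ayy, bby] at hA
  rw [px_congr (px_congr ev) y hy, py_congr (py_congr ev) y hy, py_congr eu y hy, eu y hy, ev y hy, bxx, byy, ay] at hB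
  rw [px_congr eu y hy, px_congr ev y hy, py_congr eu y hy, py_congr ev y hy, ax, bx, ay, bby]
  change _ + a y * (1 - (a y ^ 2 + b y ^ 2)) = 0 at hA
  change _ + b y * (1 - (a y ^ 2 + b y ^ 2)) = 0 at hB
  have E2 : a y ^ 2 + b y ^ 2 = Real.exp (2 * s y) := by
    simp only [ha, hb]
    rw [mul_pow, mul_pow, ← mul_add, Real.cos_sq_add_sin_sq, mul_one, ← Real.exp_nat_mul]; norm_num
  have E0 : Real.exp (2 * s y) ≠ 0 := (Real.exp_pos _).ne'
  rw [← E2] at E0 ⊢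
  refine ⟨?_, ?_, ?_, ?_⟩
  · refine (mul_eq_zero.1 ?_).resolve_left E0
    simp only at hA hB
    linear_combination a y * hA + b y * hB
  · refine (mul_eq_zero.1 ?_).resolve_left E0
    simp only at hA hB
    linear_combination a y * hB - b y * hA
  · ring
  · ring

lemma tw_lift {U : Euc 2 → ℂ} (h2 : ContDiff ℝ 2 U) {R : ℝ} (hR : 0 < R) (hU : ∀ y, R ≤ ‖y‖ → ‖U y - 1‖ ≤ 1 / 2) :
    ContDiff ℝ 2 (fun y => ((1 - eta R y : ℝ) : ℂ) * Complex.log (U y)) := by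
  rw [contDiff_iff_contDiffAt]
  intro y
  by_cases hy : R ≤ ‖y‖
  · have sl : U y ∈ Complex.slitPlane := by
      left
      have := (Complex.abs_re_le_norm (U y - 1)).trans (hU y hy)
      rw [Complex.sub_re, Complex.one_re, abs_le] at this
      linarith [this.1]
    have l : ContDiffAt ℝ 2 (fun y => Complex.log (U y)) y :=
      ((Complex.contDiffAt_log sl).restrict_scalars ℝ).comp y h2.contDiffAt
    have e : ContDiff ℝ 2 (fun y => ((1 - eta R y : ℝ) : ℂ)) :=
      Complex.ofRealCLM.contDiff.comp (contDiff_const.sub (contDiff_infty.1 (eta_contDiff R) 2))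
    exact e.contDiffAt.mul l
  · push Not at hy
    have : (fun y => ((1 - eta R y : ℝ) : ℂ) * Complex.log (U y)) =ᶠ[𝓝 y] fun _ => 0 := by
      filter_upwards [(isOpen_lt continuous_norm continuous_const).mem_nhds hy] with z hz
      rw [eta_one hR (le_of_lt hz)]; simp
    exact contDiffAt_const.congr_of_eventuallyEq this

lemma far_of_tendsto {F : Euc 2 → ℂ} {l : ℂ} (h : Tendsto F (cocompact (Euc 2)) (𝓝 l)) :
    ∀ ε > (0:ℝ), ∃ R, ∀ y, R ≤ ‖y‖ → ‖F y - l‖ ≤ ε := by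
  intro ε hε
  have := h.eventually (Metric.closedBall_mem_nhds l hε)
  rw [← Metric.cobounded_eq_cocompact, ← comap_norm_atTop, eventually_comap] at this
  obtain ⟨R, hR⟩ := eventually_atTop.1 this
  exact ⟨R, fun y hy => by simpa [dist_eq_norm] using hR _ hy y rfl⟩

lemma int_energy {U : Euc 2 → ℂ} (h2 : ContDiff ℝ 2 U) (hE : glEnergy U < ⊤) :
    Integrable (fun y => ‖fderiv ℝ U y‖ ^ 2 / 2 + (1 - ‖U y‖ ^ 2) ^ 2 / 4) := by
  have c1 : Continuous (fun y => fderiv ℝ U y) := h2.continuous_fderiv (by norm_num)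
  have c2 := h2.continuous
  refine ⟨(by fun_prop : Continuous _).aestronglyMeasurable, ?_⟩
  rw [hasFiniteIntegral_iff_ofReal (Eventually.of_forall fun y => by positivity)]
  refine lt_of_le_of_lt (le_of_eq ?_) hE
  unfold glEnergy
  apply lintegral_congr
  intro y
  rw [ENNReal.ofReal_add (by positivity) (by positivity), ENNReal.ofReal_div_of_pos (by norm_num), ENNReal.ofReal_div_of_pos (by norm_num),
    ENNReal.ofReal_pow (norm_nonneg _), ← sq_abs (1 - ‖U y‖ ^ 2), ENNReal.ofReal_pow (abs_nonneg _)]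
  congr 3
  · exact ofReal_norm _
  · norm_num
  · congr 1
    rw [← Real.norm_eq_abs]; exact ofReal_norm _
  · norm_num

lemma s_sq_le {t : ℝ} (ht : |t| ≤ 1 / 2) : t ^ 2 ≤ (1 - Real.exp (2 * t)) ^ 2 := by
  obtain ⟨h1, h2⟩ := abs_le.1 ht
  rw [sq_le_sq]
  rcases le_total 0 t with h | h
  · rw [abs_of_nonneg h]
    have := Real.add_one_le_exp (2 * t)
    rw [abs_of_nonpos (by linarith)]; linarith
  · rw [abs_of_nonpos h]
    have := Real.add_one_le_exp (-(2 * t))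
    have e : Real.exp (2 * t) * Real.exp (-(2 * t)) = 1 := by rw [← Real.exp_add]; simp
    have p := Real.exp_pos (2 * t)
    have : Real.exp (2 * t) * (1 - 2 * t) ≤ 1 := by nlinarith
    have : Real.exp (2 * t) ≤ 1 + t := by
      by_contra hc
      push Not at hc
      nlinarith
    rw [abs_of_nonneg (by linarith)]; linarith

lemma TW_exists {c : ℝ} (hc1 : 0 < c) (hc2 : c < Real.sqrt 2) {U : Euc 2 → ℂ} (hTW : IsTravelingWave c U) (hE : glEnergy U < ⊤)
    (hlim : Tendsto U (Filter.cocompact (Euc 2)) (nhds 1)) :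
    ∃ (R0 : ℝ) (s φ : Euc 2 → ℝ), TW c R0 s φ ∧ ∀ y, R0 ≤ ‖y‖ → U y = Complex.exp (⟨s y, φ y⟩ : ℂ) := by
  have h2 := hTW.1
  have hR := TWR_of hTW
  set u : Euc 2 → ℝ := fun y => (U y).re with hu
  set v : Euc 2 → ℝ := fun y => (U y).im with hv
  have far := far_of_tendsto hlim
  have far1 : ∀ ε > (0:ℝ), ∃ R, ∀ y, R ≤ ‖y‖ → |u y - 1| ≤ ε := by
    intro ε hε
    obtain ⟨R, h⟩ := far ε hε
    exact ⟨R, fun y hy => by simpa [hu] using (Complex.abs_re_le_norm (U y - 1)).trans (h y hy)⟩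
  have far2 : ∀ ε > (0:ℝ), ∃ R, ∀ y, R ≤ ‖y‖ → |v y| ≤ ε := by
    intro ε hε
    obtain ⟨R, h⟩ := far ε hε
    exact ⟨R, fun y hy => by simpa [hv] using (Complex.abs_im_le_norm (U y - 1)).trans (h y hy)⟩
  -- uniform bounds
  obtain ⟨K1, K1p, hK1⟩ : ∃ A > (0:ℝ), ∀ y, |u y| ≤ A := by
    obtain ⟨r, hr⟩ := far1 1 one_pos
    refine bdd_of_small hR.hu.continuous (r := r) (B := 2) (fun y hy => ?_)
    have := abs_le.1 (hr y hy)
    rw [abs_le]; constructor <;> linarith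
  obtain ⟨K2, K2p, hK2⟩ : ∃ A > (0:ℝ), ∀ y, |v y| ≤ A := by
    obtain ⟨r, hr⟩ := far2 1 one_pos
    exact bdd_of_small hR.hv.continuous hr
  set K := K1 + K2 with hK
  have Kp : 0 < K := by positivity
  have bu : ∀ y, |u y| ≤ K := fun y => (hK1 y).trans (by linarith)
  have bv : ∀ y, |v y| ≤ K := fun y => (hK2 y).trans (by linarith)
  obtain ⟨A, Ap, hA⟩ := grad_bdd hR Kp bu bv
  set N := c * A + K * (1 + 2 * K ^ 2) with hN
  have N0 : 0 ≤ N := by positivity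
  have nl : ∀ y, |1 - (u y ^ 2 + v y ^ 2)| ≤ 1 + 2 * K ^ 2 := by
    intro y
    have q1 : u y ^ 2 ≤ K ^ 2 := by rw [← sq_abs]; exact pow_le_pow_left₀ (abs_nonneg _) (bu _) 2
    have q2 : v y ^ 2 ≤ K ^ 2 := by rw [← sq_abs]; exact pow_le_pow_left₀ (abs_nonneg _) (bv _) 2
    rw [abs_le]
    constructor <;> nlinarith [sq_nonneg (u y), sq_nonneg (v y)]
  have lu : ∀ y, |px (px u) y + py (py u) y| ≤ N := by
    intro y
    have e : px (px u) y + py (py u) y = c * py v y - u y * (1 - (u y ^ 2 + v y ^ 2)) := by linarith [hR.eqA y]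
    rw [e]
    refine (abs_sub _ _).trans ?_
    rw [abs_mul, abs_mul, abs_of_pos hc1]
    exact add_le_add (mul_le_mul_of_nonneg_left (hA y).2 hc1.le) (mul_le_mul (bu y) (nl y) (abs_nonneg _) Kp.le)
  have lv : ∀ y, |px (px v) y + py (py v) y| ≤ N := by
    intro y
    have e : px (px v) y + py (py v) y = - (c * py u y) - v y * (1 - (u y ^ 2 + v y ^ 2)) := by linarith [hR.eqB y]
    rw [e]
    refine (abs_sub _ _).trans ?_
    rw [abs_neg, abs_mul, abs_mul, abs_of_pos hc1]
    exact add_le_add (mul_le_mul_of_nonneg_left (hA y).1 hc1.le) (mul_le_mul (bv y) (nl y) (abs_nonneg _) Kp.le)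
  have gu := grad_small (f := fun y => u y - 1) (hR.hu.sub contDiff_const) N0
    (by rw [px_sub_const, py_sub_const]; exact lu) far1
  rw [px_sub_const, py_sub_const] at gu
  have gv := grad_small hR.hv N0 lv far2
  -- lifting
  obtain ⟨R', hR'⟩ := far (1 / 2) (by norm_num)
  set R := max R' 1 with hRd
  have R1 : 1 ≤ R := le_max_right _ _
  have Rp : 0 < R := by linarith
  have hUR : ∀ y, R ≤ ‖y‖ → ‖U y - 1‖ ≤ 1 / 2 := fun y hy => hR' y ((le_max_left _ _).trans hy)
  have w2 := tw_lift h2 Rp hUR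
  set w : Euc 2 → ℂ := fun y => ((1 - eta R y : ℝ) : ℂ) * Complex.log (U y) with hw
  have U0 : ∀ y, R ≤ ‖y‖ → U y ≠ 0 := by
    intro y hy h0
    have := hUR y hy
    rw [h0] at this; norm_num at this
  have wlog : ∀ y, 2 * R ≤ ‖y‖ → w y = Complex.log (U y) := by
    intro y hy; simp only [hw]; rw [eta_zero Rp hy]; simp
  have wexp : ∀ y, 2 * R ≤ ‖y‖ → U y = Complex.exp (w y) := by
    intro y hy; rw [wlog y hy, Complex.exp_log (U0 y (by linarith))]
  set s : Euc 2 → ℝ := fun y => (w y).re with hs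
  set φ : Euc 2 → ℝ := fun y => (w y).im with hφ
  have s2 : ContDiff ℝ 2 s := Complex.reCLM.contDiff.comp w2
  have φ2 : ContDiff ℝ 2 φ := Complex.imCLM.contDiff.comp w2
  have pol := polar (r := 2 * R) hR s2 φ2
    (fun y hy => by simp only [hu, wexp y hy.le, Complex.exp_re, hs, hφ])
    (fun y hy => by simp only [hv, wexp y hy.le, Complex.exp_im, hs, hφ])
  have nU : ∀ y, 2 * R ≤ ‖y‖ → Real.exp (2 * s y) = ‖U y‖ ^ 2 := by
    intro y hy
    rw [wexp y hy, Complex.norm_exp, ← Real.exp_nat_mul]; norm_num [hs]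
  have lowU : ∀ y, 2 * R ≤ ‖y‖ → 1 / 4 ≤ Real.exp (2 * s y) := by
    intro y hy
    rw [nU y hy]
    have a := hUR y (by linarith)
    have b := norm_sub_norm_le (1 : ℂ) (1 - U y)
    rw [norm_one, sub_sub_cancel, norm_sub_rev] at b
    nlinarith
  have gx : ∀ y, 2 * R < ‖y‖ → px s y ^ 2 + px φ y ^ 2 ≤ 4 * (px u y ^ 2 + px v y ^ 2) := by
    intro y hy
    rw [(pol y hy).2.2.1]
    nlinarith [lowU y hy.le, sq_nonneg (px s y), sq_nonneg (px φ y)]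
  have gy : ∀ y, 2 * R < ‖y‖ → py s y ^ 2 + py φ y ^ 2 ≤ 4 * (py u y ^ 2 + py v y ^ 2) := by
    intro y hy
    rw [(pol y hy).2.2.2]
    nlinarith [lowU y hy.le, sq_nonneg (py s y), sq_nonneg (py φ y)]
  have wl : Tendsto (fun y => Complex.log (U y)) (cocompact (Euc 2)) (𝓝 0) := by
    have := (continuousAt_clog (x := 1) (by simp)).tendsto.comp hlim
    simpa [Function.comp_def] using this
  have farw : ∀ ε > (0:ℝ), ∃ r, ∀ y, r ≤ ‖y‖ → |s y| ≤ ε ∧ |φ y| ≤ ε := by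
    intro ε hε
    obtain ⟨r, hr⟩ := far_of_tendsto wl ε hε
    refine ⟨max r (2 * R), fun y hy => ?_⟩
    have a := hr y ((le_max_left _ _).trans hy)
    rw [sub_zero, ← wlog y ((le_max_right _ _).trans hy)] at a
    exact ⟨(Complex.abs_re_le_norm _).trans a, (Complex.abs_im_le_norm _).trans a⟩
  refine ⟨2 * R + 1, s, φ, ⟨hc1, ?_, by linarith, s2, φ2, fun y hy => (pol y (by linarith)).1, fun y hy => (pol y (by linarith)).2.1, ?_, ?_⟩, fun y hy => wexp y (by linarith)⟩
  · calc c ^ 2 < Real.sqrt 2 ^ 2 := pow_lt_pow_left₀ hc2 hc1.le (by norm_num)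
      _ = 2 := by norm_num
  · intro ε hε
    obtain ⟨r1, h1⟩ := farw ε hε
    obtain ⟨r2, h2'⟩ := gu (ε / 4) (by positivity)
    obtain ⟨r3, h3⟩ := gv (ε / 4) (by positivity)
    refine ⟨max (max r1 r2) (max r3 (2 * R + 1)), fun y hy => ?_⟩
    have y1 : r1 ≤ ‖y‖ := ((le_max_left _ _).trans (le_max_left _ _)).trans hy
    have y2 : r2 ≤ ‖y‖ := ((le_max_right _ _).trans (le_max_left _ _)).trans hy
    have y3 : r3 ≤ ‖y‖ := ((le_max_left _ _).trans (le_max_right _ _)).trans hy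
    have y4 : 2 * R + 1 ≤ ‖y‖ := ((le_max_right _ _).trans (le_max_right _ _)).trans hy
    have sq : ∀ t : ℝ, |t| ≤ ε / 4 → t ^ 2 ≤ ε ^ 2 / 16 := by
      intro t ht
      calc t ^ 2 = |t| ^ 2 := (sq_abs t).symm
        _ ≤ (ε / 4) ^ 2 := pow_le_pow_left₀ (abs_nonneg _) ht 2
        _ = _ := by ring
    have q1 := sq _ (h2' y y2).1
    have q2 := sq _ (h2' y y2).2
    have q3 := sq _ (h3 y y3).1
    have q4 := sq _ (h3 y y3).2
    have x1 := gx y (by linarith)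
    have x2 := gy y (by linarith)
    refine ⟨(h1 y y1).1, (h1 y y1).2, ?_, ?_, ?_, ?_⟩ <;> apply abs_le_of_sq_le_sq _ hε.le
    · linarith [sq_nonneg (px φ y), sq_nonneg ε]
    · linarith [sq_nonneg (py φ y), sq_nonneg ε]
    · linarith [sq_nonneg (px s y), sq_nonneg ε]
    · linarith [sq_nonneg (py s y), sq_nonneg ε]
  · obtain ⟨r1, h1⟩ := farw (1 / 2) (by norm_num)
    set r := max r1 (2 * R + 1) with hr
    have ie := int_energy h2 hE
    have cX : Continuous (XX s φ) := by
      have := s2.continuous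
      have := px_cont (s2.of_le (by norm_num))
      have := py_cont (s2.of_le (by norm_num))
      have := px_cont (φ2.of_le (by norm_num))
      have := py_cont (φ2.of_le (by norm_num))
      unfold XX; fun_prop
    obtain ⟨B, hB⟩ := (isCompact_closedBall (0 : Euc 2) r).exists_bound_of_continuousOn cX.continuousOn
    have ib : Integrable ((closedBall (0 : Euc 2) r).indicator (XX s φ)) :=
      (cX.continuousOn.integrableOn_compact (isCompact_closedBall _ _)).integrable_indicator measurableSet_closedBall
    have iN := ib.add (ie.const_mul 16)
    refine iN.mono' cX.aestronglyMeasurable (Eventually.of_forall fun y => ?_)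
    have X0 : 0 ≤ XX s φ y := by unfold XX; positivity
    rw [Real.norm_eq_abs, abs_of_nonneg X0]
    simp only [Pi.add_apply]
    by_cases hy : ‖y‖ ≤ r
    · rw [Set.indicator_of_mem (by simpa using hy)]
      have : 0 ≤ 16 * (‖fderiv ℝ U y‖ ^ 2 / 2 + (1 - ‖U y‖ ^ 2) ^ 2 / 4) := by positivity
      linarith
    · rw [Set.indicator_of_notMem (by simpa using hy), zero_add]
      push Not at hy
      have y1 : r1 ≤ ‖y‖ := (le_max_left _ _).trans hy.le
      have y4 : 2 * R + 1 ≤ ‖y‖ := (le_max_right _ _).trans hy.le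
      have x1 := gx y (by linarith)
      have x2 := gy y (by linarith)
      have x3 := s_sq_le (h1 y y1).1
      rw [nU y (by linarith)] at x3
      have dU := h2.differentiable (by norm_num)
      have z : ∀ i : Fin 2, ‖fderiv ℝ U y (basisVec i)‖ ^ 2 ≤ ‖fderiv ℝ U y‖ ^ 2 := by
        intro i
        apply pow_le_pow_left₀ (norm_nonneg _)
        have := (fderiv ℝ U y).le_opNorm (basisVec i)
        simpa [norm_basisVec] using this
      have z1 : px u y ^ 2 + px v y ^ 2 = ‖fderiv ℝ U y (basisVec 0)‖ ^ 2 := by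
        have a : px u y = (fderiv ℝ U y (basisVec 0)).re := re_fd dU y _
        have b : px v y = (fderiv ℝ U y (basisVec 0)).im := im_fd dU y _
        rw [a, b, Complex.sq_norm, Complex.normSq_apply]; ring
      have z2 : py u y ^ 2 + py v y ^ 2 = ‖fderiv ℝ U y (basisVec 1)‖ ^ 2 := by
        have a : py u y = (fderiv ℝ U y (basisVec 1)).re := re_fd dU y _
        have b : py v y = (fderiv ℝ U y (basisVec 1)).im := im_fd dU y _
        rw [a, b, Complex.sq_norm, Complex.normSq_apply]; ring
      rw [z1] at x1
      rw [z2] at x2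
      have := z 0
      have := z 1
      unfold XX
      linarith [sq_nonneg (1 - ‖U y‖ ^ 2)]

lemma final_decay {c : ℝ} (hc1 : 0 < c) (hc2 : c < Real.sqrt 2) {U : Euc 2 → ℂ} (hTW : IsTravelingWave c U) (hE : glEnergy U < ⊤)
    (hlim : Tendsto U (Filter.cocompact (Euc 2)) (nhds 1)) : ∃ C : ℝ, 0 < C ∧ ∀ y : Euc 2, ‖U y - 1‖ ≤ C / jap y := by
  obtain ⟨R0, s, φ, h, hU⟩ := TW_exists hc1 hc2 hTW hE hlim
  obtain ⟨C1, C1p, hφ⟩ := phi_decay h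
  obtain ⟨C2, C2p, R2, R2p, hs⟩ := s_decay h
  set R := max (max R0 R2) (C1 + C2) with hR
  have Rp : 1 ≤ R := R2p.trans ((le_max_right _ _).trans (le_max_left _ _))
  obtain ⟨B, hB⟩ := (isCompact_closedBall (0 : Euc 2) R).exists_bound_of_continuousOn (hTW.1.continuous.sub continuous_const : Continuous fun y => U y - 1).continuousOn
  have B0 : 0 ≤ B := (norm_nonneg _).trans (hB 0 (by simp; linarith))
  refine ⟨B * (1 + R) + 4 * (C1 + C2), by positivity, fun y => ?_⟩
  have jp : 0 < jap y := Real.sqrt_pos.2 (by positivity)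
  have j1 : jap y ≤ 1 + ‖y‖ := by
    apply Real.sqrt_le_iff.2
    constructor
    · positivity
    · nlinarith [norm_nonneg y]
  rw [le_div_iff₀ jp]
  by_cases hy : ‖y‖ ≤ R
  · have := hB y (by simpa using hy)
    calc _ ≤ B * (1 + R) := mul_le_mul this (by linarith) jp.le B0
      _ ≤ _ := by linarith
  · push Not at hy
    have y1 : R0 ≤ ‖y‖ := ((le_max_left _ _).trans (le_max_left _ _)).trans hy.le
    have y2 : R2 ≤ ‖y‖ := ((le_max_right _ _).trans (le_max_left _ _)).trans hy.le
    have y3 : C1 + C2 ≤ ‖y‖ := (le_max_right _ _).trans hy.le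
    have yp : 0 < ‖y‖ := by linarith
    have a := hφ y (by linarith)
    have b := hs y y2
    have n1 : ‖(⟨s y, φ y⟩ : ℂ)‖ ≤ (C1 + C2) / ‖y‖ := by
      have := Complex.norm_le_abs_re_add_abs_im (⟨s y, φ y⟩ : ℂ)
      simp only at this
      rw [add_div]; linarith
    have n2 : ‖(⟨s y, φ y⟩ : ℂ)‖ ≤ 1 := n1.trans ((div_le_one yp).2 y3)
    have n3 := Complex.norm_exp_sub_one_le n2
    rw [← hU y y1] at n3
    calc ‖U y - 1‖ * jap y ≤ (2 * ((C1 + C2) / ‖y‖)) * (2 * ‖y‖) := by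
          apply mul_le_mul (n3.trans (by linarith)) (by linarith) jp.le (by positivity)
      _ = 4 * (C1 + C2) := by field_simp; ring
      _ ≤ _ := by
        have : 0 ≤ B * (1 + R) := by positivity
        linarith

/-- For `0 < c < √2`, a traveling wave `U_c` (finite energy, normalized
so that `U → 1` at infinity) satisfies `U_c(y) − 1 = O(⟨y⟩⁻¹)` as `|y| → ∞`. -/
theorem statement13 (c : ℝ) (hc1 : 0 < c) (hc2 : c < Real.sqrt 2)
    (U : Euc 2 → ℂ) (hTW : IsTravelingWave c U) (hE : glEnergy U < ⊤)
    (hlim : Tendsto U (Filter.cocompact (Euc 2)) (nhds 1)) :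
    ∃ C : ℝ, 0 < C ∧ ∀ y : Euc 2, ‖U y - 1‖ ≤ C / jap y := by
  exact final_decay hc1 hc2 hTW hE hlim
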